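/- arXiv:1102.4250 — 2 statements merged into one kernel-verified Lean document; each statement's English description precedes it below -/
import Mathlib

section
/- Let m, n ≥ 1 and V = mV_1 ⊕ nV_2 (m copies of V_1 and n copies of V_2), and let R = O(V)^{SL(2,ℂ)}. If 2n + 1 ≥ m, then R has a homogeneous system of parameters consisting of m + 2n − 2 invariants of degree 2 and m + n − 1 invariants of degree 3. -/
open MvPolynomial

noncomputable section

namespace BinInv

/-- `k`-fold partial derivative with respect to the variable `v`. -/
def pd {A : Type*} [CommSemiring A] (v : Fin 2) (k : ℕ)
    (f : MvPolynomial (Fin 2) A) : MvPolynomial (Fin 2) A :=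
  (fun g => MvPolynomial.pderiv v g)^[k] f

/-- The `p`-th transvectant of binary forms `g`, `h` of degrees `m`, `n`,
with coefficients in a commutative `ℂ`-algebra `A`. -/
def transvectant {A : Type*} [CommRing A] [Algebra ℂ A] (m n p : ℕ)
    (g h : MvPolynomial (Fin 2) A) : MvPolynomial (Fin 2) A :=
  algebraMap ℂ (MvPolynomial (Fin 2) A)
      ((((m - p).factorial * (n - p).factorial : ℕ) : ℂ) /
        (((m.factorial * n.factorial : ℕ)) : ℂ)) *
    ∑ i ∈ Finset.range (p + 1),
      algebraMap ℂ (MvPolynomial (Fin 2) A) ((-1 : ℂ) ^ i * (p.choose i : ℂ)) *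
        (pd 0 (p - i) (pd 1 i g) * pd 0 i (pd 1 (p - i) h))

variable {p : ℕ}

/-- Index type for the coefficients of a system of binary forms of degrees `n 0, …, n (p-1)`:
the space `V = V_{n 0} ⊕ … ⊕ V_{n (p-1)}` is identified with `Idx n → ℂ`. -/
abbrev Idx (n : Fin p → ℕ) : Type := Σ i : Fin p, Fin (n i + 1)

/-- The binary form of degree `n i` with coefficient vector `c`. -/
def formAt (n : Fin p → ℕ) (c : Idx n → ℂ) (i : Fin p) : MvPolynomial (Fin 2) ℂ :=
  ∑ k : Fin (n i + 1), C (c ⟨i, k⟩) * X 0 ^ (n i - (k : ℕ)) * X 1 ^ (k : ℕ)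

/-- The substitution action of `SL(2,ℂ)` on binary forms: `(g • f)(v) = f (g⁻¹ • v)`. -/
def sl2Act (g : Matrix.SpecialLinearGroup (Fin 2) ℂ) (f : MvPolynomial (Fin 2) ℂ) :
    MvPolynomial (Fin 2) ℂ :=
  aeval (fun i => ∑ j, C ((↑(g⁻¹) : Matrix (Fin 2) (Fin 2) ℂ) i j) * X j) f

/-- The coefficient of `x^(n-k) y^k` in a binary form. -/
def coeffAt (n : Fin p → ℕ) (j : Idx n) (f : MvPolynomial (Fin 2) ℂ) : ℂ :=
  MvPolynomial.coeff
    (Finsupp.single 0 (n j.1 - (j.2 : ℕ)) + Finsupp.single 1 (j.2 : ℕ)) f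

/-- The induced action of `SL(2,ℂ)` on points of `V`, in coefficient coordinates. -/
def actPt (n : Fin p → ℕ) (g : Matrix.SpecialLinearGroup (Fin 2) ℂ) (c : Idx n → ℂ) :
    Idx n → ℂ :=
  fun j => coeffAt n j (sl2Act g (formAt n c j.1))

/-- A polynomial function on `V` is invariant if it is constant on `SL(2,ℂ)`-orbits. -/
def IsInvariant (n : Fin p → ℕ) (P : MvPolynomial (Idx n) ℂ) : Prop :=
  ∀ (g : Matrix.SpecialLinearGroup (Fin 2) ℂ) (c : Idx n → ℂ),
    eval (actPt n g c) P = eval c P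

/-- The invariant ring `R = O(V)^{SL(2,ℂ)}` as a subalgebra of `O(V)`. -/
def invariantRing (n : Fin p → ℕ) : Subalgebra ℂ (MvPolynomial (Idx n) ℂ) where
  carrier := {P | IsInvariant n P}
  mul_mem' := fun ha hb g c => by
    simp only [map_mul]; rw [ha g c, hb g c]
  one_mem' := fun g c => by simp
  add_mem' := fun ha hb g c => by
    simp only [map_add]; rw [ha g c, hb g c]
  zero_mem' := fun g c => by simp
  algebraMap_mem' := fun r g c => by simp

/-- The nullcone: the points of `V` where every homogeneous invariant of positive
degree vanishes. -/
def Nullcone (n : Fin p → ℕ) : Set (Idx n → ℂ) :=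
  {c | ∀ P ∈ invariantRing n, ∀ d : ℕ, 0 < d → P.IsHomogeneous d → eval c P = 0}

/-- `P` is a homogeneous system of parameters of the invariant ring, with degrees `d`:
the `P j` are homogeneous invariants of positive degrees `d j`, algebraically independent
over `ℂ`, and the invariant ring is integral over the subalgebra they generate. -/
def IsHSOP (n : Fin p → ℕ) {k : ℕ} (P : Fin k → MvPolynomial (Idx n) ℂ)
    (d : Fin k → ℕ) : Prop :=
  (∀ j, P j ∈ invariantRing n) ∧ (∀ j, 0 < d j) ∧
    (∀ j, (P j).IsHomogeneous (d j)) ∧ AlgebraicIndependent ℂ P ∧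
    ∀ x ∈ invariantRing n, IsIntegral (↥(Algebra.adjoin ℂ (Set.range P))) x

/-- `r` is the minimal number of generators of the invariant ring. -/
def IsMinimalNumGens (n : Fin p → ℕ) (r : ℕ) : Prop :=
  IsLeast {k | ∃ S : Finset (MvPolynomial (Idx n) ℂ),
    S.card = k ∧ Algebra.adjoin ℂ (S : Set (MvPolynomial (Idx n) ℂ)) = invariantRing n} r

/-- The invariant ring has minimal number of generators `r`, realized by a minimal
system of homogeneous generators of degrees `d 0, …, d (r-1)`. -/
def HasMinimalGens (n : Fin p → ℕ) {r : ℕ} (d : Fin r → ℕ) : Prop :=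
  IsMinimalNumGens n r ∧
    ∃ G : Fin r → MvPolynomial (Idx n) ℂ, Function.Injective G ∧
      (∀ j, (G j).IsHomogeneous (d j)) ∧
      Algebra.adjoin ℂ (Set.range G) = invariantRing n

/-- The generic binary form of degree `n i`, whose coefficients are the corresponding
coordinate functions on `V`. -/
def genForm (n : Fin p → ℕ) (i : Fin p) :
    MvPolynomial (Fin 2) (MvPolynomial (Idx n) ℂ) :=
  ∑ k : Fin (n i + 1), C (X ⟨i, k⟩) * X 0 ^ (n i - (k : ℕ)) * X 1 ^ (k : ℕ)

end BinInv

end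

namespace BinInv

/-- A system of linear forms `p i * x + q i * y` and of quadratic forms
`a k * x ^ 2 + b k * x * y + c k * y ^ 2` over `A`. -/
@[ext]
structure FormSystem (ι κ A : Type*) where
  p : ι → A
  q : ι → A
  a : κ → A
  b : κ → A
  c : κ → A

namespace FormSystem

variable {ι κ A B : Type*}

/-- Apply a function to all coefficients. -/
def map (φ : A → B) (s : FormSystem ι κ A) : FormSystem ι κ B :=
  ⟨φ ∘ s.p, φ ∘ s.q, φ ∘ s.a, φ ∘ s.b, φ ∘ s.c⟩

/-- The coefficients of a system as a single family. -/
def coord (s : FormSystem ι κ A) : (ι × Fin 2) ⊕ (κ × Fin 3) → A :=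
  Sum.elim (fun x => ![s.p x.1, s.q x.1] x.2) (fun x => ![s.a x.1, s.b x.1, s.c x.1] x.2)

/-- The system with a given family of coefficients. -/
def ofCoord (w : (ι × Fin 2) ⊕ (κ × Fin 3) → A) : FormSystem ι κ A :=
  ⟨fun i => w (.inl (i, 0)), fun i => w (.inl (i, 1)), fun k => w (.inr (k, 0)),
    fun k => w (.inr (k, 1)), fun k => w (.inr (k, 2))⟩

theorem coord_ofCoord (w : (ι × Fin 2) ⊕ (κ × Fin 3) → A) : (ofCoord w).coord = w := by
  funext t
  rcases t with ⟨i, e⟩ | ⟨i, e⟩ <;> fin_cases e <;> rfl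

theorem map_ofCoord (φ : A → B) (w : (ι × Fin 2) ⊕ (κ × Fin 3) → A) :
    (ofCoord w).map φ = ofCoord (φ ∘ w) := rfl

theorem coord_mem {S : Type*} [SetLike S A] {E : S} (s : FormSystem ι κ A)
    (hp : ∀ i, s.p i ∈ E) (hq : ∀ i, s.q i ∈ E) (ha : ∀ k, s.a k ∈ E) (hb : ∀ k, s.b k ∈ E)
    (hc : ∀ k, s.c k ∈ E) (t) : s.coord t ∈ E := by
  rcases t with ⟨i, e⟩ | ⟨i, e⟩ <;> fin_cases e
  exacts [hp i, hq i, ha i, hb i, hc i]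

variable [CommRing A] [CommRing B]

/-- The linear substitution `x ↦ α x + β y`, `y ↦ γ x + δ y`. -/
def act (α β γ δ : A) (s : FormSystem ι κ A) : FormSystem ι κ A where
  p i := s.p i * α + s.q i * γ
  q i := s.p i * β + s.q i * δ
  a k := s.a k * α ^ 2 + s.b k * (α * γ) + s.c k * γ ^ 2
  b k := 2 * s.a k * (α * β) + s.b k * (α * δ + β * γ) + 2 * s.c k * (γ * δ)
  c k := s.a k * β ^ 2 + s.b k * (β * δ) + s.c k * δ ^ 2

/-- Multiply all forms by a scalar. -/
def scale (t : A) (s : FormSystem ι κ A) : FormSystem ι κ A :=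
  s.map (t * ·)

/-- The basic invariants of degree two: brackets of linear forms, and the polarized
discriminants of quadratic forms. -/
def deg2 (s : FormSystem ι κ A) : (ι × ι) ⊕ (κ × κ) → A :=
  Sum.elim (fun x => s.p x.1 * s.q x.2 - s.p x.2 * s.q x.1)
    (fun x => s.b x.1 * s.b x.2 - 2 * s.a x.1 * s.c x.2 - 2 * s.a x.2 * s.c x.1)

/-- The basic invariants of degree three: polarized values of quadratic forms at the roots of linear
forms, and determinants of triples of quadratic forms. -/
def deg3 (s : FormSystem ι κ A) : (κ × ι × ι) ⊕ (κ × κ × κ) → A :=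
  Sum.elim (fun x => 2 * s.a x.1 * s.q x.2.1 * s.q x.2.2
      - s.b x.1 * (s.p x.2.1 * s.q x.2.2 + s.p x.2.2 * s.q x.2.1)
      + 2 * s.c x.1 * s.p x.2.1 * s.p x.2.2)
    (fun x => s.a x.1 * (s.b x.2.1 * s.c x.2.2 - s.c x.2.1 * s.b x.2.2)
      - s.b x.1 * (s.a x.2.1 * s.c x.2.2 - s.c x.2.1 * s.a x.2.2)
      + s.c x.1 * (s.a x.2.1 * s.b x.2.2 - s.b x.2.1 * s.a x.2.2))

theorem deg2_act {α β γ δ : A} (h : α * δ - β * γ = 1) (s : FormSystem ι κ A) :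
    (s.act α β γ δ).deg2 = s.deg2 := by
  funext l
  rcases l with ⟨i, j⟩ | ⟨k, l⟩ <;> simp only [deg2, act, Sum.elim_inl, Sum.elim_inr]
  · linear_combination (s.p i * s.q j - s.p j * s.q i) * h
  · linear_combination (s.b k * s.b l - 2 * s.a k * s.c l - 2 * s.a l * s.c k) *
      (α * δ - β * γ + 1) * h

theorem deg3_act {α β γ δ : A} (h : α * δ - β * γ = 1) (s : FormSystem ι κ A) :
    (s.act α β γ δ).deg3 = s.deg3 := by
  funext l
  rcases l with ⟨k, i, j⟩ | ⟨k, l, r⟩ <;> simp only [deg3, act, Sum.elim_inl, Sum.elim_inr]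
  · linear_combination (2 * s.a k * s.q i * s.q j - s.b k * (s.p i * s.q j + s.p j * s.q i)
      + 2 * s.c k * s.p i * s.p j) * (α * δ - β * γ + 1) * h
  · linear_combination (s.a k * (s.b l * s.c r - s.c l * s.b r)
      - s.b k * (s.a l * s.c r - s.c l * s.a r) + s.c k * (s.a l * s.b r - s.b l * s.a r)) *
      ((α * δ - β * γ) ^ 2 + (α * δ - β * γ) + 1) * h

theorem deg2_scale (t : A) (s : FormSystem ι κ A) (l) :
    (s.scale t).deg2 l = t ^ 2 * s.deg2 l := by
  rcases l with ⟨i, j⟩ | ⟨k, l⟩ <;>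
    simp only [deg2, scale, map, Function.comp, Sum.elim_inl, Sum.elim_inr] <;> ring

theorem deg3_scale (t : A) (s : FormSystem ι κ A) (l) :
    (s.scale t).deg3 l = t ^ 3 * s.deg3 l := by
  rcases l with ⟨k, i, j⟩ | ⟨k, l, r⟩ <;>
    simp only [deg3, scale, map, Function.comp, Sum.elim_inl, Sum.elim_inr] <;> ring

theorem deg2_map (φ : A →+* B) (s : FormSystem ι κ A) (l) :
    (s.map φ).deg2 l = φ (s.deg2 l) := by
  rcases l with ⟨i, j⟩ | ⟨k, l⟩ <;> simp [deg2, map, map_ofNat φ 2]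

theorem deg3_map (φ : A →+* B) (s : FormSystem ι κ A) (l) :
    (s.map φ).deg3 l = φ (s.deg3 l) := by
  rcases l with ⟨k, i, j⟩ | ⟨k, l, r⟩ <;> simp [deg3, map, map_ofNat φ 2]

theorem deg2_mem {S : Type*} [SetLike S A] [SubringClass S A] {E : S} (s : FormSystem ι κ A)
    (h : ∀ t, s.coord t ∈ E) (l) : s.deg2 l ∈ E := by
  have hp i : s.p i ∈ E := h (.inl (i, 0))
  have hq i : s.q i ∈ E := h (.inl (i, 1))
  have ha i : s.a i ∈ E := h (.inr (i, 0))
  have hb i : s.b i ∈ E := h (.inr (i, 1))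
  have hc i : s.c i ∈ E := h (.inr (i, 2))
  have h2 : (2 : A) ∈ E := ofNat_mem E 2
  rcases l with ⟨i, j⟩ | ⟨k, l⟩ <;> simp only [deg2, Sum.elim_inl, Sum.elim_inr] <;>
    apply_rules [add_mem, sub_mem, mul_mem]

theorem deg3_mem {S : Type*} [SetLike S A] [SubringClass S A] {E : S} (s : FormSystem ι κ A)
    (h : ∀ t, s.coord t ∈ E) (l) : s.deg3 l ∈ E := by
  have hp i : s.p i ∈ E := h (.inl (i, 0))
  have hq i : s.q i ∈ E := h (.inl (i, 1))
  have ha i : s.a i ∈ E := h (.inr (i, 0))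
  have hb i : s.b i ∈ E := h (.inr (i, 1))
  have hc i : s.c i ∈ E := h (.inr (i, 2))
  have h2 : (2 : A) ∈ E := ofNat_mem E 2
  rcases l with ⟨k, i, j⟩ | ⟨k, l, r⟩ <;> simp only [deg3, Sum.elim_inl, Sum.elim_inr] <;>
    apply_rules [add_mem, sub_mem, mul_mem]

end FormSystem
end BinInv

namespace BinInv

section IntegralModel

variable {K : Type*} [Field K]

theorem exists_diagonalize [IsAlgClosed K] (a b c : K) :
    ∃ α β γ δ : K, α * δ - β * γ = 1 ∧ a * β ^ 2 + b * (β * δ) + c * δ ^ 2 = 0 ∧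
      (a * α ^ 2 + b * (α * γ) + c * γ ^ 2 = 0 ∨
        2 * a * (α * β) + b * (α * δ + β * γ) + 2 * c * (γ * δ) = 0) := by
  by_cases ha : a = 0
  · subst ha
    by_cases hb : b = 0
    · exact ⟨0, 1, -1, 0, by ring, by ring, .inr (by rw [hb]; ring)⟩
    · refine ⟨c / b, 1, -1, 0, by ring, by ring, .inl ?_⟩
      field_simp
      ring
  · obtain ⟨β, hβ⟩ := IsAlgClosed.exists_root
      (Polynomial.C a * Polynomial.X ^ 2 + Polynomial.C b * Polynomial.X + Polynomial.C c)
      (by rw [Polynomial.degree_quadratic ha]; decide)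
    simp only [Polynomial.IsRoot, Polynomial.eval_add, Polynomial.eval_mul, Polynomial.eval_C,
      Polynomial.eval_pow, Polynomial.eval_X] at hβ
    by_cases hb : 2 * a * β + b = 0
    · exact ⟨1, β, 0, 1, by ring, by linear_combination hβ, .inr (by linear_combination hb)⟩
    · obtain ⟨γ, hγ⟩ : ∃ γ, a + (2 * a * β + b) * γ = 0 :=
        ⟨-a / (2 * a * β + b), by rw [mul_div_cancel₀ _ hb]; ring⟩
      exact ⟨1 + β * γ, β, γ, 1, by ring, by linear_combination hβ,
        .inl (by linear_combination hγ + γ ^ 2 * hβ)⟩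

variable (B : ValuationSubring K)

theorem mem_of_add_mem_of_mul_mem {x y : K} (h : x + y ∈ B) (h' : x * y ∈ B) : x ∈ B := by
  rcases B.mem_or_inv_mem x with hx | hx
  · exact hx
  · by_cases h0 : x = 0
    · rw [h0]; exact B.zero_mem
    · have : y ∈ B := by
        have := B.mul_mem _ _ h' hx
        rwa [mul_comm x y, mul_assoc, mul_inv_cancel₀ h0, mul_one] at this
      simpa using B.sub_mem h this

theorem mem_of_sq_mem {x : K} (h : x ^ 2 ∈ B) : x ∈ B := by
  rcases B.mem_or_inv_mem x with hx | hx
  · exact hx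
  · by_cases h0 : x = 0
    · rw [h0]; exact B.zero_mem
    · have := B.mul_mem _ _ h hx
      rwa [pow_two, mul_assoc, mul_inv_cancel₀ h0, mul_one] at this

theorem exists_forall_div_mem {κ : Type*} [Finite κ] (a : κ → K) (h : ∃ k, a k ≠ 0) :
    ∃ k, a k ≠ 0 ∧ ∀ l, a l / a k ∈ B := by
  obtain ⟨k₀, hk₀⟩ := h
  have : Nonempty κ := ⟨k₀⟩
  obtain ⟨k, hk⟩ := Finite.exists_max fun k => B.valuation (a k)
  have hne : a k ≠ 0 := by
    intro h0
    have := hk k₀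
    simp [h0, hk₀] at this
  refine ⟨k, hne, fun l => ?_⟩
  rw [← B.valuation_le_one_iff, map_div₀]
  exact div_le_one_of_le₀ (hk l) zero_le

theorem exists_torus [IsAlgClosed K] {κ : Type*} [Finite κ] (a c : κ → K)
    (h : ∀ k l, a k * c l ∈ B) :
    ∃ s : K, s ≠ 0 ∧ ∀ k, s ^ 2 * a k ∈ B ∧ (s ^ 2)⁻¹ * c k ∈ B := by
  by_cases ha : ∃ k, a k ≠ 0
  · obtain ⟨k, hk, hk'⟩ := exists_forall_div_mem B a ha
    obtain ⟨s, hs⟩ := IsAlgClosed.exists_pow_nat_eq (a k)⁻¹ (n := 2) (by norm_num)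
    refine ⟨s, fun h0 => ?_, fun l => ⟨?_, ?_⟩⟩
    · rw [h0, zero_pow two_ne_zero] at hs
      exact inv_ne_zero hk hs.symm
    · rw [hs, mul_comm, ← div_eq_mul_inv]; exact hk' l
    · rw [hs, inv_inv]; exact h k l
  · push Not at ha
    by_cases hc : ∃ k, c k ≠ 0
    · obtain ⟨k, hk, hk'⟩ := exists_forall_div_mem B c hc
      obtain ⟨s, hs⟩ := IsAlgClosed.exists_pow_nat_eq (c k) (n := 2) (by norm_num)
      refine ⟨s, fun h0 => ?_, fun l => ⟨?_, ?_⟩⟩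
      · rw [h0, zero_pow two_ne_zero] at hs
        exact hk hs.symm
      · rw [ha, mul_zero]; exact B.zero_mem
      · rw [hs, mul_comm, ← div_eq_mul_inv]; exact hk' l
    · push Not at hc
      exact ⟨1, one_ne_zero, fun k => by simp [ha, hc]⟩

/-- Quadratic forms whose polarized discriminants are integral have a common integral model. -/
theorem exists_integral_model [IsAlgClosed K] (h2 : (2 : K)⁻¹ ∈ B) (h20 : (2 : K) ≠ 0)
    {κ : Type*} [Finite κ] (a b c : κ → K)
    (h : ∀ k l, b k * b l - 2 * a k * c l - 2 * a l * c k ∈ B) :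
    ∃ α β γ δ : K, α * δ - β * γ = 1 ∧ ∀ k,
      a k * α ^ 2 + b k * (α * γ) + c k * γ ^ 2 ∈ B ∧
      2 * a k * (α * β) + b k * (α * δ + β * γ) + 2 * c k * (γ * δ) ∈ B ∧
      a k * β ^ 2 + b k * (β * δ) + c k * δ ^ 2 ∈ B := by
  suffices H : ∃ α β γ δ : K, α * δ - β * γ = 1 ∧
      (∀ k, 2 * a k * (α * β) + b k * (α * δ + β * γ) + 2 * c k * (γ * δ) ∈ B) ∧
      ∀ k l, (a k * α ^ 2 + b k * (α * γ) + c k * γ ^ 2) *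
        (a l * β ^ 2 + b l * (β * δ) + c l * δ ^ 2) ∈ B by
    obtain ⟨α, β, γ, δ, hdet, hb, hac⟩ := H
    obtain ⟨s, hs, hs'⟩ := exists_torus B _ _ hac
    refine ⟨s * α, s⁻¹ * β, s * γ, s⁻¹ * δ, ?_, fun k => ⟨?_, ?_, ?_⟩⟩
    · field_simp
      exact hdet
    · convert (hs' k).1 using 1
      ring
    · convert hb k using 1
      field_simp
    · convert (hs' k).2 using 1
      field_simp
  by_cases hF : ∃ x : κ × κ, b x.1 * b x.2 - 2 * a x.1 * c x.2 - 2 * a x.2 * c x.1 ≠ 0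
  · obtain ⟨⟨i, j⟩, hg, hmax⟩ := exists_forall_div_mem B _ hF
    simp only [Prod.forall] at hg hmax
    obtain ⟨g, hgdef⟩ : ∃ g, g = b i * b j - 2 * a i * c j - 2 * a j * c i := ⟨_, rfl⟩
    rw [← hgdef] at hg
    simp only [← hgdef] at hmax
    -- a form of maximal discriminant
    obtain ⟨a₀, b₀, c₀, hD, hgD, hD1, hpair⟩ : ∃ a₀ b₀ c₀ : K, b₀ ^ 2 - 4 * a₀ * c₀ ≠ 0 ∧
        g / (b₀ ^ 2 - 4 * a₀ * c₀) ∈ B ∧ b₀ ^ 2 - 4 * a₀ * c₀ ∈ B ∧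
        ∀ k, (b k * b₀ - 2 * a k * c₀ - 2 * a₀ * c k) / g ∈ B := by
      have key : ∀ a₀ b₀ c₀ : K, B.valuation ((b₀ ^ 2 - 4 * a₀ * c₀) / g) = 1 →
          b₀ ^ 2 - 4 * a₀ * c₀ ≠ 0 ∧ g / (b₀ ^ 2 - 4 * a₀ * c₀) ∈ B := by
        intro a₀ b₀ c₀ hv
        refine ⟨fun h0 => ?_, ?_⟩
        · rw [h0, zero_div, map_zero] at hv
          exact zero_ne_one hv
        · rw [← B.valuation_le_one_iff, ← inv_div, map_inv₀, hv, inv_one]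
      have hi : (b i ^ 2 - 4 * a i * c i) / g ∈ B := by convert hmax i i using 2; ring
      have hj : (b j ^ 2 - 4 * a j * c j) / g ∈ B := by convert hmax j j using 2; ring
      by_cases vi : B.valuation ((b i ^ 2 - 4 * a i * c i) / g) = 1
      · refine ⟨a i, b i, c i, (key _ _ _ vi).1, (key _ _ _ vi).2, ?_, fun k => hmax k i⟩
        convert h i i using 1; ring
      by_cases vj : B.valuation ((b j ^ 2 - 4 * a j * c j) / g) = 1
      · refine ⟨a j, b j, c j, (key _ _ _ vj).1, (key _ _ _ vj).2, ?_, fun k => hmax k j⟩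
        convert h j j using 1; ring
      have v2 : B.valuation 2 = 1 := by
        refine le_antisymm ((B.valuation_le_one_iff _).2 (ofNat_mem B 2)) ?_
        have := (B.valuation_le_one_iff _).2 h2
        rwa [map_inv₀, inv_le_one₀ (by simp [zero_lt_iff, h20])] at this
      have hij : B.valuation (((b i + b j) ^ 2 - 4 * (a i + a j) * (c i + c j)) / g) = 1 := by
        have e : ((b i + b j) ^ 2 - 4 * (a i + a j) * (c i + c j)) / g =
            ((b i ^ 2 - 4 * a i * c i) / g + (b j ^ 2 - 4 * a j * c j) / g) + 2 := by
          field_simp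
          rw [hgdef]
          ring
        rw [e, ← v2]
        refine B.valuation.map_add_eq_of_lt_right ?_
        rw [v2]
        refine B.valuation.map_add_lt (lt_of_le_of_ne ?_ vi) (lt_of_le_of_ne ?_ vj)
        exacts [(B.valuation_le_one_iff _).2 hi, (B.valuation_le_one_iff _).2 hj]
      refine ⟨a i + a j, b i + b j, c i + c j, (key _ _ _ hij).1, (key _ _ _ hij).2, ?_,
        fun k => ?_⟩
      · have := B.add_mem _ _ (B.add_mem _ _ (h i i) (h j j))
          (B.mul_mem _ _ (ofNat_mem B 2) (h i j))
        convert this using 1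
        ring
      · convert B.add_mem _ _ (hmax k i) (hmax k j) using 1
        ring
    obtain ⟨α, β, γ, δ, hdet, hc, hab⟩ := exists_diagonalize a₀ b₀ c₀
    obtain ⟨r, hr⟩ : ∃ r, r = 2 * a₀ * (α * β) + b₀ * (α * δ + β * γ) + 2 * c₀ * (γ * δ) := ⟨_, rfl⟩
    have hdisc : b₀ ^ 2 - 4 * a₀ * c₀ = r ^ 2 := by
      rw [hr]
      linear_combination (-(b₀ ^ 2 - 4 * a₀ * c₀) * (α * δ - β * γ + 1)) * hdet -
        4 * (a₀ * α ^ 2 + b₀ * (α * γ) + c₀ * γ ^ 2) * hc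
    rw [hdisc] at hD hgD hD1
    have hr0 : r ≠ 0 := fun h0 => hD (by rw [h0]; ring)
    rw [← hr] at hab
    have ha := hab.resolve_right hr0
    have hrB := mem_of_sq_mem B hD1
    obtain ⟨A', hA'⟩ : ∃ A' : κ → K, ∀ k, A' k = a k * α ^ 2 + b k * (α * γ) + c k * γ ^ 2 :=
      ⟨_, fun _ => rfl⟩
    obtain ⟨B', hB'⟩ : ∃ B' : κ → K, ∀ k, B' k =
      2 * a k * (α * β) + b k * (α * δ + β * γ) + 2 * c k * (γ * δ) := ⟨_, fun _ => rfl⟩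
    obtain ⟨C', hC'⟩ : ∃ C' : κ → K, ∀ k, C' k = a k * β ^ 2 + b k * (β * δ) + c k * δ ^ 2 :=
      ⟨_, fun _ => rfl⟩
    have hpairs k l : b k * b l - 2 * a k * c l - 2 * a l * c k =
        B' k * B' l - 2 * A' k * C' l - 2 * A' l * C' k := by
      rw [hA', hA', hB', hB', hC', hC']
      linear_combination (-(b k * b l - 2 * a k * c l - 2 * a l * c k) *
        (α * δ - β * γ + 1)) * hdet
    have hpair₀ k : b k * b₀ - 2 * a k * c₀ - 2 * a₀ * c k = B' k * r := by
      rw [hB', hr]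
      linear_combination (-(b k * b₀ - 2 * a k * c₀ - 2 * a₀ * c k) *
        (α * δ - β * γ + 1)) * hdet - 2 * (a k * α ^ 2 + b k * (α * γ) + c k * γ ^ 2) * hc
        - 2 * (a k * β ^ 2 + b k * (β * δ) + c k * δ ^ 2) * ha
    have hBr k : B' k / r ∈ B := by
      have := B.mul_mem _ _ (hpair k) hgD
      rw [hpair₀] at this
      convert this using 1
      field_simp
    have hsum k l : (A' k * C' l) / r ^ 2 + (A' l * C' k) / r ^ 2 ∈ B := by
      have h1 := B.mul_mem _ _ (hmax k l) hgD
      rw [hpairs] at h1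
      have := B.mul_mem _ _ h2 (B.sub_mem (B.mul_mem _ _ (hBr k) (hBr l)) h1)
      convert this using 1
      field_simp
      ring
    have hself k : (A' k * C' k) / r ^ 2 ∈ B := by
      have := B.mul_mem _ _ h2 (hsum k k)
      convert this using 1
      field_simp
      ring
    refine ⟨α, β, γ, δ, hdet, fun k => ?_, fun k l => ?_⟩
    · rw [← hB']
      have := B.mul_mem _ _ (hBr k) hrB
      rwa [div_mul_cancel₀ _ hr0] at this
    · rw [← hA', ← hC']
      have := mem_of_add_mem_of_mul_mem B (hsum k l)
        (by convert B.mul_mem _ _ (hself k) (hself l) using 1; ring)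
      have := B.mul_mem _ _ this hD1
      rwa [div_mul_cancel₀ _ hD] at this
  · push Not at hF
    simp only [Prod.forall] at hF
    by_cases h0 : ∃ k, ¬ (a k = 0 ∧ b k = 0 ∧ c k = 0)
    · obtain ⟨i, hi⟩ := h0
      obtain ⟨α, β, γ, δ, hdet, hc, hab⟩ := exists_diagonalize (a i) (b i) (c i)
      obtain ⟨A', hA'⟩ : ∃ A' : κ → K, ∀ k, A' k = a k * α ^ 2 + b k * (α * γ) + c k * γ ^ 2 :=
        ⟨_, fun _ => rfl⟩
      obtain ⟨B', hB'⟩ : ∃ B' : κ → K, ∀ k, B' k =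
        2 * a k * (α * β) + b k * (α * δ + β * γ) + 2 * c k * (γ * δ) := ⟨_, fun _ => rfl⟩
      obtain ⟨C', hC'⟩ : ∃ C' : κ → K, ∀ k, C' k = a k * β ^ 2 + b k * (β * δ) + c k * δ ^ 2 :=
        ⟨_, fun _ => rfl⟩
      have hpairs k l : B' k * B' l - 2 * A' k * C' l - 2 * A' l * C' k = 0 := by
        rw [hA', hA', hB', hB', hC', hC', ← hF k l]
        linear_combination ((b k * b l - 2 * a k * c l - 2 * a l * c k) *
          (α * δ - β * γ + 1)) * hdet
      have hci : C' i = 0 := by rw [hC']; exact hc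
      have hbi : B' i = 0 := by
        have := hpairs i i
        rw [hci] at this
        exact pow_eq_zero_iff (two_ne_zero) |>.1 (by linear_combination this)
      have hai : A' i ≠ 0 := by
        intro hai
        rw [hA'] at hai
        rw [hB'] at hbi
        refine hi ⟨?_, ?_, ?_⟩
        · linear_combination δ ^ 2 * hai - γ * δ * hbi + γ ^ 2 * hc -
            a i * (α * δ - β * γ + 1) * hdet
        · linear_combination -2 * β * δ * hai + (α * δ + β * γ) * hbi - 2 * α * γ * hc -
            b i * (α * δ - β * γ + 1) * hdet
        · linear_combination β ^ 2 * hai - α * β * hbi + α ^ 2 * hc -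
            c i * (α * δ - β * γ + 1) * hdet
      have hc' k : C' k = 0 := by
        have := hpairs i k
        rw [hbi, hci] at this
        refine (mul_eq_zero.1 ?_).resolve_left (mul_ne_zero h20 hai)
        linear_combination -this
      have hb' k : B' k = 0 := by
        have := hpairs k k
        rw [hc'] at this
        exact pow_eq_zero_iff (two_ne_zero) |>.1 (by linear_combination this)
      refine ⟨α, β, γ, δ, hdet, fun k => ?_, fun k l => ?_⟩
      · rw [← hB', hb']; exact B.zero_mem
      · rw [← hC', hc', mul_zero]; exact B.zero_mem
    · push Not at h0
      refine ⟨1, 0, 0, 1, by ring, fun k => ?_, fun k l => ?_⟩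
      · simp [(h0 k).1, (h0 k).2.1, (h0 k).2.2]
      · simp [(h0 k).1, (h0 k).2.1, (h0 k).2.2]

end IntegralModel
end BinInv

namespace BinInv
namespace FormSystem

section NormalForm

variable {ι κ K : Type*} [Field K]

/-- The basic invariants of `s'` are those of `s`, up to rescaling all forms by a common factor. -/
def SameInvariants (s s' : FormSystem ι κ K) : Prop :=
  ∃ t : K, t ≠ 0 ∧ (∀ l, s'.deg2 l = t ^ 2 * s.deg2 l) ∧ ∀ l, s'.deg3 l = t ^ 3 * s.deg3 l

/-- After a change of variables and a rescaling, at least `N` coefficients of `s` become `0` or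
`1`. -/
def HasNormalForm (s : FormSystem ι κ K) (N : ℕ) : Prop :=
  ∃ (s' : FormSystem ι κ K) (T : Finset ((ι × Fin 2) ⊕ (κ × Fin 3))), s.SameInvariants s' ∧
    (∀ t ∈ T, s'.coord t = 0 ∨ s'.coord t = 1) ∧ N ≤ T.card

theorem SameInvariants.trans {s s' s'' : FormSystem ι κ K} (h : s.SameInvariants s')
    (h' : s'.SameInvariants s'') : s.SameInvariants s'' := by
  obtain ⟨t, ht, h2, h3⟩ := h
  obtain ⟨t', ht', h2', h3'⟩ := h'
  exact ⟨t' * t, mul_ne_zero ht' ht, fun l => by rw [h2', h2]; ring,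
    fun l => by rw [h3', h3]; ring⟩

theorem SameInvariants.deg2_eq_zero_iff {s s' : FormSystem ι κ K} (h : s.SameInvariants s') (l) :
    s'.deg2 l = 0 ↔ s.deg2 l = 0 := by
  obtain ⟨t, ht, h2, -⟩ := h
  rw [h2]
  simp [ht]

theorem SameInvariants.deg3_eq_zero_iff {s s' : FormSystem ι κ K} (h : s.SameInvariants s') (l) :
    s'.deg3 l = 0 ↔ s.deg3 l = 0 := by
  obtain ⟨t, ht, -, h3⟩ := h
  rw [h3]
  simp [ht]

theorem HasNormalForm.of_sameInvariants {s s' : FormSystem ι κ K} {N : ℕ}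
    (h : s.SameInvariants s') (h' : s'.HasNormalForm N) : s.HasNormalForm N := by
  obtain ⟨s'', T, h1, h2, h3⟩ := h'
  exact ⟨s'', T, h.trans h1, h2, h3⟩

theorem sameInvariants_act (s : FormSystem ι κ K) {α β γ δ : K} (h : α * δ - β * γ = 1) :
    s.SameInvariants (s.act α β γ δ) :=
  ⟨1, one_ne_zero, fun l => by rw [deg2_act h]; ring, fun l => by rw [deg3_act h]; ring⟩

theorem sameInvariants_scale (s : FormSystem ι κ K) {t : K} (h : t ≠ 0) :
    s.SameInvariants (s.scale t) :=
  ⟨t, h, deg2_scale t s, deg3_scale t s⟩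

theorem exists_sameInvariants_shear (s : FormSystem ι κ K) (γ : K) :
    ∃ s' : FormSystem ι κ K, s.SameInvariants s' ∧ (∀ i, s'.p i = s.p i + s.q i * γ) ∧
      (∀ i, s'.q i = s.q i) ∧ (∀ k, s'.a k = s.a k + s.b k * γ + s.c k * γ ^ 2) ∧
      (∀ k, s'.b k = s.b k + 2 * s.c k * γ) ∧ ∀ k, s'.c k = s.c k := by
  refine ⟨_, s.sameInvariants_act (α := 1) (β := 0) (γ := γ) (δ := 1) (by ring),
    fun i => ?_, fun i => ?_, fun i => ?_, fun i => ?_, fun i => ?_⟩ <;> simp only [act] <;> ring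

theorem exists_sameInvariants_torus (s : FormSystem ι κ K) {t : K} (ht : t ≠ 0) :
    ∃ s' : FormSystem ι κ K, s.SameInvariants s' ∧ (∀ i, s'.p i = s.p i) ∧
      (∀ i, s'.q i = t ^ 2 * s.q i) ∧ (∀ k, s'.a k = t⁻¹ * s.a k) ∧
      (∀ k, s'.b k = t * s.b k) ∧ ∀ k, s'.c k = t ^ 3 * s.c k := by
  refine ⟨_, (s.sameInvariants_act (α := t⁻¹) (β := 0) (γ := 0) (δ := t)
    (by field_simp; ring)).trans (sameInvariants_scale _ ht),
    fun i => ?_, fun i => ?_, fun i => ?_, fun i => ?_, fun i => ?_⟩ <;>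
    simp only [act, scale, map, Function.comp] <;> field_simp <;> ring

theorem exists_sameInvariants_linear (s : FormSystem ι κ K) {i : ι}
    (h : ¬ (s.p i = 0 ∧ s.q i = 0)) :
    ∃ s' : FormSystem ι κ K, s.SameInvariants s' ∧ s'.p i = 1 ∧ s'.q i = 0 := by
  by_cases hp : s.p i = 0
  · have hq : s.q i ≠ 0 := fun hq => h ⟨hp, hq⟩
    refine ⟨_, s.sameInvariants_act (α := 0) (β := -s.q i) (γ := (s.q i)⁻¹) (δ := 0) ?_, ?_, ?_⟩
    · field_simp; ring
    · simp [act, hq]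
    · simp [act, hp]
  · refine ⟨_, s.sameInvariants_act (α := (s.p i)⁻¹) (β := -s.q i) (γ := 0) (δ := s.p i) ?_, ?_, ?_⟩
    · field_simp; ring
    · simp [act, hp]
    · simp only [act]; ring

open Finset in
theorem hasNormalForm_of_rank_two [Fintype κ] [DecidableEq ι] [DecidableEq κ] {s : FormSystem ι κ K} {i j : ι} (hp : s.p i = 1)
    (hq : s.q i = 0) (hp' : s.p j = 0) (hq' : s.q j = 1) :
    s.HasNormalForm 4 ∧ ((∀ k, s.a k = 0 ∧ s.b k = 0 ∧ s.c k = 0) →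
      s.HasNormalForm (4 + 3 * Fintype.card κ)) := by
  have hij : i ≠ j := by rintro rfl; simp [hp] at hp'
  have hcard : ({(i, 0), (i, 1), (j, 0), (j, 1)} : Finset (ι × Fin 2)).card = 4 := by
    rw [card_insert_of_notMem, card_insert_of_notMem, card_insert_of_notMem, card_singleton] <;>
      simp [hij]
  have h1 : s.SameInvariants s := ⟨1, one_ne_zero, by simp, by simp⟩
  constructor
  · refine ⟨s, disjSum {(i, 0), (i, 1), (j, 0), (j, 1)} ∅, h1, ?_, ?_⟩
    · simp [coord, hp, hq, hp', hq']
    · rw [card_disjSum, hcard]; simp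
  · intro h
    refine ⟨s, disjSum {(i, 0), (i, 1), (j, 0), (j, 1)} univ, h1, ?_, ?_⟩
    · rintro (⟨x, e⟩ | ⟨x, e⟩) ht
      · simp only [inl_mem_disjSum, mem_insert, mem_singleton, Prod.mk.injEq] at ht
        rcases ht with ⟨rfl, rfl⟩ | ⟨rfl, rfl⟩ | ⟨rfl, rfl⟩ | ⟨rfl, rfl⟩ <;>
          simp [coord, hp, hq, hp', hq']
      · obtain ⟨h1, h2, h3⟩ := h x
        fin_cases e <;> simp [coord, h1, h2, h3]
    · rw [card_disjSum, hcard, card_univ, Fintype.card_prod, Fintype.card_fin, mul_comm 3]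

open Finset in
/-- Normal forms given by linear coefficients and any set of normalized quadratic coefficients. -/
theorem hasNormalForm_of_rank_one [Fintype ι] [DecidableEq ι] {s : FormSystem ι κ K} {i : ι} (hp : s.p i = 1)
    (hq : ∀ j, s.q j = 0) (T : Finset (κ × Fin 3))
    (hT : ∀ t ∈ T, s.coord (.inr t) = 0 ∨ s.coord (.inr t) = 1) :
    s.HasNormalForm (Fintype.card ι + 1 + T.card) := by
  refine ⟨s, disjSum (insert (i, 0) (univ ×ˢ {1})) T, ⟨1, one_ne_zero, by simp, by simp⟩, ?_, ?_⟩
  · rintro (⟨x, e⟩ | ⟨x, e⟩) ht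
    · simp only [inl_mem_disjSum, mem_insert, mem_product, mem_singleton, Prod.mk.injEq, mem_univ,
        true_and] at ht
      rcases ht with ⟨rfl, rfl⟩ | rfl <;> simp [coord, hp, hq]
    · exact hT _ (by simpa using ht)
  · rw [card_disjSum, card_insert_of_notMem (by simp)]
    simp

open Finset in
theorem hasNormalForm_of_rank_zero [Fintype ι] {s : FormSystem ι κ K} (hp : ∀ j, s.p j = 0)
    (hq : ∀ j, s.q j = 0) (T : Finset (κ × Fin 3))
    (hT : ∀ t ∈ T, s.coord (.inr t) = 0 ∨ s.coord (.inr t) = 1) :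
    s.HasNormalForm (2 * Fintype.card ι + T.card) := by
  refine ⟨s, disjSum univ T, ⟨1, one_ne_zero, by simp, by simp⟩, ?_, ?_⟩
  · rintro (⟨x, e⟩ | ⟨x, e⟩) ht
    · fin_cases e <;> simp [coord, hp, hq]
    · exact hT _ (by simpa using ht)
  · rw [card_disjSum, card_univ, Fintype.card_prod, Fintype.card_fin, mul_comm 2]

/-- The possible positions of the linear forms, after a change of variables. -/
theorem exists_linear_normal_form [IsAlgClosed K] (s : FormSystem ι κ K) :
    ∃ s' : FormSystem ι κ K, s.SameInvariants s' ∧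
      ((∃ i j, s'.p i = 1 ∧ s'.q i = 0 ∧ s'.p j = 0 ∧ s'.q j = 1) ∨
      (∃ i, s'.p i = 1 ∧ ∀ j, s'.q j = 0) ∨ ((∀ j, s'.p j = 0) ∧ ∀ j, s'.q j = 0)) := by
  by_cases h : ∃ i, ¬ (s.p i = 0 ∧ s.q i = 0)
  · obtain ⟨i, hi⟩ := h
    obtain ⟨s₁, h₁, hp, hq⟩ := s.exists_sameInvariants_linear hi
    by_cases hj : ∃ j, s₁.q j ≠ 0
    · obtain ⟨j, hj⟩ := hj
      obtain ⟨s₂, h₂, hp₂, hq₂, -⟩ := s₁.exists_sameInvariants_shear (-s₁.p j / s₁.q j)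
      obtain ⟨t, ht⟩ := IsAlgClosed.exists_pow_nat_eq (s₁.q j)⁻¹ (n := 2) (by norm_num)
      have ht0 : t ≠ 0 := by
        rintro rfl
        rw [zero_pow two_ne_zero] at ht
        exact inv_ne_zero hj ht.symm
      obtain ⟨s₃, h₃, hp₃, hq₃, -⟩ := s₂.exists_sameInvariants_torus ht0
      refine ⟨s₃, (h₁.trans h₂).trans h₃, .inl ⟨i, j, ?_, ?_, ?_, ?_⟩⟩
      · rw [hp₃, hp₂, hp, hq]; ring
      · rw [hq₃, hq₂, hq]; ring
      · rw [hp₃, hp₂]; field_simp; ring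
      · rw [hq₃, hq₂, ht]; field_simp
    · push Not at hj
      exact ⟨s₁, h₁, .inr (.inl ⟨i, hp, hj⟩)⟩
  · push Not at h
    exact ⟨s, ⟨1, one_ne_zero, by simp, by simp⟩,
      .inr (.inr ⟨fun j => (h j).1, fun j => (h j).2⟩)⟩

variable [Fintype ι] [Fintype κ] [DecidableEq ι] [DecidableEq κ] [CharZero K]

theorem hasNormalForm_of_deg2_ne_zero_of_deg3_ne_zero [IsAlgClosed K] (s : FormSystem ι κ K)
    (hι : 1 ≤ Fintype.card ι) (h2 : ∃ l, s.deg2 l ≠ 0) (h3 : ∃ l, s.deg3 l ≠ 0) :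
    s.HasNormalForm 4 := by
  obtain ⟨s', h, hs'⟩ := s.exists_linear_normal_form
  simp_rw [ne_eq, ← h.deg2_eq_zero_iff] at h2
  simp_rw [ne_eq, ← h.deg3_eq_zero_iff] at h3
  refine .of_sameInvariants h ?_
  clear h s
  rename' s' => s
  rcases hs' with ⟨i, j, hp, hq, hp', hq'⟩ | ⟨i, hp, hq⟩ | ⟨hp, hq⟩
  · exact (hasNormalForm_of_rank_two hp hq hp' hq').1
  · by_cases hc : ∃ k, s.c k ≠ 0
    · obtain ⟨k, hk⟩ := hc
      obtain ⟨s₁, h₁, hp₁, hq₁, ha₁, hb₁, hc₁⟩ :=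
        s.exists_sameInvariants_shear (-s.b k / (2 * s.c k))
      obtain ⟨t, ht⟩ := IsAlgClosed.exists_pow_nat_eq (s.c k)⁻¹ (n := 3) (by norm_num)
      have ht0 : t ≠ 0 := by
        rintro rfl
        rw [zero_pow three_ne_zero] at ht
        exact inv_ne_zero hk ht.symm
      obtain ⟨s₂, h₂, hp₂, hq₂, ha₂, hb₂, hc₂⟩ := s₁.exists_sameInvariants_torus ht0
      refine .of_sameInvariants (h₁.trans h₂) ?_
      obtain ⟨s', T, H1, H2, H3⟩ := hasNormalForm_of_rank_one (s := s₂) (i := i)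
        (by rw [hp₂, hp₁, hp, hq]; ring) (fun j => by rw [hq₂, hq₁, hq]; ring)
        {(k, 1), (k, 2)} (by
          have hb : s₂.b k = 0 := by rw [hb₂, hb₁]; field_simp; ring
          have hc : s₂.c k = 1 := by rw [hc₂, hc₁, ht]; field_simp
          simp [coord, hb, hc])
      refine ⟨s', T, H1, H2, le_trans ?_ H3⟩
      rw [Finset.card_pair (by simp)]
      omega
    · push Not at hc
      obtain ⟨⟨k, i, j⟩ | ⟨k, l, r⟩, hl⟩ := h3
      · simp [deg3, hq, hc] at hl
      · simp [deg3, hc] at hl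
  · obtain ⟨k, hk⟩ : ∃ k, ¬ (s.a k = 0 ∧ s.b k = 0 ∧ s.c k = 0) := by
      by_contra! H
      obtain ⟨⟨i, j⟩ | ⟨k, l⟩, hl⟩ := h2
      · simp [deg2, hq] at hl
      · simp [deg2, H] at hl
    obtain ⟨α, β, γ, δ, hdet, hc, -⟩ := exists_diagonalize (s.a k) (s.b k) (s.c k)
    obtain ⟨s₁, hs₁⟩ : ∃ s₁, s₁ = s.act α β γ δ := ⟨_, rfl⟩
    have h₁ : s.SameInvariants s₁ := hs₁ ▸ s.sameInvariants_act hdet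
    have hc' : s₁.c k = 0 := by rw [hs₁]; exact hc
    have key : ∀ x : K, x ≠ 0 → ∀ e : Fin 3, ![s₁.a k, s₁.b k, s₁.c k] e = x → e ≠ 2 →
        s.HasNormalForm 4 := by
      intro x hx e he he2
      refine .of_sameInvariants (h₁.trans (sameInvariants_scale _ (inv_ne_zero hx))) ?_
      obtain ⟨s', T, H1, H2, H3⟩ := hasNormalForm_of_rank_zero (s := s₁.scale x⁻¹)
        (fun j => by simp [hs₁, act, scale, map, hp, hq])
        (fun j => by simp [hs₁, act, scale, map, hp, hq]) {(k, 2), (k, e)} (by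
          have : (s₁.scale x⁻¹).coord (.inr (k, e)) = 1 := by
            rw [← inv_mul_cancel₀ hx]
            nth_rw 3 [← he]
            fin_cases e <;> rfl
          simp only [Finset.mem_insert, Finset.mem_singleton]
          rintro t (rfl | rfl)
          · left; simp [coord, scale, map, hc']
          · exact .inr this)
      refine ⟨s', T, H1, H2, le_trans ?_ H3⟩
      rw [Finset.card_pair (by simpa using he2.symm)]
      omega
    by_cases ha : s₁.a k = 0
    · by_cases hb : s₁.b k = 0
      · refine absurd ?_ hk
        rw [hs₁] at ha hb
        simp only [act] at ha hb
        refine ⟨?_, ?_, ?_⟩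
        · linear_combination δ ^ 2 * ha - γ * δ * hb + γ ^ 2 * hc -
            s.a k * (α * δ - β * γ + 1) * hdet
        · linear_combination -2 * β * δ * ha + (α * δ + β * γ) * hb - 2 * α * γ * hc -
            s.b k * (α * δ - β * γ + 1) * hdet
        · linear_combination β ^ 2 * ha - α * β * hb + α ^ 2 * hc -
            s.c k * (α * δ - β * γ + 1) * hdet
      · exact key _ hb 1 rfl (by decide)
    · exact key _ ha 0 rfl (by decide)

end NormalForm
end FormSystem
end BinInv

namespace BinInv
namespace FormSystem

section NormalForm

variable {ι κ K : Type*} [Field K]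

theorem four_mul_deg3_sq {A : Type*} [CommRing A] (s : FormSystem ι κ A) (k l r : κ) :
    -4 * s.deg3 (.inr (k, l, r)) ^ 2 = s.deg2 (.inr (k, k)) *
      (s.deg2 (.inr (l, l)) * s.deg2 (.inr (r, r)) - s.deg2 (.inr (l, r)) ^ 2) -
      s.deg2 (.inr (k, l)) * (s.deg2 (.inr (k, l)) * s.deg2 (.inr (r, r)) -
        s.deg2 (.inr (l, r)) * s.deg2 (.inr (k, r))) +
      s.deg2 (.inr (k, r)) * (s.deg2 (.inr (k, l)) * s.deg2 (.inr (l, r)) -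
        s.deg2 (.inr (l, l)) * s.deg2 (.inr (k, r))) := by
  simp only [deg2, deg3, Sum.elim_inr]
  ring

theorem exists_perp (a b c : κ → K) (h0 : ∃ k, ¬ (a k = 0 ∧ b k = 0 ∧ c k = 0))
    (h : ∀ k l r, a k * (b l * c r - c l * b r) - b k * (a l * c r - c l * a r)
      + c k * (a l * b r - b l * a r) = 0) :
    ∃ u v w : K, ¬ (u = 0 ∧ v = 0 ∧ w = 0) ∧ ∀ k, a k * u + b k * v + c k * w = 0 := by
  by_cases hcross : ∃ l r, ¬ (b l * c r - c l * b r = 0 ∧ a l * c r - c l * a r = 0 ∧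
      a l * b r - b l * a r = 0)
  · obtain ⟨l, r, hlr⟩ := hcross
    refine ⟨b l * c r - c l * b r, -(a l * c r - c l * a r), a l * b r - b l * a r, ?_,
      fun k => by linear_combination h k l r⟩
    rwa [neg_eq_zero]
  · push Not at hcross
    obtain ⟨k, hk⟩ := h0
    by_cases ha : a k = 0
    · by_cases hb : b k = 0
      · have hc : c k ≠ 0 := fun hc => hk ⟨ha, hb, hc⟩
        exact ⟨c k, 0, -a k, fun H => hc H.1, fun l => by linear_combination -(hcross k l).2.1⟩
      · exact ⟨0, -c k, b k, fun H => hb H.2.2, fun l => by linear_combination (hcross k l).1⟩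
    · exact ⟨-b k, a k, 0, fun H => ha H.2.1, fun l => by linear_combination (hcross k l).2.2⟩

theorem exists_sameInvariants_of_c_eq_zero (s : FormSystem ι κ K) (hc : ∀ k, s.c k = 0)
    (hq : ∀ i, s.q i = 0) {k : κ} (hb : s.b k ≠ 0) :
    ∃ s' : FormSystem ι κ K, s.SameInvariants s' ∧ s'.p = s.p ∧ (∀ i, s'.q i = 0) ∧
      s'.a k = 0 ∧ s'.b k = 1 ∧ ∀ l, s'.c l = 0 := by
  obtain ⟨s₁, h₁, hp₁, hq₁, ha₁, hb₁, hc₁⟩ := s.exists_sameInvariants_shear (-s.a k / s.b k)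
  obtain ⟨s₂, h₂, hp₂, hq₂, ha₂, hb₂, hc₂⟩ := s₁.exists_sameInvariants_torus (inv_ne_zero hb)
  refine ⟨s₂, h₁.trans h₂, funext fun i => ?_, fun i => ?_, ?_, ?_, fun l => ?_⟩
  · rw [hp₂, hp₁, hq]; ring
  · rw [hq₂, hq₁, hq]; ring
  · rw [ha₂, ha₁, hc]; field_simp; ring
  · rw [hb₂, hb₁, hc]; field_simp; ring
  · rw [hc₂, hc₁, hc]; ring

/-- A family of quadratic forms spanning the torus-fixed form together with weight vectors of one
sign. -/
theorem coord_normalized_of_c_eq_zero [Fintype κ] [DecidableEq κ] {s : FormSystem ι κ K} {k : κ}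
    (ha : s.a k = 0) (hb : s.b k = 1) (hc : ∀ l, s.c l = 0) :
    ∃ T : Finset (κ × Fin 3), T.card = Fintype.card κ + 2 ∧
      ∀ t ∈ T, s.coord (.inr t) = 0 ∨ s.coord (.inr t) = 1 := by
  refine ⟨insert (k, 0) (insert (k, 1) (Finset.univ ×ˢ {2})), ?_, ?_⟩
  · rw [Finset.card_insert_of_notMem (by simp), Finset.card_insert_of_notMem (by simp)]
    simp
  · rintro ⟨x, e⟩ ht
    simp only [Finset.mem_insert, Finset.mem_product, Finset.mem_singleton, Prod.mk.injEq,
      Finset.mem_univ, true_and] at ht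
    rcases ht with ⟨rfl, rfl⟩ | ⟨rfl, rfl⟩ | rfl <;> simp [coord, ha, hb, hc]

/-- A family of quadratic forms without middle terms. -/
theorem coord_normalized_of_b_eq_zero [Fintype κ] [DecidableEq κ] {s : FormSystem ι κ K}
    {k l : κ} (ha : s.a k = 1) (hb : ∀ l, s.b l = 0) (hc : s.c l = 1) :
    ∃ T : Finset (κ × Fin 3), T.card = Fintype.card κ + 2 ∧
      ∀ t ∈ T, s.coord (.inr t) = 0 ∨ s.coord (.inr t) = 1 := by
  refine ⟨insert (k, 0) (insert (l, 2) (Finset.univ ×ˢ {1})), ?_, ?_⟩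
  · rw [Finset.card_insert_of_notMem (by simp), Finset.card_insert_of_notMem (by simp)]
    simp
  · rintro ⟨x, e⟩ ht
    simp only [Finset.mem_insert, Finset.mem_product, Finset.mem_singleton, Prod.mk.injEq,
      Finset.mem_univ, true_and] at ht
    rcases ht with ⟨rfl, rfl⟩ | ⟨rfl, rfl⟩ | rfl <;> simp [coord, ha, hb, hc]

theorem HasNormalForm.mono {s : FormSystem ι κ K} {M N : ℕ} (h : s.HasNormalForm N)
    (hMN : M ≤ N) : s.HasNormalForm M := by
  obtain ⟨s', T, H1, H2, H3⟩ := h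
  exact ⟨s', T, H1, H2, hMN.trans H3⟩

variable [Fintype ι] [Fintype κ] [DecidableEq ι] [DecidableEq κ] [CharZero K]

theorem hasNormalForm_of_deg3_eq_zero [IsAlgClosed K] (s : FormSystem ι κ K)
    (hι : 1 ≤ Fintype.card ι) (hκ : Fintype.card ι ≤ 2 * Fintype.card κ + 1)
    (h2 : ∃ l, s.deg2 l ≠ 0) (h3 : ∀ l, s.deg3 l = 0) :
    s.HasNormalForm (Fintype.card ι + Fintype.card κ + 3) := by
  obtain ⟨s', h, hs'⟩ := s.exists_linear_normal_form
  simp_rw [ne_eq, ← h.deg2_eq_zero_iff] at h2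
  simp_rw [← h.deg3_eq_zero_iff] at h3
  refine .of_sameInvariants h ?_
  clear h s
  rename' s' => s
  rcases hs' with ⟨i, j, hp, hq, hp', hq'⟩ | ⟨i, hp, hq⟩ | ⟨hp, hq⟩
  · refine ((hasNormalForm_of_rank_two hp hq hp' hq').2 fun k => ?_).mono (by omega)
    have h1 := h3 (.inl (k, i, i))
    have h2 := h3 (.inl (k, i, j))
    have h4 := h3 (.inl (k, j, j))
    simp [deg3, hp, hq, hp', hq'] at h1 h2 h4
    exact ⟨h4, h2, h1⟩
  · have hc k : s.c k = 0 := by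
      have h1 := h3 (.inl (k, i, i))
      simpa [deg3, hp, hq] using h1
    obtain ⟨k, hk⟩ : ∃ k, s.b k ≠ 0 := by
      by_contra! H
      obtain ⟨⟨i, j⟩ | ⟨k, l⟩, hl⟩ := h2
      · simp [deg2, hq] at hl
      · simp [deg2, H, hc] at hl
    obtain ⟨s₁, h₁, hp₁, hq₁, ha₁, hb₁, hc₁⟩ := s.exists_sameInvariants_of_c_eq_zero hc hq hk
    obtain ⟨T, hT, hT'⟩ := coord_normalized_of_c_eq_zero ha₁ hb₁ hc₁
    refine .of_sameInvariants h₁ ((hasNormalForm_of_rank_one (i := i) (by rw [hp₁, hp]) hq₁ T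
      hT').mono ?_)
    omega
  · have hdisc : ∃ k, ¬ (s.a k = 0 ∧ s.b k = 0 ∧ s.c k = 0) := by
      by_contra! H
      obtain ⟨⟨i, j⟩ | ⟨k, l⟩, hl⟩ := h2
      · simp [deg2, hq] at hl
      · simp [deg2, H] at hl
    obtain ⟨u, v, w, hu, hperp⟩ := exists_perp s.a s.b s.c hdisc fun k l r => h3 (.inr (k, l, r))
    obtain ⟨α, β, γ, δ, hdet, hC, hAB⟩ := exists_diagonalize (-w / 2) v (-u / 2)
    obtain ⟨s₁, hs₁⟩ : ∃ s₁, s₁ = s.act α β γ δ := ⟨_, rfl⟩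
    have h₁ : s.SameInvariants s₁ := hs₁ ▸ s.sameInvariants_act hdet
    obtain ⟨A, hA⟩ : ∃ A, A = -w / 2 * α ^ 2 + v * (α * γ) + -u / 2 * γ ^ 2 := ⟨_, rfl⟩
    obtain ⟨B, hB⟩ : ∃ B, B = 2 * (-w / 2) * (α * β) + v * (α * δ + β * γ) +
      2 * (-u / 2) * (γ * δ) := ⟨_, rfl⟩
    rw [← hA, ← hB] at hAB
    have hpair k : s₁.b k * B - 2 * A * s₁.c k = 0 := by
      rw [hs₁, hA, hB]
      simp only [act]
      linear_combination (s.b k * v - 2 * s.a k * (-u / 2) - 2 * (-w / 2) * s.c k) *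
        (α * δ - β * γ + 1) * hdet + hperp k +
        2 * (s.a k * α ^ 2 + s.b k * (α * γ) + s.c k * γ ^ 2) * hC
    have hne : ¬ (A = 0 ∧ B = 0) := by
      rintro ⟨h1, h2⟩
      rw [hA] at h1
      rw [hB] at h2
      refine hu ⟨?_, ?_, ?_⟩
      · linear_combination -2 * (β ^ 2 * h1 - α * β * h2 + α ^ 2 * hC -
            (-u / 2) * (α * δ - β * γ + 1) * hdet)
      · linear_combination -2 * β * δ * h1 + (α * δ + β * γ) * h2 - 2 * α * γ * hC -
            v * (α * δ - β * γ + 1) * hdet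
      · linear_combination -2 * (δ ^ 2 * h1 - γ * δ * h2 + γ ^ 2 * hC -
            (-w / 2) * (α * δ - β * γ + 1) * hdet)
    have hp₁ i : s₁.p i = 0 := by rw [hs₁]; simp [act, hp, hq]
    have hq₁ i : s₁.q i = 0 := by rw [hs₁]; simp [act, hp, hq]
    simp_rw [← h₁.deg2_eq_zero_iff] at h2
    refine .of_sameInvariants h₁ ?_
    rcases hAB with h0 | h0
    · have hB0 : B ≠ 0 := fun h => hne ⟨h0, h⟩
      have hb k : s₁.b k = 0 := by
        have := hpair k
        rw [h0] at this
        simpa [hB0] using this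
      obtain ⟨k, l, hk, hl⟩ : ∃ k l, s₁.a k ≠ 0 ∧ s₁.c l ≠ 0 := by
        obtain ⟨⟨i, j⟩ | ⟨k, l⟩, hl⟩ := h2
        · simp [deg2, hq₁] at hl
        · by_cases h : s₁.a k * s₁.c l = 0
          · by_cases h' : s₁.a l * s₁.c k = 0
            · refine absurd ?_ hl
              simp only [deg2, Sum.elim_inr, hb]
              linear_combination -2 * h - 2 * h'
            · exact ⟨l, k, left_ne_zero_of_mul h', right_ne_zero_of_mul h'⟩
          · exact ⟨k, l, left_ne_zero_of_mul h, right_ne_zero_of_mul h⟩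
      obtain ⟨t, ht⟩ := IsAlgClosed.exists_pow_nat_eq (s₁.a k * s₁.c l)⁻¹ (n := 2) (by norm_num)
      have ht0 : t ≠ 0 := by
        rintro rfl
        rw [zero_pow two_ne_zero] at ht
        exact inv_ne_zero (mul_ne_zero hk hl) ht.symm
      obtain ⟨z, hz⟩ := IsAlgClosed.exists_pow_nat_eq (t * s₁.a k)⁻¹ (n := 2) (by norm_num)
      have hz0 : z ≠ 0 := by
        rintro rfl
        rw [zero_pow two_ne_zero] at hz
        exact inv_ne_zero (mul_ne_zero ht0 hk) hz.symm
      have h₂ := (s₁.sameInvariants_act (α := z) (β := 0) (γ := 0) (δ := z⁻¹)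
        (by field_simp; ring)).trans (sameInvariants_scale _ ht0)
      obtain ⟨T, hT, hT'⟩ := coord_normalized_of_b_eq_zero (k := k) (l := l)
        (s := (s₁.act z 0 0 z⁻¹).scale t)
        (by
          simp only [act, scale, map, Function.comp, hz]
          field_simp
          ring)
        (fun l => by simp [act, scale, map, hb])
        (by
          simp only [act, scale, map, Function.comp, inv_pow, hz, inv_inv]
          have : t * (s₁.c l * (t * s₁.a k)) = 1 := by
            rw [← inv_mul_cancel₀ (mul_ne_zero hk hl), ← ht]; ring
          linear_combination this)
      refine .of_sameInvariants h₂ ((hasNormalForm_of_rank_zero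
        (fun j => by simp [act, scale, map, hp₁, hq₁])
        (fun j => by simp [act, scale, map, hp₁, hq₁]) T hT').mono ?_)
      omega
    · have hA0 : A ≠ 0 := fun h => hne ⟨h, h0⟩
      have hc k : s₁.c k = 0 := by
        have := hpair k
        rw [h0] at this
        simpa [hA0] using this
      obtain ⟨k, hk⟩ : ∃ k, s₁.b k ≠ 0 := by
        by_contra! H
        obtain ⟨⟨i, j⟩ | ⟨k, l⟩, hl⟩ := h2
        · simp [deg2, hq₁] at hl
        · simp [deg2, H, hc] at hl
      obtain ⟨s₂, h₂, hp₂, hq₂, ha₂, hb₂, hc₂⟩ := s₁.exists_sameInvariants_of_c_eq_zero hc hq₁ hk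
      obtain ⟨T, hT, hT'⟩ := coord_normalized_of_c_eq_zero ha₂ hb₂ hc₂
      refine .of_sameInvariants h₂ ((hasNormalForm_of_rank_zero (by rw [hp₂]; exact hp₁) hq₂ T
        hT').mono ?_)
      omega

theorem hasNormalForm_of_deg2_eq_zero [IsAlgClosed K] (s : FormSystem ι κ K)
    (h2 : ∀ l, s.deg2 l = 0) (h3 : ∃ l, s.deg3 l ≠ 0) :
    s.HasNormalForm (Fintype.card ι + 2 * Fintype.card κ + 2) := by
  obtain ⟨s', h, hs'⟩ := s.exists_linear_normal_form
  simp_rw [← h.deg2_eq_zero_iff] at h2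
  simp_rw [ne_eq, ← h.deg3_eq_zero_iff] at h3
  refine .of_sameInvariants h ?_
  clear h s
  rename' s' => s
  rcases hs' with ⟨i, j, hp, hq, hp', hq'⟩ | ⟨i, hp, hq⟩ | ⟨hp, hq⟩
  · have := h2 (.inl (i, j))
    simp [deg2, hp, hq, hp', hq'] at this
  · obtain ⟨k, hk⟩ : ∃ k, s.c k ≠ 0 := by
      by_contra! H
      obtain ⟨⟨k, i, j⟩ | ⟨k, l, r⟩, hl⟩ := h3
      · simp [deg3, hq, H] at hl
      · simp [deg3, H] at hl
    obtain ⟨s₁, h₁, hp₁, hq₁, ha₁, hb₁, hc₁⟩ :=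
      s.exists_sameInvariants_shear (-s.b k / (2 * s.c k))
    obtain ⟨t, ht⟩ := IsAlgClosed.exists_pow_nat_eq (s.c k)⁻¹ (n := 3) (by norm_num)
    have ht0 : t ≠ 0 := by
      rintro rfl
      rw [zero_pow three_ne_zero] at ht
      exact inv_ne_zero hk ht.symm
    obtain ⟨s₂, h₂, hp₂, hq₂, ha₂, hb₂, hc₂⟩ := s₁.exists_sameInvariants_torus ht0
    have h₃ := h₁.trans h₂
    refine .of_sameInvariants h₃ ?_
    simp_rw [← h₃.deg2_eq_zero_iff] at h2
    have hbk : s₂.b k = 0 := by rw [hb₂, hb₁]; field_simp; ring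
    have hck : s₂.c k = 1 := by rw [hc₂, hc₁, ht]; field_simp
    have hpair k l : s₂.b k * s₂.b l - 2 * s₂.a k * s₂.c l - 2 * s₂.a l * s₂.c k = 0 :=
      h2 (.inr (k, l))
    have hak : s₂.a k = 0 := by
      have := hpair k k
      rw [hbk, hck] at this
      linear_combination (-1 / 4) * this
    have ha l : s₂.a l = 0 := by
      have := hpair k l
      rw [hbk, hck, hak] at this
      linear_combination (-1 / 2) * this
    have hb l : s₂.b l = 0 := by
      have := hpair l l
      rw [ha] at this
      exact pow_eq_zero_iff (two_ne_zero) |>.1 (by linear_combination this)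
    refine (hasNormalForm_of_rank_one (s := s₂) (i := i) (by rw [hp₂, hp₁, hp, hq]; ring)
      (fun j => by rw [hq₂, hq₁, hq]; ring) (insert (k, 2) (Finset.univ ×ˢ {0, 1})) ?_).mono ?_
    · rintro ⟨x, e⟩ ht
      simp only [Finset.mem_insert, Finset.mem_product, Finset.mem_singleton, Prod.mk.injEq,
        Finset.mem_univ, true_and] at ht
      rcases ht with ⟨rfl, rfl⟩ | rfl | rfl <;> simp [coord, ha, hb, hck]
    · rw [Finset.card_insert_of_notMem (by simp), Finset.card_product, Finset.card_univ,
        Finset.card_pair (by simp)]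
      omega
  · obtain ⟨⟨k, i, j⟩ | ⟨k, l, r⟩, hl⟩ := h3
    · simp [deg3, hp, hq] at hl
    · refine absurd ?_ hl
      have key : -4 * (s.deg3 (.inr (k, l, r))) ^ 2 = 0 := by
        rw [four_mul_deg3_sq]
        simp [h2]
      exact pow_eq_zero_iff (two_ne_zero) |>.1 (by linear_combination (-1 / 4) * key)

end NormalForm
end FormSystem
end BinInv

namespace BinInv

/-- Counting parameters: if a finite algebraically independent family can be recovered rationally
from a subfamily and from the coordinates of a point, some of which are `0` or `1`, then the number
of omitted parameters is at most the number of free coordinates. -/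
theorem card_add_card_le_of_algebraicIndependent {J τ k : Type*} [Field k] [CharZero k] [Fintype J]
    [DecidableEq J] [Fintype τ] [DecidableEq τ] {lam : J → k} (hlam : AlgebraicIndependent ℚ lam)
    (x : τ → k) (T : Finset τ) (hT : ∀ t ∈ T, x t = 0 ∨ x t = 1) (R : Finset J)
    (hR : ∀ j ∈ R, ∀ E : Subfield k, (∀ t, x t ∈ E) → (∀ i ∉ R, lam i ∈ E) → lam j ∈ E) :
    R.card + T.card ≤ Fintype.card τ := by
  classical
  let M := AlgebraicIndependent.matroid ℚ k
  let S : Finset k := Rᶜ.image lam ∪ Tᶜ.image x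
  let E : Subfield k :=
    { (Subalgebra.algebraicClosure (Algebra.adjoin ℚ (S : Set k)) k).toSubring with
      inv_mem' := fun z hz => IsAlgebraic.inv hz }
  have hSE : ∀ z ∈ S, z ∈ E := fun z hz =>
    isAlgebraic_algebraMap (⟨z, Algebra.subset_adjoin hz⟩ : Algebra.adjoin ℚ (S : Set k))
  have hx t : x t ∈ E := by
    by_cases ht : t ∈ T
    · rcases hT t ht with h | h <;> rw [h]
      exacts [E.zero_mem, E.one_mem]
    · exact hSE _ (Finset.mem_union_right _ (Finset.mem_image_of_mem _ (by simpa using ht)))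
  have hl i (hi : i ∉ R) : lam i ∈ E :=
    hSE _ (Finset.mem_union_left _ (Finset.mem_image_of_mem _ (by simpa using hi)))
  have hsub : Set.range lam ⊆ M.closure S := by
    rw [AlgebraicIndependent.matroid_closure_eq]
    rintro _ ⟨j, rfl⟩
    change lam j ∈ E
    by_cases hj : j ∈ R
    · exact hR j hj E hx hl
    · exact hl j hj
  have hind : M.Indep (Set.range lam) := by
    rw [AlgebraicIndependent.matroid_indep_iff]
    exact hlam.to_subtype_range
  have h1 : (Set.range lam).encard ≤ (S : Set k).encard := by
    rw [← hind.eRk_eq_encard]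
    exact (M.eRk_mono hsub).trans ((M.eRk_closure_eq _).trans_le (M.eRk_le_encard _))
  rw [← Set.image_univ, hlam.injective.encard_image, Set.encard_univ, ENat.card_eq_coe_fintype_card,
    Set.encard_coe_eq_coe_finsetCard, Nat.cast_le] at h1
  have h2 := (Finset.card_union_le (Rᶜ.image lam) (Tᶜ.image x)).trans
    (add_le_add Finset.card_image_le Finset.card_image_le)
  rw [Finset.card_compl, Finset.card_compl] at h2
  have h3 := h1.trans h2
  have := R.card_le_univ
  have := T.card_le_univ
  omega

/-- There are arbitrarily large finite families of complex numbers which are algebraically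
independent over the rationals. -/
theorem exists_algebraicIndependent_complex (J : Type*) [Finite J] :
    ∃ lam : J → ℂ, AlgebraicIndependent ℚ lam := by
  obtain ⟨s, hs⟩ := exists_isTranscendenceBasis' ℚ ℂ
  obtain ⟨x, hx⟩ := hs
  have hinf : Infinite s := by
    rw [← not_finite_iff_infinite]
    intro hfin
    have h1 := IsAlgClosed.cardinal_le_max_transcendence_basis' x hx
    have h2 : Cardinal.mk s ≤ Cardinal.aleph0 := Cardinal.mk_le_aleph0
    have h3 : Cardinal.mk ℚ ≤ Cardinal.aleph0 := Cardinal.mk_le_aleph0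
    have h4 := h1.trans (max_le (max_le h3 h2) le_rfl)
    rw [Cardinal.mk_complex] at h4
    exact absurd Cardinal.aleph0_lt_continuum h4.not_gt
  obtain ⟨n, ⟨e⟩⟩ := Finite.exists_equiv_fin J
  let f : J ↪ s := e.toEmbedding.trans (Fin.valEmbedding.trans (Infinite.natEmbedding s))
  exact ⟨x ∘ f, hx.1.comp f f.injective⟩

end BinInv

namespace BinInv
namespace FormSystem

variable {ι κ ρ σ A : Type*} [Fintype ι] [Fintype κ]

/-- Linear combinations of the basic invariants of degree two. -/
def combo2 [CommRing A] (lam : (ρ × ((ι × ι) ⊕ (κ × κ))) ⊕ (σ × ((κ × ι × ι) ⊕ (κ × κ × κ))) → A)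
    (s : FormSystem ι κ A) (j : ρ) : A :=
  ∑ l, lam (.inl (j, l)) * s.deg2 l

/-- Linear combinations of the basic invariants of degree three. -/
def combo3 [CommRing A] (lam : (ρ × ((ι × ι) ⊕ (κ × κ))) ⊕ (σ × ((κ × ι × ι) ⊕ (κ × κ × κ))) → A)
    (s : FormSystem ι κ A) (j : σ) : A :=
  ∑ l, lam (.inr (j, l)) * s.deg3 l

variable {k : Type*} [Field k] [DecidableEq ι] [DecidableEq κ]

theorem mem_of_sum_mul_eq_zero {I : Type*} [Fintype I] [DecidableEq I] (E : Subfield k)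
    {f g : I → k} (h : ∑ l, f l * g l = 0) (hg : ∀ l, g l ∈ E) {l : I} (hl : g l ≠ 0)
    (hf : ∀ l' ≠ l, f l' ∈ E) : f l ∈ E := by
  rw [← Finset.add_sum_erase _ _ (Finset.mem_univ l), add_eq_zero_iff_eq_neg,
    ← eq_div_iff hl] at h
  rw [h]
  refine E.div_mem (E.neg_mem (E.sum_mem fun l' hl' => E.mul_mem (hf l' ?_) (hg l'))) (hg l)
  exact Finset.ne_of_mem_erase hl'

variable [CharZero k] [Fintype ρ] [Fintype σ]
  {lam : (ρ × ((ι × ι) ⊕ (κ × κ))) ⊕ (σ × ((κ × ι × ι) ⊕ (κ × κ × κ))) → k}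

theorem HasNormalForm.card_le {N : ℕ} {s : FormSystem ι κ k} (hN : s.HasNormalForm N)
    (hlam : AlgebraicIndependent ℚ lam) (h2 : ∀ j, s.combo2 lam j = 0)
    (h3 : ∀ j, s.combo3 lam j = 0) (L₂ : Finset ((ι × ι) ⊕ (κ × κ)))
    (L₃ : Finset ((κ × ι × ι) ⊕ (κ × κ × κ))) (hL₂ : L₂.card ≤ 1) (hL₃ : L₃.card ≤ 1)
    (hL₂' : ∀ l ∈ L₂, s.deg2 l ≠ 0) (hL₃' : ∀ l ∈ L₃, s.deg3 l ≠ 0) :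
    Fintype.card ρ * L₂.card + Fintype.card σ * L₃.card + N ≤
      2 * Fintype.card ι + 3 * Fintype.card κ := by
  classical
  obtain ⟨s', T, hs, hT, hNT⟩ := hN
  simp_rw [ne_eq, ← hs.deg2_eq_zero_iff] at hL₂'
  simp_rw [ne_eq, ← hs.deg3_eq_zero_iff] at hL₃'
  obtain ⟨t, ht, hs2, hs3⟩ := hs
  have h2' j : ∑ l, lam (.inl (j, l)) * s'.deg2 l = 0 := by
    have := congrArg (t ^ 2 * ·) (h2 j)
    simp only [combo2, Finset.mul_sum, mul_zero] at this
    rw [← this]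
    exact Finset.sum_congr rfl fun l _ => by rw [hs2]; ring
  have h3' j : ∑ l, lam (.inr (j, l)) * s'.deg3 l = 0 := by
    have := congrArg (t ^ 3 * ·) (h3 j)
    simp only [combo3, Finset.mul_sum, mul_zero] at this
    rw [← this]
    exact Finset.sum_congr rfl fun l _ => by rw [hs3]; ring
  have key := card_add_card_le_of_algebraicIndependent hlam s'.coord T hT
    ((Finset.univ ×ˢ L₂).disjSum (Finset.univ ×ˢ L₃)) (by
      rintro (⟨j, l⟩ | ⟨j, l⟩) hj E hE hE'
      · have hl : l ∈ L₂ := by simpa using hj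
        refine mem_of_sum_mul_eq_zero E (f := fun l => lam (.inl (j, l))) (h2' j)
          (deg2_mem s' hE) (hL₂' l hl) fun l' hl' => hE' _ ?_
        simp only [Finset.inl_mem_disjSum, Finset.mem_product, Finset.mem_univ, true_and]
        exact fun h => hl' (Finset.card_le_one.1 hL₂ _ h _ hl)
      · have hl : l ∈ L₃ := by simpa using hj
        refine mem_of_sum_mul_eq_zero E (f := fun l => lam (.inr (j, l))) (h3' j)
          (deg3_mem s' hE) (hL₃' l hl) fun l' hl' => hE' _ ?_
        simp only [Finset.inr_mem_disjSum, Finset.mem_product, Finset.mem_univ, true_and]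
        exact fun h => hl' (Finset.card_le_one.1 hL₃ _ h _ hl))
  rw [Finset.card_disjSum, Finset.card_product, Finset.card_product, Finset.card_univ,
    Finset.card_univ] at key
  simp only [Fintype.card_sum, Fintype.card_prod, Fintype.card_fin] at key
  omega

/-- The generic linear combinations cut out the common zeros of all basic invariants. -/
theorem deg2_deg3_eq_zero_of_combo [IsAlgClosed k] (hlam : AlgebraicIndependent ℚ lam)
    (hι : 1 ≤ Fintype.card ι) (hκ : 1 ≤ Fintype.card κ)
    (hικ : Fintype.card ι ≤ 2 * Fintype.card κ + 1)
    (hρ : Fintype.card ρ = Fintype.card ι + 2 * Fintype.card κ - 2)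
    (hσ : Fintype.card σ = Fintype.card ι + Fintype.card κ - 1) (s : FormSystem ι κ k)
    (h2 : ∀ j, s.combo2 lam j = 0) (h3 : ∀ j, s.combo3 lam j = 0) :
    (∀ l, s.deg2 l = 0) ∧ ∀ l, s.deg3 l = 0 := by
  by_cases H2 : ∀ l, s.deg2 l = 0
  · refine ⟨H2, ?_⟩
    by_contra! H3
    have hN := s.hasNormalForm_of_deg2_eq_zero H2 H3
    obtain ⟨l, hl⟩ := H3
    have := hN.card_le hlam h2 h3 ∅ {l} (by simp) (by simp) (by simp) (by simpa using hl)
    simp only [Finset.card_singleton, Finset.card_empty] at this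
    omega
  · exfalso
    push Not at H2
    by_cases H3 : ∀ l, s.deg3 l = 0
    · have hN := s.hasNormalForm_of_deg3_eq_zero hι hικ H2 H3
      obtain ⟨l, hl⟩ := H2
      have := hN.card_le hlam h2 h3 {l} ∅ (by simp) (by simp) (by simpa using hl) (by simp)
      simp only [Finset.card_singleton, Finset.card_empty] at this
      omega
    · push Not at H3
      have hN := s.hasNormalForm_of_deg2_ne_zero_of_deg3_ne_zero hι H2 H3
      obtain ⟨l, hl⟩ := H2
      obtain ⟨l', hl'⟩ := H3
      have := hN.card_le hlam h2 h3 {l} {l'} (by simp) (by simp) (by simpa using hl)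
        (by simpa using hl')
      simp only [Finset.card_singleton] at this
      omega

end FormSystem
end BinInv

namespace BinInv
namespace FormSystem

section Combo

variable {ι κ ρ σ A A' : Type*} [Fintype ι] [Fintype κ] [CommRing A] [CommRing A']
  (lam : (ρ × ((ι × ι) ⊕ (κ × κ))) ⊕ (σ × ((κ × ι × ι) ⊕ (κ × κ × κ))) → A)
  (s : FormSystem ι κ A)

theorem combo2_map (φ : A →+* A') (j) : (s.map φ).combo2 (φ ∘ lam) j = φ (s.combo2 lam j) := by
  simp [combo2, deg2_map]

theorem combo3_map (φ : A →+* A') (j) : (s.map φ).combo3 (φ ∘ lam) j = φ (s.combo3 lam j) := by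
  simp [combo3, deg3_map]

theorem combo2_act {α β γ δ : A} (h : α * δ - β * γ = 1) (j) :
    (s.act α β γ δ).combo2 lam j = s.combo2 lam j := by
  simp [combo2, deg2_act h]

theorem combo3_act {α β γ δ : A} (h : α * δ - β * γ = 1) (j) :
    (s.act α β γ δ).combo3 lam j = s.combo3 lam j := by
  simp [combo3, deg3_act h]

theorem combo2_scale (t : A) (j) : (s.scale t).combo2 lam j = t ^ 2 * s.combo2 lam j := by
  simp only [combo2, deg2_scale, Finset.mul_sum]
  exact Finset.sum_congr rfl fun l _ => by ring

theorem combo3_scale (t : A) (j) : (s.scale t).combo3 lam j = t ^ 3 * s.combo3 lam j := by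
  simp only [combo3, deg3_scale, Finset.mul_sum]
  exact Finset.sum_congr rfl fun l _ => by ring

end Combo

section Valuation

variable {ι κ K : Type*} [Field K] [IsAlgClosed K] [CharZero K] (B : ValuationSubring K)

/-- If the basic invariants of a system are integral, so is the system after a change of
variables. -/
theorem exists_act_coord_mem [Finite ι] [Finite κ] (hB : (2 : K)⁻¹ ∈ B) (s : FormSystem ι κ K)
    (h2 : ∀ l, s.deg2 l ∈ B) (h3 : ∀ l, s.deg3 l ∈ B) :
    ∃ α β γ δ : K, α * δ - β * γ = 1 ∧ ∀ t, (s.act α β γ δ).coord t ∈ B := by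
  obtain ⟨α, β, γ, δ, hdet, h⟩ := exists_integral_model B hB two_ne_zero
    (κ := κ ⊕ ι) (Sum.elim s.a fun i => s.p i ^ 2) (Sum.elim s.b fun i => 2 * s.p i * s.q i)
    (Sum.elim s.c fun i => s.q i ^ 2) (by
      have h4 k i : s.b k * (2 * s.p i * s.q i) - 2 * s.a k * s.q i ^ 2 -
          2 * s.p i ^ 2 * s.c k ∈ B := by
        convert B.neg_mem _ (h3 (.inl (k, i, i))) using 1
        simp only [deg3, Sum.elim_inl]
        ring
      rintro (k | i) (l | j) <;> simp only [Sum.elim_inl, Sum.elim_inr]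
      · exact h2 (.inr (k, l))
      · exact h4 k j
      · convert h4 l i using 1
        ring
      · convert B.neg_mem _ (B.mul_mem _ _ (ofNat_mem B 2) (B.mul_mem _ _ (h2 (.inl (i, j)))
          (h2 (.inl (i, j))))) using 1
        simp only [deg2, Sum.elim_inl]
        ring)
  refine ⟨α, β, γ, δ, hdet, coord_mem _ (fun i => ?_) (fun i => ?_) (fun k => (h (.inl k)).1)
    (fun k => (h (.inl k)).2.1) fun k => (h (.inl k)).2.2⟩
  · refine mem_of_sq_mem B ?_
    convert (h (.inr i)).1 using 1
    simp only [act, Sum.elim_inr]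
    ring
  · refine mem_of_sq_mem B ?_
    convert (h (.inr i)).2.2 using 1
    simp only [act, Sum.elim_inr]
    ring

variable [Fintype ι] [Fintype κ] [DecidableEq ι] [DecidableEq κ] [Algebra ℂ K]
  {ρ σ : Type*} [Fintype ρ] [Fintype σ]
  {lam : (ρ × ((ι × ι) ⊕ (κ × κ))) ⊕ (σ × ((κ × ι × ι) ⊕ (κ × κ × κ))) → ℂ}

/-- If the generic linear combinations of the basic invariants are integral, so are all basic
invariants. -/
theorem deg2_mem_deg3_mem_of_combo_mem (hB : ∀ z : ℂ, algebraMap ℂ K z ∈ B)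
    (hlam : AlgebraicIndependent ℚ lam)
    (hι : 1 ≤ Fintype.card ι) (hκ : 1 ≤ Fintype.card κ)
    (hικ : Fintype.card ι ≤ 2 * Fintype.card κ + 1)
    (hρ : Fintype.card ρ = Fintype.card ι + 2 * Fintype.card κ - 2)
    (hσ : Fintype.card σ = Fintype.card ι + Fintype.card κ - 1) (s : FormSystem ι κ K)
    (h2 : ∀ j, s.combo2 (algebraMap ℂ K ∘ lam) j ∈ B)
    (h3 : ∀ j, s.combo3 (algebraMap ℂ K ∘ lam) j ∈ B) :
    (∀ l, s.deg2 l ∈ B) ∧ ∀ l, s.deg3 l ∈ B := by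
  have hpow : ∀ {n : ℕ} {x : K}, n ≠ 0 → x ^ n ∈ B → x ∈ B := fun {n x} hn h => by
    rw [← B.valuation_le_one_iff, map_pow] at h
    rw [← B.valuation_le_one_iff]
    exact (pow_le_one_iff hn).1 h
  let Q := Sum.elim (fun l => s.deg2 l ^ 3) fun l => s.deg3 l ^ 2
  by_cases hQ : ∀ l, Q l ∈ B
  · exact ⟨fun l => hpow (n := 3) (by norm_num) (hQ (.inl l)),
      fun l => hpow (n := 2) (by norm_num) (hQ (.inr l))⟩
  exfalso
  push Not at hQ
  obtain ⟨l₀, hl₀⟩ := hQ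
  obtain ⟨l, hl, hmax⟩ := exists_forall_div_mem B Q ⟨l₀, fun h => hl₀ (h ▸ B.zero_mem)⟩
  have hlB : Q l ∉ B := fun h => hl₀ (by
    have := B.mul_mem _ _ (hmax l₀) h
    rwa [div_mul_cancel₀ _ hl] at this)
  obtain ⟨t, ht⟩ := IsAlgClosed.exists_pow_nat_eq (Q l) (n := 6) (by norm_num)
  have ht0 : t ≠ 0 := by
    rintro rfl
    exact hl (by rw [← ht, zero_pow (by norm_num)])
  have htB : t ∉ B := fun h => hlB (ht ▸ pow_mem h 6)
  have htB' : t⁻¹ ∈ B := (B.mem_or_inv_mem t).resolve_left htB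
  have hd2 l' : (s.scale t⁻¹).deg2 l' ^ 3 = Q (.inl l') / Q l := by
    rw [deg2_scale, ← ht]
    simp only [Q, Sum.elim_inl]
    field_simp
  have hd3 l' : (s.scale t⁻¹).deg3 l' ^ 2 = Q (.inr l') / Q l := by
    rw [deg3_scale, ← ht]
    simp only [Q, Sum.elim_inr]
    field_simp
  obtain ⟨α, β, γ, δ, hdet, hcoord⟩ := exists_act_coord_mem B
    (by have := hB 2⁻¹; rwa [map_inv₀, map_ofNat] at this) (s.scale t⁻¹)
    (fun l' => hpow (n := 3) (by norm_num) (by rw [hd2]; exact hmax _))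
    (fun l' => hpow (n := 2) (by norm_num) (by rw [hd3]; exact hmax _))
  let s₀ : FormSystem ι κ B := ofCoord fun x => ⟨_, hcoord x⟩
  have hs₀ : s₀.map B.subtype = (s.scale t⁻¹).act α β γ δ := rfl
  let ψ : ℂ →+* B := (algebraMap ℂ K).codRestrict B hB
  have hψ : B.subtype ∘ (ψ ∘ lam) = algebraMap ℂ K ∘ lam := rfl
  let F := AlgebraicClosure (IsLocalRing.ResidueField B)
  let φ : B →+* F := (algebraMap _ F).comp (IsLocalRing.residue B)
  have hφt : φ ⟨t⁻¹, htB'⟩ = 0 := by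
    have : IsLocalRing.residue B ⟨t⁻¹, htB'⟩ = 0 := by
      rw [IsLocalRing.residue_eq_zero_iff, IsLocalRing.mem_maximalIdeal, mem_nonunits_iff,
        isUnit_iff_exists_inv]
      rintro ⟨y, hy⟩
      have hy' : t⁻¹ * (y : K) = 1 := congrArg Subtype.val hy
      refine htB ?_
      rw [← inv_inv t, ← eq_inv_of_mul_eq_one_right hy']
      exact y.2
    simp [φ, this]
  have hchar : CharZero F := charZero_of_injective_ringHom (φ.comp ψ).injective
  have hlamF : AlgebraicIndependent ℚ (φ ∘ (ψ ∘ lam)) :=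
    hlam.map' (f := (φ.comp ψ).toRatAlgHom) (φ.comp ψ).injective
  have hz2 j : (s₀.map φ).combo2 (φ ∘ (ψ ∘ lam)) j = 0 := by
    rw [combo2_map]
    have : s₀.combo2 (ψ ∘ lam) j = ⟨t⁻¹, htB'⟩ ^ 2 * ⟨_, h2 j⟩ := by
      refine Subtype.ext ?_
      change B.subtype _ = _
      rw [← combo2_map, hψ, hs₀, combo2_act _ _ hdet, combo2_scale]
      rfl
    rw [this, map_mul, map_pow, hφt]
    ring
  have hz3 j : (s₀.map φ).combo3 (φ ∘ (ψ ∘ lam)) j = 0 := by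
    rw [combo3_map]
    have : s₀.combo3 (ψ ∘ lam) j = ⟨t⁻¹, htB'⟩ ^ 3 * ⟨_, h3 j⟩ := by
      refine Subtype.ext ?_
      change B.subtype _ = _
      rw [← combo3_map, hψ, hs₀, combo3_act _ _ hdet, combo3_scale]
      rfl
    rw [this, map_mul, map_pow, hφt]
    ring
  obtain ⟨H2, H3⟩ := deg2_deg3_eq_zero_of_combo hlamF hι hκ hικ hρ hσ _ hz2 hz3
  rcases l with l | l
  · have h1 : s₀.deg2 l ^ 3 = 1 := by
      refine Subtype.ext ?_
      change B.subtype (s₀.deg2 l ^ 3) = 1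
      rw [map_pow, ← deg2_map, hs₀, deg2_act hdet, hd2, div_self hl]
    have := congrArg φ h1
    rw [map_pow, ← deg2_map, H2, map_one] at this
    norm_num at this
  · have h1 : s₀.deg3 l ^ 2 = 1 := by
      refine Subtype.ext ?_
      change B.subtype (s₀.deg3 l ^ 2) = 1
      rw [map_pow, ← deg3_map, hs₀, deg3_act hdet, hd3, div_self hl]
    have := congrArg φ h1
    rw [map_pow, ← deg3_map, H3, map_one] at this
    norm_num at this

end Valuation
end FormSystem
end BinInv

namespace BinInv

theorem isIntegral_of_forall_valuationSubring {O K : Type*} [CommRing O] [Algebra ℂ O] [Field K]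
    [Algebra O K] (hinj : Function.Injective (algebraMap O K)) (R : Subalgebra ℂ O) (f : O)
    (h : ∀ V : ValuationSubring K, (∀ r ∈ R, algebraMap O K r ∈ V) → algebraMap O K f ∈ V) :
    IsIntegral R f := by
  have h1 : algebraMap O K f ∈
      (integralClosure (Subring.closure (algebraMap O K '' (R : Set O))) K).toSubring := by
    rw [← iInf_valuationSubring_superset, Subring.mem_iInf]
    rintro ⟨V, hV⟩
    exact h V fun r hr => hV ⟨r, hr, rfl⟩
  have h2 : (integralClosure (Subring.closure (algebraMap O K '' (R : Set O))) K).toSubring ≤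
      (integralClosure R K).toSubring := by
    have : IsIntegrallyClosedIn (integralClosure R K).toSubring K :=
      inferInstanceAs (IsIntegrallyClosedIn (integralClosure R K) K)
    rw [Subring.integralClosure_subring_le_iff]
    refine Subring.closure_le.2 ?_
    rintro _ ⟨r, hr, rfl⟩
    exact isIntegral_algebraMap (R := R) (x := ⟨r, hr⟩)
  exact (isIntegral_algHom_iff (IsScalarTower.toAlgHom R O K) hinj).1 (h2 h1)

namespace FormSystem

variable {ι κ : Type*}

theorem coord_map {A B : Type*} (φ : A → B) (s : FormSystem ι κ A) :
    (s.map φ).coord = φ ∘ s.coord := by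
  funext t
  rcases t with ⟨i, e⟩ | ⟨i, e⟩ <;> fin_cases e <;> rfl

theorem ofCoord_coord {A : Type*} (s : FormSystem ι κ A) : ofCoord s.coord = s := rfl

theorem act_map {A B F : Type*} [CommRing A] [CommRing B] [FunLike F A B] [RingHomClass F A B]
    (φ : F) (α β γ δ : A) (s : FormSystem ι κ A) :
    (s.act α β γ δ).map φ = (s.map φ).act (φ α) (φ β) (φ γ) (φ δ) := by
  ext <;> simp [act, map, map_ofNat φ 2]

theorem aeval_coord_map {A B : Type*} [CommRing A] [CommRing B] [Algebra ℂ A] [Algebra ℂ B]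
    (φ : A →ₐ[ℂ] B) (s : FormSystem ι κ A) (f : MvPolynomial ((ι × Fin 2) ⊕ (κ × Fin 3)) ℂ) :
    φ (MvPolynomial.aeval s.coord f) = MvPolynomial.aeval (s.map φ).coord f := by
  rw [MvPolynomial.comp_aeval_apply, coord_map]
  rfl

/-- A polynomial function is invariant under unimodular substitutions. -/
def IsActInvariant (f : MvPolynomial ((ι × Fin 2) ⊕ (κ × Fin 3)) ℂ) : Prop :=
  ∀ α β γ δ : ℂ, α * δ - β * γ = 1 → ∀ s : FormSystem ι κ ℂ,
    MvPolynomial.eval (s.act α β γ δ).coord f = MvPolynomial.eval s.coord f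

theorem exists_elementary {K : Type*} [Field K] {α β γ δ : K} (h : α * δ - β * γ = 1) :
    ∃ a b c d : K, α = 1 + a * b ∧ β = a + c + a * b * c ∧ γ = b + d * (1 + a * b) ∧
      δ = 1 + b * c + d * (a + c + a * b * c) := by
  by_cases hγ : γ = 0
  · subst hγ
    have hα : α ≠ 0 := by rintro rfl; simp at h
    obtain ⟨a, ha⟩ : ∃ a, a * α = 1 - α := ⟨(1 - α) / α, div_mul_cancel₀ _ hα⟩
    obtain ⟨c, hc⟩ : ∃ c, c * α = 1 + β - δ := ⟨(1 + β - δ) / α, div_mul_cancel₀ _ hα⟩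
    refine ⟨a, -α, c, 1, by linear_combination ha, mul_right_cancel₀ hα ?_,
      by linear_combination ha, mul_right_cancel₀ hα ?_⟩
    · linear_combination -(1 - c * α) * ha - α * hc + h
    · linear_combination -(1 - c * α) * ha + h
  · obtain ⟨a, ha⟩ : ∃ a, a * γ = α - 1 := ⟨(α - 1) / γ, div_mul_cancel₀ _ hγ⟩
    obtain ⟨c, hc⟩ : ∃ c, c * γ = δ - 1 := ⟨(δ - 1) / γ, div_mul_cancel₀ _ hγ⟩
    refine ⟨a, γ, c, 0, by linear_combination -ha, mul_right_cancel₀ hγ ?_, by ring,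
      by linear_combination -hc⟩
    linear_combination (-1 - c * γ) * ha - α * hc - h

theorem IsActInvariant.aeval_act {f : MvPolynomial ((ι × Fin 2) ⊕ (κ × Fin 3)) ℂ}
    (hf : IsActInvariant f) {K : Type*} [Field K] [Algebra ℂ K] {α β γ δ : K}
    (h : α * δ - β * γ = 1) (s : FormSystem ι κ K) :
    MvPolynomial.aeval (s.act α β γ δ).coord f = MvPolynomial.aeval s.coord f := by
  obtain ⟨a, b, c, d, rfl, rfl, rfl, rfl⟩ := exists_elementary h
  let Y : Fin 4 → MvPolynomial (((ι × Fin 2) ⊕ (κ × Fin 3)) ⊕ Fin 4) ℂ :=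
    fun i => MvPolynomial.X (.inr i)
  let s₀ : FormSystem ι κ (MvPolynomial (((ι × Fin 2) ⊕ (κ × Fin 3)) ⊕ Fin 4) ℂ) :=
    ofCoord fun t => MvPolynomial.X (.inl t)
  have key : MvPolynomial.aeval (s₀.act (1 + Y 0 * Y 1) (Y 0 + Y 2 + Y 0 * Y 1 * Y 2)
      (Y 1 + Y 3 * (1 + Y 0 * Y 1))
      (1 + Y 1 * Y 2 + Y 3 * (Y 0 + Y 2 + Y 0 * Y 1 * Y 2))).coord f =
      MvPolynomial.aeval s₀.coord f := by
    refine MvPolynomial.funext fun z => ?_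
    have ev (s : FormSystem ι κ _) :
        MvPolynomial.eval z (MvPolynomial.aeval s.coord f) =
          MvPolynomial.eval (s.map (MvPolynomial.aeval (R := ℂ) z)).coord f := by
      rw [← MvPolynomial.coe_aeval_eq_eval, RingHom.coe_coe, aeval_coord_map,
        ← MvPolynomial.coe_aeval_eq_eval, RingHom.coe_coe]
    rw [ev, ev, act_map]
    refine hf _ _ _ _ ?_ _
    simp only [map_add, map_mul, map_one]
    ring
  let φ : MvPolynomial (((ι × Fin 2) ⊕ (κ × Fin 3)) ⊕ Fin 4) ℂ →ₐ[ℂ] K :=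
    MvPolynomial.aeval (Sum.elim s.coord ![a, b, c, d])
  have hs : s₀.map φ = s := by
    rw [map_ofCoord]
    conv_rhs => rw [← ofCoord_coord s]
    congr 1
    funext t
    simp [φ]
  have hY i : φ (Y i) = ![a, b, c, d] i := by simp [φ, Y]
  have := congrArg φ key
  rw [aeval_coord_map, aeval_coord_map, act_map, hs] at this
  simp only [map_add, map_mul, map_one, hY] at this
  exact this

/-- The system whose coefficients are the coordinate functions. -/
noncomputable def generic (ι κ : Type*) : FormSystem ι κ (MvPolynomial ((ι × Fin 2) ⊕ (κ × Fin 3)) ℂ) :=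
  ofCoord MvPolynomial.X

theorem generic_map_aeval {A : Type*} [CommRing A] [Algebra ℂ A] (s : FormSystem ι κ A) :
    (generic ι κ).map (MvPolynomial.aeval (R := ℂ) s.coord) = s := by
  rw [generic, map_ofCoord]
  conv_rhs => rw [← ofCoord_coord s]
  congr 1
  funext t
  simp

theorem generic_map_eval (s : FormSystem ι κ ℂ) :
    (generic ι κ).map (MvPolynomial.eval s.coord) = s := by
  rw [← MvPolynomial.coe_aeval_eq_eval]
  exact generic_map_aeval s

theorem isActInvariant_deg2 (l) : IsActInvariant ((generic ι κ).deg2 l) := by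
  intro α β γ δ h s
  rw [← deg2_map, ← deg2_map, generic_map_eval, generic_map_eval, deg2_act h]

theorem isActInvariant_deg3 (l) : IsActInvariant ((generic ι κ).deg3 l) := by
  intro α β γ δ h s
  rw [← deg3_map, ← deg3_map, generic_map_eval, generic_map_eval, deg3_act h]

variable [Fintype ι] [Fintype κ] {ρ σ : Type*}

/-- The parameters attached to a family of complex numbers. -/
noncomputable def params (lam : (ρ × ((ι × ι) ⊕ (κ × κ))) ⊕ (σ × ((κ × ι × ι) ⊕ (κ × κ × κ))) → ℂ) :
    ρ ⊕ σ → MvPolynomial ((ι × Fin 2) ⊕ (κ × Fin 3)) ℂ :=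
  Sum.elim ((generic ι κ).combo2 (MvPolynomial.C ∘ lam))
    ((generic ι κ).combo3 (MvPolynomial.C ∘ lam))

variable {lam : (ρ × ((ι × ι) ⊕ (κ × κ))) ⊕ (σ × ((κ × ι × ι) ⊕ (κ × κ × κ))) → ℂ}

theorem isActInvariant_params (j) : IsActInvariant (params lam j) := by
  intro α β γ δ h s
  rcases j with j | j
  · simp only [params, Sum.elim_inl]
    rw [← combo2_map, ← combo2_map, generic_map_eval, generic_map_eval, combo2_act]
    · congr 1
      funext x
      simp
    · exact h
  · simp only [params, Sum.elim_inr]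
    rw [← combo3_map, ← combo3_map, generic_map_eval, generic_map_eval, combo3_act]
    · congr 1
      funext x
      simp
    · exact h

/-- Invariants are integral over the subalgebra generated by generic parameters. -/
theorem IsActInvariant.isIntegral_adjoin_params [DecidableEq ι] [DecidableEq κ] [Fintype ρ]
    [Fintype σ] (hlam : AlgebraicIndependent ℚ lam)
    (hι : 1 ≤ Fintype.card ι) (hκ : 1 ≤ Fintype.card κ)
    (hικ : Fintype.card ι ≤ 2 * Fintype.card κ + 1)
    (hρ : Fintype.card ρ = Fintype.card ι + 2 * Fintype.card κ - 2)
    (hσ : Fintype.card σ = Fintype.card ι + Fintype.card κ - 1)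
    {f : MvPolynomial ((ι × Fin 2) ⊕ (κ × Fin 3)) ℂ} (hf : IsActInvariant f) :
    IsIntegral (Algebra.adjoin ℂ (Set.range (params lam))) f := by
  let O := MvPolynomial ((ι × Fin 2) ⊕ (κ × Fin 3)) ℂ
  let K := AlgebraicClosure (FractionRing O)
  have hinj : Function.Injective (algebraMap O K) := by
    rw [IsScalarTower.algebraMap_eq O (FractionRing O) K]
    exact (algebraMap (FractionRing O) K).injective.comp (IsFractionRing.injective O (FractionRing O))
  have : CharZero K := charZero_of_injective_ringHom hinj
  refine isIntegral_of_forall_valuationSubring (K := K) hinj _ _ fun V hV => ?_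
  let s : FormSystem ι κ K := (generic ι κ).map (algebraMap O K)
  have hC : ∀ z : ℂ, algebraMap ℂ K z ∈ V := fun z => by
    rw [IsScalarTower.algebraMap_apply ℂ O K]
    exact hV _ (Subalgebra.algebraMap_mem _ z)
  have hlam' : algebraMap O K ∘ (MvPolynomial.C ∘ lam) = algebraMap ℂ K ∘ lam := by
    funext x
    simp only [Function.comp]
    rw [IsScalarTower.algebraMap_apply ℂ O K]
    rfl
  obtain ⟨h2, h3⟩ := deg2_mem_deg3_mem_of_combo_mem V hC hlam hι hκ hικ hρ hσ s
    (fun j => by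
      rw [← hlam', combo2_map]
      exact hV _ (Algebra.subset_adjoin ⟨.inl j, rfl⟩))
    (fun j => by
      rw [← hlam', combo3_map]
      exact hV _ (Algebra.subset_adjoin ⟨.inr j, rfl⟩))
  obtain ⟨α, β, γ, δ, hdet, hmem⟩ := exists_act_coord_mem V
    (by have := hC 2⁻¹; rwa [map_inv₀, map_ofNat] at this) s h2 h3
  have hfs : algebraMap O K f = MvPolynomial.aeval s.coord f := by
    have := aeval_coord_map (IsScalarTower.toAlgHom ℂ O K) (generic ι κ) f
    rw [generic, coord_ofCoord, MvPolynomial.aeval_X_left] at this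
    exact this
  rw [hfs, ← hf.aeval_act hdet, MvPolynomial.aeval_def, MvPolynomial.eval₂_eq]
  exact sum_mem fun d _ => mul_mem (hC _) (prod_mem fun i _ => pow_mem (hmem i) _)

end FormSystem
end BinInv

namespace BinInv
namespace FormSystem

variable {ι κ : Type*}

/-- The coefficients of a system can be recovered algebraically from its invariants of degrees two
and three, the coefficients of one linear form, and one further polynomial. -/
theorem coord_mem_of_deg2_mem_deg3_mem {K : Type*} [Field K] [CharZero K] (E : Subfield K)
    (hE : ∀ z : K, z ^ 2 ∈ E → z ∈ E) (s : FormSystem ι κ K) (i : ι) (k : κ)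
    (h2 : ∀ l, s.deg2 l ∈ E) (h3 : ∀ l, s.deg3 l ∈ E) (hp : s.p i ∈ E) (hq : s.q i ∈ E)
    (hu : 2 * s.a k * s.q i - s.b k * s.p i ∈ E) (hp0 : s.p i ≠ 0)
    (hT : s.deg3 (.inl (k, i, i)) ≠ 0) (t) : s.coord t ∈ E := by
  have h20 : (2 : K) ≠ 0 := two_ne_zero
  have htwo : (2 : K) ∈ E := ofNat_mem E 2
  have hTE := h3 (.inl (k, i, i))
  have solve {r w z : K} (hr : r ∈ E) (hr0 : r ≠ 0) (hw : w ∈ E) (h : z * r = w) : z ∈ E := by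
    rw [eq_div_of_mul_eq hr0 h]
    exact div_mem hw hr
  have ha : s.a k ∈ E := by
    refine solve (mul_mem htwo hTE) (mul_ne_zero h20 hT)
      (sub_mem (pow_mem hu 2) (mul_mem (pow_mem hp 2) (h2 (.inr (k, k))))) ?_
    simp only [deg2, deg3, Sum.elim_inl, Sum.elim_inr]
    ring
  have hb : s.b k ∈ E :=
    solve hp hp0 (sub_mem (mul_mem (mul_mem htwo ha) hq) hu) (by ring)
  have hc : s.c k ∈ E := by
    refine solve (mul_mem htwo (pow_mem hp 2)) (mul_ne_zero h20 (pow_ne_zero 2 hp0))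
      (add_mem (sub_mem hTE (mul_mem (mul_mem htwo ha) (pow_mem hq 2)))
        (mul_mem (mul_mem (mul_mem htwo hb) hp) hq)) ?_
    simp only [deg3, Sum.elim_inl]
    ring
  refine coord_mem s (fun j => ?_) (fun j => ?_) (fun l => ?_) (fun l => ?_) (fun l => ?_) t
  · refine solve hTE hT (sub_mem (mul_mem hp (h3 (.inl (k, i, j))))
      (mul_mem hu (h2 (.inl (i, j))))) ?_
    simp only [deg2, deg3, Sum.elim_inl]
    ring
  · refine solve hTE hT (add_mem (mul_mem hq (h3 (.inl (k, i, j))))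
      (mul_mem (sub_mem (mul_mem (mul_mem htwo hc) hp) (mul_mem hb hq)) (h2 (.inl (i, j))))) ?_
    simp only [deg2, deg3, Sum.elim_inl]
    ring
  all_goals
    have hd : s.a l * (s.b k * s.q i ^ 2 - 2 * s.c k * s.p i * s.q i)
        - s.b l * (s.a k * s.q i ^ 2 - s.c k * s.p i ^ 2)
        + s.c l * (2 * s.a k * s.p i * s.q i - s.b k * s.p i ^ 2) ∈ E := by
      refine hE _ (solve (r := -(2 * 2)) (neg_mem (mul_mem htwo htwo))
        (neg_ne_zero.2 (mul_ne_zero h20 h20)) (w := 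
          2 * s.deg2 (.inr (l, k)) * s.deg3 (.inl (l, i, i)) * s.deg3 (.inl (k, i, i))
          - s.deg2 (.inr (l, l)) * s.deg3 (.inl (k, i, i)) ^ 2
          - s.deg2 (.inr (k, k)) * s.deg3 (.inl (l, i, i)) ^ 2) ?_ ?_)
      · clear hE solve
        have := h2 (.inr (l, k))
        have := h2 (.inr (l, l))
        have := h2 (.inr (k, k))
        have := h3 (.inl (l, i, i))
        apply_rules [sub_mem, mul_mem, pow_mem]
      · simp only [deg2, deg3, Sum.elim_inl, Sum.elim_inr]
        ring
    have hg1 := h2 (.inr (k, l))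
    have hg2 := h3 (.inl (l, i, i))
    have hx1 : s.b k * s.q i ^ 2 - 2 * s.c k * s.p i * s.q i ∈ E := by
      clear hE solve
      apply_rules [sub_mem, mul_mem, pow_mem]
    have hx2 : s.a k * s.q i ^ 2 - s.c k * s.p i ^ 2 ∈ E := by
      clear hE solve
      apply_rules [sub_mem, mul_mem, pow_mem]
    have hx3 : 2 * s.a k * s.p i * s.q i - s.b k * s.p i ^ 2 ∈ E := by
      clear hE solve
      apply_rules [sub_mem, mul_mem, pow_mem]
    set d := s.a l * (s.b k * s.q i ^ 2 - 2 * s.c k * s.p i * s.q i)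
        - s.b l * (s.a k * s.q i ^ 2 - s.c k * s.p i ^ 2)
        + s.c l * (2 * s.a k * s.p i * s.q i - s.b k * s.p i ^ 2) with hd_def
    set x1 := s.b k * s.q i ^ 2 - 2 * s.c k * s.p i * s.q i with hx1_def
    set x2 := s.a k * s.q i ^ 2 - s.c k * s.p i ^ 2 with hx2_def
    set x3 := 2 * s.a k * s.p i * s.q i - s.b k * s.p i ^ 2 with hx3_def
  · refine solve (pow_mem hTE 2) (pow_ne_zero 2 hT)
      (w := (-(2 * s.p i * s.q i) * x3 + 2 * s.p i ^ 2 * x2) * s.deg2 (.inr (k, l))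
        + (2 * s.a k * x2 - s.b k * x3) * s.deg3 (.inl (l, i, i))
        + (2 * s.b k * s.p i ^ 2 - 2 * s.a k * (2 * s.p i * s.q i)) * d) ?_ ?_
    · clear hE solve
      apply_rules [add_mem, sub_mem, mul_mem, pow_mem, neg_mem]
    · rw [hd_def, hx1_def, hx2_def, hx3_def]
      simp only [deg2, deg3, Sum.elim_inl, Sum.elim_inr]
      ring
  · refine solve (pow_mem hTE 2) (pow_ne_zero 2 hT)
      (w := (2 * s.p i ^ 2 * x1 - 2 * s.q i ^ 2 * x3) * s.deg2 (.inr (k, l))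
        + (2 * s.a k * x1 - 2 * s.c k * x3) * s.deg3 (.inl (l, i, i))
        + (2 * s.c k * (2 * s.p i ^ 2) - 2 * s.a k * (2 * s.q i ^ 2)) * d) ?_ ?_
    · clear hE solve
      apply_rules [add_mem, sub_mem, mul_mem, pow_mem, neg_mem]
    · rw [hd_def, hx1_def, hx2_def, hx3_def]
      simp only [deg2, deg3, Sum.elim_inl, Sum.elim_inr]
      ring
  · refine solve (pow_mem hTE 2) (pow_ne_zero 2 hT)
      (w := (2 * s.p i * s.q i * x1 - 2 * s.q i ^ 2 * x2) * s.deg2 (.inr (k, l))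
        + (s.b k * x1 - 2 * s.c k * x2) * s.deg3 (.inl (l, i, i))
        + (2 * s.c k * (2 * s.p i * s.q i) - s.b k * (2 * s.q i ^ 2)) * d) ?_ ?_
    · clear hE solve
      apply_rules [add_mem, sub_mem, mul_mem, pow_mem, neg_mem]
    · rw [hd_def, hx1_def, hx2_def, hx3_def]
      simp only [deg2, deg3, Sum.elim_inl, Sum.elim_inr]
      ring

end FormSystem
end BinInv

namespace BinInv
namespace FormSystem

variable {ι κ ρ σ : Type*} [Fintype ι] [Fintype κ] [DecidableEq ι] [DecidableEq κ] [Fintype ρ]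
  [Fintype σ] {lam : (ρ × ((ι × ι) ⊕ (κ × κ))) ⊕ (σ × ((κ × ι × ι) ⊕ (κ × κ × κ))) → ℂ}

theorem algebraicIndependent_params (hlam : AlgebraicIndependent ℚ lam)
    (hι : 1 ≤ Fintype.card ι) (hκ : 1 ≤ Fintype.card κ)
    (hικ : Fintype.card ι ≤ 2 * Fintype.card κ + 1)
    (hρ : Fintype.card ρ = Fintype.card ι + 2 * Fintype.card κ - 2)
    (hσ : Fintype.card σ = Fintype.card ι + Fintype.card κ - 1) :
    AlgebraicIndependent ℂ (params lam) := by
  obtain ⟨i⟩ : Nonempty ι := Fintype.card_pos_iff.1 hι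
  obtain ⟨k⟩ : Nonempty κ := Fintype.card_pos_iff.1 hκ
  let O := MvPolynomial ((ι × Fin 2) ⊕ (κ × Fin 3)) ℂ
  let K := FractionRing O
  let g := generic ι κ
  let y : Fin 3 → O := ![g.p i, g.q i, 2 * g.a k * g.q i - g.b k * g.p i]
  let x : (ρ ⊕ σ) ⊕ Fin 3 → O := Sum.elim (params lam) y
  let R := Algebra.adjoin ℂ (Set.range x)
  let E : Subfield K :=
    { (Subalgebra.algebraicClosure R K).toSubring with
      inv_mem' := fun z hz => IsAlgebraic.inv hz }
  have hinj : Function.Injective (algebraMap O K) := IsFractionRing.injective O K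
  have : CharZero K := charZero_of_injective_ringHom hinj
  have hxE j : algebraMap O K (x j) ∈ E :=
    isAlgebraic_algebraMap (⟨x j, Algebra.subset_adjoin ⟨j, rfl⟩⟩ : R)
  have hle : Algebra.adjoin ℂ (Set.range (params lam)) ≤ R :=
    Algebra.adjoin_mono (by rintro _ ⟨j, rfl⟩; exact ⟨.inl j, rfl⟩)
  have hinv {f : O} (hf : IsActInvariant f) : algebraMap O K f ∈ E := by
    have h1 := hf.isIntegral_adjoin_params hlam hι hκ hικ hρ hσ
    have h2 : IsIntegral R (algebraMap O K f) :=
      h1.map_of_comp_eq (Subalgebra.inclusion hle).toRingHom (algebraMap O K) rfl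
    exact h2.isAlgebraic
  have hE : ∀ z : K, z ^ 2 ∈ E → z ∈ E := fun z hz => IsAlgebraic.of_pow two_pos hz
  have hT : g.deg3 (.inl (k, i, i)) ≠ 0 := by
    intro h0
    let s : FormSystem ι κ ℂ := ⟨1, 0, 0, 0, 1⟩
    have := congrArg (MvPolynomial.eval s.coord) h0
    rw [← deg3_map, generic_map_eval] at this
    simp [deg3, s] at this
  have hcoord := coord_mem_of_deg2_mem_deg3_mem E hE (g.map (algebraMap O K)) i k
    (fun l => by rw [deg2_map]; exact hinv (isActInvariant_deg2 l))
    (fun l => by rw [deg3_map]; exact hinv (isActInvariant_deg3 l))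
    (hxE (.inr 0)) (hxE (.inr 1))
    (by simpa [x, y, map, map_ofNat (algebraMap O K) 2] using hxE (.inr 2))
    (fun h0 => MvPolynomial.X_ne_zero _ (hinj (h0.trans (map_zero _).symm)))
    (by rw [deg3_map]; exact fun h0 => hT (hinj (h0.trans (map_zero _).symm)))
  have halg : Algebra.IsAlgebraic R O := by
    have key : ∀ t, IsAlgebraic R (MvPolynomial.X t : O) := fun t => by
      have h1 : algebraMap O K (MvPolynomial.X t) ∈ E := by
        simpa [g, generic, coord_map, coord_ofCoord] using hcoord t
      exact (isAlgebraic_algebraMap_iff hinj).1 h1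
    refine ⟨fun f => ?_⟩
    induction f using MvPolynomial.induction_on with
    | C z => exact isAlgebraic_algebraMap (algebraMap ℂ R z)
    | add f g hf hg => exact hf.add hg
    | mul_X f t hf => exact hf.mul (key t)
  have hx : AlgebraicIndependent ℂ x := by
    refine (Algebra.IsAlgebraic.isTranscendenceBasis_of_lift_le_trdeg_of_finite ℂ x ?_).1
    rw [MvPolynomial.trdeg_of_isDomain]
    simp only [Cardinal.mk_fintype, Fintype.card_sum, Fintype.card_prod, Fintype.card_fin,
      Cardinal.lift_natCast, Nat.cast_le]
    omega
  exact hx.comp Sum.inl Sum.inl_injective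

end FormSystem
end BinInv

namespace BinInv

theorem coeff_sum_C_mul_X_pow {N : ℕ} (w : Fin (N + 1) → ℂ) (k : Fin (N + 1)) :
    MvPolynomial.coeff (Finsupp.single 0 (N - (k : ℕ)) + Finsupp.single 1 (k : ℕ))
      (∑ k : Fin (N + 1), MvPolynomial.C (w k) * MvPolynomial.X (0 : Fin 2) ^ (N - (k : ℕ)) *
        MvPolynomial.X 1 ^ (k : ℕ)) = w k := by
  rw [MvPolynomial.coeff_sum, Finset.sum_eq_single k]
  · rw [mul_assoc, MvPolynomial.coeff_C_mul, MvPolynomial.X_pow_eq_monomial,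
      MvPolynomial.X_pow_eq_monomial, MvPolynomial.monomial_mul, MvPolynomial.coeff_monomial]
    simp
  · intro l _ hl
    rw [mul_assoc, MvPolynomial.coeff_C_mul, MvPolynomial.X_pow_eq_monomial,
      MvPolynomial.X_pow_eq_monomial, MvPolynomial.monomial_mul, MvPolynomial.coeff_monomial,
      if_neg, mul_zero]
    intro h
    refine hl (Fin.ext ?_)
    simpa using DFunLike.congr_fun h 1
  · simp

variable {p : ℕ} (n : Fin p → ℕ) (g : Matrix.SpecialLinearGroup (Fin 2) ℂ) (c : Idx n → ℂ)

theorem formAt_of_eq {i : Fin p} {N : ℕ} (h : n i = N) :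
    formAt n c i = ∑ k : Fin (N + 1), MvPolynomial.C (c ⟨i, Fin.cast (by rw [h]) k⟩) *
      MvPolynomial.X 0 ^ (N - (k : ℕ)) * MvPolynomial.X 1 ^ (k : ℕ) := by
  subst h
  rfl

theorem actPt_of_eq_one {i : Fin p} (h : n i = 1) (k : Fin 2) :
    actPt n g c ⟨i, Fin.cast (by rw [h]) k⟩ =
      ![c ⟨i, Fin.cast (by rw [h]) (0 : Fin 2)⟩ * (↑(g⁻¹) : Matrix (Fin 2) (Fin 2) ℂ) 0 0
          + c ⟨i, Fin.cast (by rw [h]) (1 : Fin 2)⟩ * (↑(g⁻¹) : Matrix (Fin 2) (Fin 2) ℂ) 1 0,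
        c ⟨i, Fin.cast (by rw [h]) (0 : Fin 2)⟩ * (↑(g⁻¹) : Matrix (Fin 2) (Fin 2) ℂ) 0 1
          + c ⟨i, Fin.cast (by rw [h]) (1 : Fin 2)⟩ * (↑(g⁻¹) : Matrix (Fin 2) (Fin 2) ℂ) 1 1] k := by
  refine Eq.trans ?_ (coeff_sum_C_mul_X_pow (N := 1) _ k)
  rw [actPt, coeffAt, formAt_of_eq n c h, sl2Act]
  simp only [Fin.val_cast, h]
  generalize (↑(g⁻¹) : Matrix (Fin 2) (Fin 2) ℂ) = A
  congr 1
  rw [Fin.sum_univ_two, Fin.sum_univ_two]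
  simp [Fin.sum_univ_two]
  ring

theorem actPt_of_eq_two {i : Fin p} (h : n i = 2) (k : Fin 3) :
    actPt n g c ⟨i, Fin.cast (by rw [h]) k⟩ =
      ![c ⟨i, Fin.cast (by rw [h]) (0 : Fin 3)⟩ * (↑(g⁻¹) : Matrix (Fin 2) (Fin 2) ℂ) 0 0 ^ 2
          + c ⟨i, Fin.cast (by rw [h]) (1 : Fin 3)⟩ * ((↑(g⁻¹) : Matrix (Fin 2) (Fin 2) ℂ) 0 0 * (↑(g⁻¹) : Matrix (Fin 2) (Fin 2) ℂ) 1 0)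
          + c ⟨i, Fin.cast (by rw [h]) (2 : Fin 3)⟩ * (↑(g⁻¹) : Matrix (Fin 2) (Fin 2) ℂ) 1 0 ^ 2,
        2 * c ⟨i, Fin.cast (by rw [h]) (0 : Fin 3)⟩ * ((↑(g⁻¹) : Matrix (Fin 2) (Fin 2) ℂ) 0 0 * (↑(g⁻¹) : Matrix (Fin 2) (Fin 2) ℂ) 0 1)
          + c ⟨i, Fin.cast (by rw [h]) (1 : Fin 3)⟩ *
            ((↑(g⁻¹) : Matrix (Fin 2) (Fin 2) ℂ) 0 0 * (↑(g⁻¹) : Matrix (Fin 2) (Fin 2) ℂ) 1 1 + (↑(g⁻¹) : Matrix (Fin 2) (Fin 2) ℂ) 0 1 * (↑(g⁻¹) : Matrix (Fin 2) (Fin 2) ℂ) 1 0)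
          + 2 * c ⟨i, Fin.cast (by rw [h]) (2 : Fin 3)⟩ * ((↑(g⁻¹) : Matrix (Fin 2) (Fin 2) ℂ) 1 0 * (↑(g⁻¹) : Matrix (Fin 2) (Fin 2) ℂ) 1 1),
        c ⟨i, Fin.cast (by rw [h]) (0 : Fin 3)⟩ * (↑(g⁻¹) : Matrix (Fin 2) (Fin 2) ℂ) 0 1 ^ 2
          + c ⟨i, Fin.cast (by rw [h]) (1 : Fin 3)⟩ * ((↑(g⁻¹) : Matrix (Fin 2) (Fin 2) ℂ) 0 1 * (↑(g⁻¹) : Matrix (Fin 2) (Fin 2) ℂ) 1 1)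
          + c ⟨i, Fin.cast (by rw [h]) (2 : Fin 3)⟩ * (↑(g⁻¹) : Matrix (Fin 2) (Fin 2) ℂ) 1 1 ^ 2] k := by
  refine Eq.trans ?_ (coeff_sum_C_mul_X_pow (N := 2) _ k)
  rw [actPt, coeffAt, formAt_of_eq n c h, sl2Act]
  simp only [Fin.val_cast, h]
  generalize (↑(g⁻¹) : Matrix (Fin 2) (Fin 2) ℂ) = A
  congr 1
  rw [Fin.sum_univ_three, Fin.sum_univ_three]
  simp [Fin.sum_univ_two]
  rw [show (MvPolynomial.C 2 : MvPolynomial (Fin 2) ℂ) = 2 from map_ofNat MvPolynomial.C 2]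
  ring

/-- The degrees of a system of `m` linear and `n` quadratic forms. -/
abbrev degrees (m n : ℕ) : Fin (m + n) → ℕ := fun i => if (i : ℕ) < m then 1 else 2

theorem degrees_castAdd {m n : ℕ} (i : Fin m) : degrees m n (Fin.castAdd n i) = 1 :=
  if_pos i.2

theorem degrees_natAdd {m n : ℕ} (i : Fin n) : degrees m n (Fin.natAdd m i) = 2 :=
  if_neg (by simp)

/-- The coefficient indices of a system of `m` linear and `n` quadratic forms. -/
def toIdx (m n : ℕ) : (Fin m × Fin 2) ⊕ (Fin n × Fin 3) → Idx (degrees m n) :=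
  Sum.elim (fun x => ⟨Fin.castAdd n x.1, Fin.cast (by rw [degrees_castAdd]) x.2⟩)
    (fun x => ⟨Fin.natAdd m x.1, Fin.cast (by rw [degrees_natAdd]) x.2⟩)

theorem toIdx_bijective (m n : ℕ) : Function.Bijective (toIdx m n) := by
  constructor
  · have h (z w : Idx (degrees m n)) (hzw : z = w) :
        (z.1 : ℕ) = w.1 ∧ (z.2 : ℕ) = w.2 := by subst hzw; simp
    rintro (⟨⟨i, hi⟩, ⟨e, he⟩⟩ | ⟨⟨i, hi⟩, ⟨e, he⟩⟩) (⟨⟨j, hj⟩, ⟨f, hf⟩⟩ | ⟨⟨j, hj⟩, ⟨f, hf⟩⟩) hij <;>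
      have := h _ _ hij <;> simp [toIdx] at this ⊢ <;> omega
  · rintro ⟨i, k⟩
    induction i using Fin.addCases with
    | left i => exact ⟨.inl (i, Fin.cast (by rw [degrees_castAdd]) k), rfl⟩
    | right i => exact ⟨.inr (i, Fin.cast (by rw [degrees_natAdd]) k), rfl⟩

/-- The coefficient indices of a system of `m` linear and `n` quadratic forms. -/
noncomputable def idxEquiv (m n : ℕ) : (Fin m × Fin 2) ⊕ (Fin n × Fin 3) ≃ Idx (degrees m n) :=
  Equiv.ofBijective _ (toIdx_bijective m n)

theorem actPt_comp_idxEquiv (m n : ℕ) (g : Matrix.SpecialLinearGroup (Fin 2) ℂ)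
    (c : Idx (degrees m n) → ℂ) :
    actPt (degrees m n) g c ∘ idxEquiv m n =
      ((FormSystem.ofCoord (c ∘ idxEquiv m n)).act
        ((↑(g⁻¹) : Matrix (Fin 2) (Fin 2) ℂ) 0 0) ((↑(g⁻¹) : Matrix (Fin 2) (Fin 2) ℂ) 0 1) ((↑(g⁻¹) : Matrix (Fin 2) (Fin 2) ℂ) 1 0) ((↑(g⁻¹) : Matrix (Fin 2) (Fin 2) ℂ) 1 1)).coord := by
  funext t
  rcases t with ⟨i, k⟩ | ⟨i, k⟩
  · exact actPt_of_eq_one (degrees m n) g c (degrees_castAdd i) k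
  · exact actPt_of_eq_two (degrees m n) g c (degrees_natAdd i) k

end BinInv

namespace BinInv

theorem isInvariant_rename_iff {m n : ℕ} (f : MvPolynomial ((Fin m × Fin 2) ⊕ (Fin n × Fin 3)) ℂ) :
    IsInvariant (degrees m n) (MvPolynomial.rename (idxEquiv m n) f) ↔
      FormSystem.IsActInvariant f := by
  simp only [IsInvariant, MvPolynomial.eval_rename, actPt_comp_idxEquiv]
  constructor
  · intro h α β γ δ hdet s
    obtain ⟨g, hg⟩ : ∃ g : Matrix.SpecialLinearGroup (Fin 2) ℂ,
        (g : Matrix (Fin 2) (Fin 2) ℂ) = !![α, β; γ, δ] :=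
      ⟨⟨!![α, β; γ, δ], by rw [Matrix.det_fin_two_of, hdet]⟩, rfl⟩
    have := h g⁻¹ (s.coord ∘ (idxEquiv m n).symm)
    rw [inv_inv, hg, Function.comp_assoc, Equiv.symm_comp_self, Function.comp_id] at this
    exact this
  · intro h g c
    rw [h _ _ _ _ (by rw [← Matrix.det_fin_two]; exact (g⁻¹).2), FormSystem.coord_ofCoord]

namespace FormSystem

variable {ι κ : Type*}

theorem isHomogeneous_generic_deg2 (l) : ((generic ι κ).deg2 l).IsHomogeneous 2 := by
  have h2 : (2 : MvPolynomial ((ι × Fin 2) ⊕ (κ × Fin 3)) ℂ).IsHomogeneous 0 := by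
    rw [← map_ofNat MvPolynomial.C 2]
    exact MvPolynomial.isHomogeneous_C _ _
  have hX := MvPolynomial.isHomogeneous_X (R := ℂ) (σ := (ι × Fin 2) ⊕ (κ × Fin 3))
  rcases l with ⟨i, j⟩ | ⟨k, l⟩ <;> simp only [deg2, Sum.elim_inl, Sum.elim_inr]
  · exact ((hX _).mul (hX _)).sub ((hX _).mul (hX _))
  · exact (((hX _).mul (hX _)).sub ((h2.mul (hX _)).mul (hX _))).sub ((h2.mul (hX _)).mul (hX _))

theorem isHomogeneous_generic_deg3 (l) : ((generic ι κ).deg3 l).IsHomogeneous 3 := by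
  have h2 : (2 : MvPolynomial ((ι × Fin 2) ⊕ (κ × Fin 3)) ℂ).IsHomogeneous 0 := by
    rw [← map_ofNat MvPolynomial.C 2]
    exact MvPolynomial.isHomogeneous_C _ _
  have hX := MvPolynomial.isHomogeneous_X (R := ℂ) (σ := (ι × Fin 2) ⊕ (κ × Fin 3))
  have hXX x y := (hX x).mul (hX y)
  rcases l with ⟨k, i, j⟩ | ⟨k, l, r⟩ <;> simp only [deg3, Sum.elim_inl, Sum.elim_inr]
  · exact ((((h2.mul (hX _)).mul (hX _)).mul (hX _)).sub
      ((hX _).mul ((hXX _ _).add (hXX _ _)))).add (((h2.mul (hX _)).mul (hX _)).mul (hX _))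
  · exact (((hX _).mul ((hXX _ _).sub (hXX _ _))).sub
      ((hX _).mul ((hXX _ _).sub (hXX _ _)))).add ((hX _).mul ((hXX _ _).sub (hXX _ _)))

theorem isHomogeneous_params [Fintype ι] [Fintype κ] {ρ σ : Type*}
    (lam : (ρ × ((ι × ι) ⊕ (κ × κ))) ⊕ (σ × ((κ × ι × ι) ⊕ (κ × κ × κ))) → ℂ) (j : ρ ⊕ σ) :
    (params lam j).IsHomogeneous (Sum.elim (fun _ => 2) (fun _ => 3) j) := by
  rcases j with j | j
  · exact MvPolynomial.IsHomogeneous.sum _ _ _ fun l _ =>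
      (isHomogeneous_generic_deg2 l).C_mul _
  · exact MvPolynomial.IsHomogeneous.sum _ _ _ fun l _ =>
      (isHomogeneous_generic_deg3 l).C_mul _

end FormSystem
end BinInv

open BinInv in
/-- For `V = m·V₁ ⊕ n·V₂` with `m, n ≥ 1` and `2n + 1 ≥ m`, the invariant ring has a
homogeneous system of parameters consisting of `m + 2n − 2` invariants of degree 2 and
`m + n − 1` invariants of degree 3. -/
theorem mV1_nV2_hsop_small_m (m n : ℕ) (hm : 1 ≤ m) (hn : 1 ≤ n) (h : m ≤ 2 * n + 1) :
    ∃ P : Fin ((m + 2 * n - 2) + (m + n - 1)) →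
        MvPolynomial (Idx (fun i : Fin (m + n) => if (i : ℕ) < m then 1 else 2)) ℂ,
      IsHSOP (fun i : Fin (m + n) => if (i : ℕ) < m then 1 else 2) P
        (fun j => if (j : ℕ) < m + 2 * n - 2 then 2 else 3) := by
  classical
  obtain ⟨lam, hlam⟩ := exists_algebraicIndependent_complex
    ((Fin (m + 2 * n - 2) × ((Fin m × Fin m) ⊕ (Fin n × Fin n))) ⊕
      (Fin (m + n - 1) × ((Fin n × Fin m × Fin m) ⊕ (Fin n × Fin n × Fin n))))
  let e := idxEquiv m n
  let P : Fin ((m + 2 * n - 2) + (m + n - 1)) → MvPolynomial (Idx (degrees m n)) ℂ :=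
    fun j => rename e (FormSystem.params lam (finSumFinEquiv.symm j))
  refine ⟨P, fun j => ?_, fun j => ?_, fun j => ?_, ?_, fun x hx => ?_⟩
  · exact (isInvariant_rename_iff _).2 (FormSystem.isActInvariant_params _)
  · dsimp only
    split_ifs <;> norm_num
  · convert (FormSystem.isHomogeneous_params lam (finSumFinEquiv.symm j)).rename_isHomogeneous
      (f := e) using 1
    induction j using Fin.addCases with
    | left j => simp
    | right j => simp
  · have h1 := FormSystem.algebraicIndependent_params hlam (by simpa using hm) (by simpa using hn)
      (by simpa using h) (by simp) (by simp)
    exact (h1.map' (f := rename e) (rename_injective e e.injective)).comp finSumFinEquiv.symm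
      finSumFinEquiv.symm.injective
  · obtain ⟨f, rfl⟩ : ∃ f, rename e f = x := ⟨rename e.symm x, by simp [rename_rename]⟩
    have h1 := FormSystem.IsActInvariant.isIntegral_adjoin_params hlam (by simpa using hm)
      (by simpa using hn) (by simpa using h) (by simp) (by simp) ((isInvariant_rename_iff f).1 hx)
    have h2 : ∀ z : Algebra.adjoin ℂ (Set.range (FormSystem.params lam)),
        rename e (z : MvPolynomial ((Fin m × Fin 2) ⊕ (Fin n × Fin 3)) ℂ) ∈
          Algebra.adjoin ℂ (Set.range P) := by
      rintro ⟨z, hz⟩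
      have h3 : rename e z ∈ (Algebra.adjoin ℂ (Set.range (FormSystem.params lam))).map
          (rename e) := ⟨z, hz, rfl⟩
      rw [AlgHom.map_adjoin] at h3
      refine Algebra.adjoin_mono ?_ h3
      rintro _ ⟨_, ⟨j, rfl⟩, rfl⟩
      exact ⟨finSumFinEquiv j, by simp [P]⟩
    exact h1.map_of_comp_eq (((rename e).comp (Subalgebra.val _)).codRestrict _ h2).toRingHom
      (rename e).toRingHom rfl
end

section
/- Let m, n ≥ 1 and V = mV_1 ⊕ nV_2 (m copies of V_1 and n copies of V_2), and let R = O(V)^{SL(2,ℂ)}. If 2n + 1 < m, then R has a homogeneous system of parameters consisting of m + 2n − 2 invariants of degree 2, 3n invariants of degree 3, and m − 2n − 1 invariants of degree 6. -/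
open MvPolynomial

namespace LinQuad

/-- The bracket `[v, w]` of two linear forms. -/
def bk {A : Type*} [CommRing A] (v w : A × A) : A := v.1 * w.2 - v.2 * w.1

/-- The polarised discriminant of two quadratic forms. -/
def disc {A : Type*} [CommRing A] (f g : A × A × A) : A :=
  2 * f.1 * g.2.2 + 2 * f.2.2 * g.1 - f.2.1 * g.2.1

/-- The traceless endomorphism of the space of linear forms attached to a quadratic form. -/
def endo {A : Type*} [CommRing A] (f : A × A × A) (w : A × A) : A × A :=
  (f.2.1 * w.1 - 2 * f.1 * w.2, 2 * f.2.2 * w.1 - f.2.1 * w.2)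

/-- Half the trace of the product of three of the endomorphisms `endo`. -/
def triple {A : Type*} [CommRing A] (f g h : A × A × A) : A :=
  2 * (f.1 * (g.2.1 * h.2.2 - g.2.2 * h.2.1) - f.2.1 * (g.1 * h.2.2 - g.2.2 * h.1)
    + f.2.2 * (g.1 * h.2.1 - g.2.1 * h.1))

section Identities

variable {A : Type*} [CommRing A] (u v w : A × A) (f g h : A × A × A)

lemma bk_endo_left : bk (endo f v) w = -bk v (endo f w) := by
  simp only [bk, endo]; ring

lemma bk_endo_endo_add :
    bk v (endo f (endo g w)) + bk v (endo g (endo f w)) = -2 * disc f g * bk v w := by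
  simp only [bk, endo, disc]; ring

lemma bk_endo_endo_self_sq :
    bk v (endo f (endo g v)) ^ 2 = -(disc f f * bk v (endo g v) ^ 2
      - 2 * disc f g * bk v (endo f v) * bk v (endo g v) + disc g g * bk v (endo f v) ^ 2) := by
  simp only [bk, endo, disc]; ring

lemma bk_endo_endo_mul :
    bk v (endo f (endo g w)) * bk v (endo g (endo f w)) =
      -bk v (endo f (endo g v)) * bk w (endo f (endo g w))
        + disc f f * disc g g * bk v w ^ 2 := by
  simp only [bk, endo, disc]; ring

lemma bk_endo_endo_endo :
    bk u (endo f (endo g (endo h v))) = -disc f g * bk u (endo h v) + disc f h * bk u (endo g v)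
      - disc g h * bk u (endo f v) + triple f g h * bk u v := by
  simp only [bk, endo, disc, triple]; ring

lemma triple_sq :
    triple f g h ^ 2 = disc f f * (disc g g * disc h h - disc g h ^ 2)
      - disc f g * (disc f g * disc h h - disc g h * disc f h)
      + disc f h * (disc f g * disc g h - disc g g * disc f h) := by
  simp only [disc, triple]; ring

end Identities

end LinQuad

namespace LinQuad

section Lattice

variable {K : Type*} [Field K] (O : ValuationSubring K)

lemma mem_of_pow_mem {x : K} {k : ℕ} (hk : k ≠ 0) (h : x ^ k ∈ O) : x ∈ O := by
  rw [← ValuationSubring.valuation_le_one_iff, map_pow] at h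
  rw [← ValuationSubring.valuation_le_one_iff]
  by_contra! hx
  exact absurd h (not_le.mpr (one_lt_pow₀ hx hk))

lemma mem_of_add_mem_of_mul_mem {x y : K} (hadd : x + y ∈ O) (hmul : x * y ∈ O) : x ∈ O := by
  by_contra hx
  have hx0 : x ≠ 0 := fun h0 => hx (h0 ▸ zero_mem O)
  have hinv : x⁻¹ ∈ O := (O.mem_or_inv_mem x).resolve_left hx
  apply hx
  have : x = (x + y) - x * y * x⁻¹ := by field_simp; ring
  rw [this]
  exact sub_mem hadd (mul_mem hmul hinv)

/-- A maximal pair for the bracket on a finite family of vectors. -/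
lemma exists_maximal_bracket {T : Type*} [Finite T] (t : T → K × K)
    (hne : ∃ a b, bk (t a) (t b) ≠ 0) :
    ∃ a b, bk (t a) (t b) ≠ 0 ∧ ∀ a' b', bk (t a') (t b') / bk (t a) (t b) ∈ O := by
  obtain ⟨a₀, b₀, h₀⟩ := hne
  have : Nonempty (T × T) := ⟨(a₀, b₀)⟩
  obtain ⟨⟨a, b⟩, hab⟩ :=
    Finite.exists_max (fun x : T × T => O.valuation (bk (t x.1) (t x.2)))
  have hne : bk (t a) (t b) ≠ 0 := by
    intro h
    have := hab (a₀, b₀)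
    simp only [h, map_zero, le_zero_iff, map_eq_zero] at this
    exact h₀ this
  refine ⟨a, b, hne, fun a' b' => ?_⟩
  rw [← ValuationSubring.valuation_le_one_iff, map_div₀]
  exact div_le_one_of_le₀ (hab (a', b')) zero_le

variable {ι κ : Type*} (v : ι → K × K) (F : κ → K × K × K)

/-- The vectors obtained from `v` by applying at most two of the endomorphisms. -/
def words : ι ⊕ (κ × ι) ⊕ (κ × κ × ι) → K × K
  | .inl i => v i
  | .inr (.inl (k, i)) => endo (F k) (v i)
  | .inr (.inr (k, l, i)) => endo (F k) (endo (F l) (v i))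

variable {O v F}

lemma triple_mem (hF : ∀ k l, disc (F k) (F l) ∈ O) (k l r : κ) :
    triple (F k) (F l) (F r) ∈ O := by
  refine mem_of_pow_mem O two_ne_zero ?_
  rw [triple_sq]
  simp only [sq]
  refine add_mem (sub_mem ?_ ?_) ?_ <;>
  refine mul_mem (hF _ _) ?_ <;> refine sub_mem ?_ ?_ <;> exact mul_mem (hF _ _) (hF _ _)

lemma two_mem : (2 : K) ∈ O := by
  have := add_mem (one_mem O) (one_mem O)
  rwa [one_add_one_eq_two] at this

lemma bk_words_two_mem (hv : ∀ i j, bk (v i) (v j) ∈ O) (hF : ∀ k l, disc (F k) (F l) ∈ O)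
    (hvF : ∀ i k j, bk (v i) (endo (F k) (v j)) ∈ O) (i : ι) (k l : κ) (j : ι) :
    bk (v i) (endo (F k) (endo (F l) (v j))) ∈ O := by
  have hdiag : ∀ i, bk (v i) (endo (F k) (endo (F l) (v i))) ∈ O := by
    intro i
    refine mem_of_pow_mem O two_ne_zero ?_
    rw [bk_endo_endo_self_sq]
    simp only [sq]
    refine neg_mem (add_mem (sub_mem ?_ ?_) ?_)
    · exact mul_mem (hF _ _) (mul_mem (hvF _ _ _) (hvF _ _ _))
    · exact mul_mem (mul_mem (mul_mem two_mem (hF _ _)) (hvF _ _ _)) (hvF _ _ _)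
    · exact mul_mem (hF _ _) (mul_mem (hvF _ _ _) (hvF _ _ _))
  refine mem_of_add_mem_of_mul_mem O (y := bk (v i) (endo (F l) (endo (F k) (v j)))) ?_ ?_
  · rw [bk_endo_endo_add]
    exact mul_mem (mul_mem (neg_mem two_mem) (hF _ _)) (hv _ _)
  · rw [bk_endo_endo_mul, sq]
    exact add_mem (mul_mem (neg_mem (hdiag _)) (hdiag _))
      (mul_mem (mul_mem (hF _ _) (hF _ _)) (mul_mem (hv _ _) (hv _ _)))

lemma bk_words_three_mem (hv : ∀ i j, bk (v i) (v j) ∈ O) (hF : ∀ k l, disc (F k) (F l) ∈ O)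
    (hvF : ∀ i k j, bk (v i) (endo (F k) (v j)) ∈ O) (i : ι) (k l r : κ) (j : ι) :
    bk (v i) (endo (F k) (endo (F l) (endo (F r) (v j)))) ∈ O := by
  rw [bk_endo_endo_endo]
  exact add_mem (sub_mem (add_mem (mul_mem (neg_mem (hF _ _)) (hvF _ _ _))
    (mul_mem (hF _ _) (hvF _ _ _))) (mul_mem (hF _ _) (hvF _ _ _)))
    (mul_mem (triple_mem hF _ _ _) (hv _ _))

lemma bk_words_four_mem (hv : ∀ i j, bk (v i) (v j) ∈ O) (hF : ∀ k l, disc (F k) (F l) ∈ O)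
    (hvF : ∀ i k j, bk (v i) (endo (F k) (v j)) ∈ O) (i : ι) (k l r s : κ) (j : ι) :
    bk (v i) (endo (F k) (endo (F l) (endo (F r) (endo (F s) (v j))))) ∈ O := by
  have h2 := bk_words_two_mem hv hF hvF
  rw [bk_endo_endo_endo]
  exact add_mem (sub_mem (add_mem (mul_mem (neg_mem (hF _ _)) (h2 _ _ _ _))
    (mul_mem (hF _ _) (h2 _ _ _ _))) (mul_mem (hF _ _) (h2 _ _ _ _)))
    (mul_mem (triple_mem hF _ _ _) (hvF _ _ _))

lemma bk_words_mem (hv : ∀ i j, bk (v i) (v j) ∈ O) (hF : ∀ k l, disc (F k) (F l) ∈ O)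
    (hvF : ∀ i k j, bk (v i) (endo (F k) (v j)) ∈ O) (a b) :
    bk (words v F a) (words v F b) ∈ O := by
  have h2 := bk_words_two_mem hv hF hvF
  have h3 := bk_words_three_mem hv hF hvF
  have h4 := bk_words_four_mem hv hF hvF
  rcases a with i | ⟨k, i⟩ | ⟨k, l, i⟩ <;> rcases b with j | ⟨r, j⟩ | ⟨r, s, j⟩ <;>
  simp only [words, bk_endo_left, neg_neg]
  · exact hv i j
  · exact hvF i r j
  · exact h2 i r s j
  · exact neg_mem (hvF i k j)
  · exact neg_mem (h2 i k r j)
  · exact neg_mem (h3 i k r s j)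
  · exact h2 i l k j
  · exact h3 i l k r j
  · exact h4 i l k r s j

/-- If the brackets, polarised discriminants and evaluations are integral, there is a lattice
preserved by all the data, spanned by two vectors of integral bracket. -/
lemma exists_lattice [Finite ι] [Finite κ]
    (hv : ∀ i j, bk (v i) (v j) ∈ O) (hF : ∀ k l, disc (F k) (F l) ∈ O)
    (hvF : ∀ i k j, bk (v i) (endo (F k) (v j)) ∈ O) (hne : ∃ i j, bk (v i) (v j) ≠ 0) :
    ∃ w₁ w₂ : K × K, bk w₁ w₂ ≠ 0 ∧ bk w₁ w₂ ∈ O ∧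
      (∀ i, bk (v i) w₂ / bk w₁ w₂ ∈ O ∧ bk w₁ (v i) / bk w₁ w₂ ∈ O) ∧
      ∀ k, bk w₁ (endo (F k) w₁) / bk w₁ w₂ ∈ O ∧ bk w₁ (endo (F k) w₂) / bk w₁ w₂ ∈ O ∧
        bk w₂ (endo (F k) w₂) / bk w₁ w₂ ∈ O := by
  obtain ⟨i₀, j₀, h₀⟩ := hne
  obtain ⟨a, b, hab, hmax⟩ := exists_maximal_bracket O (words v F) ⟨.inl i₀, .inl j₀, h₀⟩
  have key : ∀ c k e,
      bk (words v F c) (endo (F k) (words v F e)) / bk (words v F a) (words v F b) ∈ O := by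
    intro c k e
    rcases e with j | ⟨r, j⟩ | ⟨r, s, j⟩
    · exact hmax c (.inr (.inl (k, j)))
    · exact hmax c (.inr (.inr (k, r, j)))
    · simp only [words]
      rw [bk_endo_endo_endo, add_div, sub_div, add_div, mul_div_assoc, mul_div_assoc,
        mul_div_assoc, mul_div_assoc]
      exact add_mem (sub_mem (add_mem
        (mul_mem (neg_mem (hF _ _)) (hmax c (.inr (.inl (s, j)))))
        (mul_mem (hF _ _) (hmax c (.inr (.inl (r, j))))))
        (mul_mem (hF _ _) (hmax c (.inr (.inl (k, j))))))
        (mul_mem (triple_mem hF _ _ _) (hmax c (.inl j)))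
  exact ⟨words v F a, words v F b, hab, bk_words_mem hv hF hvF a b,
    fun i => ⟨hmax (.inl i) b, hmax a (.inl i)⟩, fun k => ⟨key a k a, key a k b, key b k b⟩⟩

end Lattice

end LinQuad

namespace LinQuad

/-- Coordinates on `m` linear forms and `n` quadratic forms. -/
abbrev Ix (m n : ℕ) : Type := (Fin m × Fin 2) ⊕ (Fin n × Fin 3)

section Coordinates

variable {m n : ℕ} {A : Type*}

/-- The `i`-th linear form of a point. -/
def lin (c : Ix m n → A) (i : Fin m) : A × A := (c (.inl (i, 0)), c (.inl (i, 1)))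

/-- The `k`-th quadratic form of a point. -/
def quad (c : Ix m n → A) (k : Fin n) : A × A × A :=
  (c (.inr (k, 0)), c (.inr (k, 1)), c (.inr (k, 2)))

/-- The point with given linear and quadratic forms. -/
def point (v : Fin m → A × A) (F : Fin n → A × A × A) : Ix m n → A :=
  Sum.elim (fun x => ![(v x.1).1, (v x.1).2] x.2)
    (fun x => ![(F x.1).1, (F x.1).2.1, (F x.1).2.2] x.2)

@[simp] lemma lin_point (v : Fin m → A × A) (F : Fin n → A × A × A) : lin (point v F) = v := rfl

@[simp] lemma quad_point (v : Fin m → A × A) (F : Fin n → A × A × A) :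
    quad (point v F) = F := rfl

lemma forall_ix {P : Ix m n → Prop} (h : ∀ i, P (.inl (i, 0)) ∧ P (.inl (i, 1)))
    (h' : ∀ k, P (.inr (k, 0)) ∧ P (.inr (k, 1)) ∧ P (.inr (k, 2))) (x : Ix m n) : P x := by
  rcases x with ⟨i, j⟩ | ⟨k, j⟩
  · fin_cases j
    exacts [(h i).1, (h i).2]
  · fin_cases j
    exacts [(h' k).1, (h' k).2.1, (h' k).2.2]

end Coordinates

section Action

variable {m n : ℕ} {A : Type*} [CommRing A]

/-- Substitution of `p x + q y`, `r x + s y` into a linear form. -/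
def substLin (p q r s : A) (v : A × A) : A × A := (v.1 * p + v.2 * r, v.1 * q + v.2 * s)

/-- Substitution of `p x + q y`, `r x + s y` into a quadratic form. -/
def substQuad (p q r s : A) (f : A × A × A) : A × A × A :=
  (f.1 * p ^ 2 + f.2.1 * (p * r) + f.2.2 * r ^ 2,
    2 * f.1 * (p * q) + f.2.1 * (p * s + q * r) + 2 * f.2.2 * (r * s),
    f.1 * q ^ 2 + f.2.1 * (q * s) + f.2.2 * s ^ 2)

/-- Substitution of `p x + q y`, `r x + s y` into all forms. -/
def act (p q r s : A) (c : Ix m n → A) : Ix m n → A :=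
  point (fun i => substLin p q r s (lin c i)) (fun k => substQuad p q r s (quad c k))

@[simp] lemma lin_act (p q r s : A) (c : Ix m n → A) (i : Fin m) :
    lin (act p q r s c) i = substLin p q r s (lin c i) := rfl

@[simp] lemma quad_act (p q r s : A) (c : Ix m n → A) (k : Fin n) :
    quad (act p q r s c) k = substQuad p q r s (quad c k) := rfl

lemma bk_subst (p q r s : A) (v w : A × A) :
    bk (substLin p q r s v) (substLin p q r s w) = (p * s - q * r) * bk v w := by
  simp only [bk, substLin]; ring

lemma disc_subst (p q r s : A) (f g : A × A × A) :
    disc (substQuad p q r s f) (substQuad p q r s g) = (p * s - q * r) ^ 2 * disc f g := by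
  simp only [disc, substQuad]; ring

lemma bk_endo_subst (p q r s : A) (f : A × A × A) (v w : A × A) :
    bk (substLin p q r s v) (endo (substQuad p q r s f) (substLin p q r s w))
      = (p * s - q * r) ^ 2 * bk v (endo f w) := by
  simp only [bk, endo, substLin, substQuad]; ring

lemma act_act (p q r s p' q' r' s' : A) (c : Ix m n → A) :
    act p q r s (act p' q' r' s' c) =
      act (p' * p + q' * r) (p' * q + q' * s) (r' * p + s' * r) (r' * q + s' * s) c := by
  have h1 : ∀ v : A × A, substLin p q r s (substLin p' q' r' s' v) = substLin
      (p' * p + q' * r) (p' * q + q' * s) (r' * p + s' * r) (r' * q + s' * s) v := by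
    intro v; ext <;> simp only [substLin] <;> ring
  have h2 : ∀ v : A × A × A, substQuad p q r s (substQuad p' q' r' s' v) = substQuad
      (p' * p + q' * r) (p' * q + q' * s) (r' * p + s' * r) (r' * q + s' * s) v := by
    intro v; ext <;> simp only [substQuad] <;> ring
  unfold act
  congr 1
  · exact funext fun i => h1 _
  · exact funext fun k => h2 _

variable {B : Type*} [CommRing B]

lemma map_act (φ : A →+* B) (p q r s : A) (c : Ix m n → A) (x : Ix m n) :
    φ (act p q r s c x) = act (φ p) (φ q) (φ r) (φ s) (fun j => φ (c j)) x := by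
  induction x using forall_ix <;>
    simp [act, point, substLin, substQuad, lin, quad, map_ofNat φ 2]

end Action

section Invariance

variable {m n : ℕ}

open MvPolynomial

/-- Invariance of a polynomial function under unimodular substitutions. -/
def SubstInvariant (f : MvPolynomial (Ix m n) ℂ) : Prop :=
  ∀ p q r s : ℂ, p * s - q * r = 1 → ∀ c, eval (act p q r s c) f = eval c f

/-- Invariance under a one-parameter family of substitutions extends to all `ℂ`-algebras. -/
lemma SubstInvariant.aeval_family {f : MvPolynomial (Ix m n) ℂ} (hf : SubstInvariant f)
    (p q r s : MvPolynomial (Option (Ix m n)) ℂ) (h : p * s - q * r = 1)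
    {K : Type*} [CommRing K] [Algebra ℂ K] (t : K) (c : Ix m n → K) :
    aeval (act (aeval (fun o => o.elim t c) p) (aeval (fun o => o.elim t c) q)
      (aeval (fun o => o.elim t c) r) (aeval (fun o => o.elim t c) s) c) f = aeval c f := by
  have key : aeval (act p q r s (fun j => X (some j))) f = rename some f := by
    refine MvPolynomial.funext fun z => ?_
    have h1 := congrArg (eval z) h
    simp only [map_sub, map_mul, map_one] at h1
    have h2 := hf _ _ _ _ h1 (fun j => z (some j))
    rw [eval_rename]
    rw [show eval (z ∘ some) f = _ from h2.symm]
    rw [← coe_aeval_eq_eval, ← coe_aeval_eq_eval, RingHom.coe_coe, RingHom.coe_coe,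
      ← AlgHom.comp_apply, comp_aeval]
    congr 2
    funext x
    have := map_act (aeval z : MvPolynomial (Option (Ix m n)) ℂ →ₐ[ℂ] ℂ).toRingHom p q r s
      (fun j => X (some j)) x
    simpa using this
  have h3 := congrArg (aeval (fun o : Option (Ix m n) => o.elim t c)) key
  rw [aeval_rename, ← AlgHom.comp_apply, comp_aeval] at h3
  rw [show (fun o : Option (Ix m n) => o.elim t c) ∘ some = c from rfl] at h3
  rw [← h3]
  congr 2
  funext x
  have := map_act (aeval (fun o : Option (Ix m n) => o.elim t c)).toRingHom p q r s
      (fun j => X (some j)) x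
  simpa using this.symm

lemma SubstInvariant.aeval_act {f : MvPolynomial (Ix m n) ℂ} (hf : SubstInvariant f)
    {K : Type*} [Field K] [Algebra ℂ K] {p q r s : K} (h : p * s - q * r = 1)
    (c : Ix m n → K) : aeval (act p q r s c) f = aeval c f := by
  have upper : ∀ (t : K) c, aeval (act 1 t 0 1 c) f = aeval c f := fun t c => by
    simpa using hf.aeval_family 1 (X none) 0 1 (by simp) t c
  have lower : ∀ (t : K) c, aeval (act 1 0 t 1 c) f = aeval c f := fun t c => by
    simpa using hf.aeval_family 1 0 (X none) 1 (by simp) t c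
  have main : ∀ (p q r s : K), p * s - q * r = 1 → r ≠ 0 → ∀ c,
      aeval (act p q r s c) f = aeval c f := by
    intro p q r s h hr c
    have : act p q r s c = act 1 ((s - 1) / r) 0 1 (act 1 0 r 1 (act 1 ((p - 1) / r) 0 1 c)) := by
      rw [act_act, act_act]
      have hq : q = (p * s - 1) / r := by field_simp; linear_combination -h
      subst hq
      congr 1 <;> field_simp <;> ring
    rw [this, upper, lower, upper]
  by_cases hr : r = 0
  · subst hr
    have hs : s ≠ 0 := by rintro rfl; simp at h
    rw [← main (p + q) q s s (by linear_combination h) hs c]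
    have : act (p + q) q s s c = act 1 0 1 1 (act p q 0 s c) := by
      rw [act_act]; congr 1 <;> ring
    rw [this, lower]
  · exact main p q r s h hr c

end Invariance

end LinQuad

namespace LinQuad

section Values

variable (m n : ℕ)

/-- Index type of the quadratic invariants. -/
abbrev Ix2 : Type := (Fin m × Fin m) ⊕ (Fin n × Fin n)

/-- Index type of the cubic invariants. -/
abbrev Ix3 : Type := Fin n × Fin m × Fin m

variable {m n} {A : Type*} [CommRing A]

/-- The quadratic invariants: brackets and polarised discriminants. -/
def deg2 (c : Ix m n → A) : Ix2 m n → A :=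
  Sum.elim (fun x => bk (lin c x.1) (lin c x.2)) (fun x => disc (quad c x.1) (quad c x.2))

/-- The cubic invariants: the polarised values of quadratic forms on linear forms. -/
def deg3 (c : Ix m n → A) (x : Ix3 m n) : A :=
  bk (lin c x.2.1) (endo (quad c x.1) (lin c x.2.2))

lemma deg2_act {p q r s : A} (h : p * s - q * r = 1) (c : Ix m n → A) :
    deg2 (act p q r s c) = deg2 c := by
  funext b
  rcases b with ⟨i, j⟩ | ⟨k, l⟩ <;> simp [deg2, bk_subst, disc_subst, h]

lemma deg3_act {p q r s : A} (h : p * s - q * r = 1) (c : Ix m n → A) :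
    deg3 (act p q r s c) = deg3 c := by
  funext b
  simp [deg3, bk_endo_subst, h]

lemma deg2_smul (t : A) (c : Ix m n → A) (b : Ix2 m n) :
    deg2 (t • c) b = t ^ 2 * deg2 c b := by
  rcases b with ⟨i, j⟩ | ⟨k, l⟩ <;> simp [deg2, lin, quad, bk, disc] <;> ring

lemma deg3_smul (t : A) (c : Ix m n → A) (b : Ix3 m n) :
    deg3 (t • c) b = t ^ 3 * deg3 c b := by
  simp [deg3, lin, quad, bk, endo]; ring

lemma map_deg2 {B F : Type*} [CommRing B] [FunLike F A B] [RingHomClass F A B] (φ : F)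
    (c : Ix m n → A) (b : Ix2 m n) : φ (deg2 c b) = deg2 (fun x => φ (c x)) b := by
  rcases b with ⟨i, j⟩ | ⟨k, l⟩ <;> simp [deg2, lin, quad, bk, disc, map_ofNat φ 2]

lemma map_deg3 {B F : Type*} [CommRing B] [FunLike F A B] [RingHomClass F A B] (φ : F)
    (c : Ix m n → A) (b : Ix3 m n) : φ (deg3 c b) = deg3 (fun x => φ (c x)) b := by
  simp [deg3, lin, quad, bk, endo, map_ofNat φ 2]

end Values

section Orbit

variable {m n : ℕ} {K : Type*} [Field K] [IsAlgClosed K] {O : ValuationSubring K}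

/-- A point with integral invariants, two of whose linear forms are independent, has an
integral point in its orbit. -/
lemma exists_integral_act (htwo : (2 : K)⁻¹ ∈ O) (h2 : (2 : K) ≠ 0) (c : Ix m n → K)
    (hc2 : ∀ b, deg2 c b ∈ O) (hc3 : ∀ b, deg3 c b ∈ O)
    (hne : ∃ i j, bk (lin c i) (lin c j) ≠ 0) :
    ∃ p q r s : K, p * s - q * r = 1 ∧ ∀ x, act p q r s c x ∈ O := by
  obtain ⟨w₁, w₂, hd, hdO, hv, hF⟩ := exists_lattice (v := lin c) (F := quad c)
    (fun i j => hc2 (.inl (i, j))) (fun k l => hc2 (.inr (k, l)))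
    (fun i k j => hc3 (k, i, j)) hne
  obtain ⟨t, ht⟩ := IsAlgClosed.exists_pow_nat_eq (bk w₁ w₂) two_pos
  have ht0 : t ≠ 0 := by rintro rfl; simp at ht; exact hd ht.symm
  have htO : t ∈ O := mem_of_pow_mem O two_ne_zero (ht ▸ hdO)
  rw [← ht] at hv hF
  refine ⟨w₂.2 / t, -w₁.2 / t, -w₂.1 / t, w₁.1 / t, ?_, forall_ix (fun i => ?_) (fun k => ?_)⟩
  · field_simp
    rw [ht, bk]; ring
  · obtain ⟨h1, h2⟩ := hv i
    constructor
    · convert mul_mem htO h1 using 1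
      simp only [act, point, substLin, bk, Sum.elim_inl, Matrix.cons_val_zero]
      field_simp; ring
    · convert mul_mem htO h2 using 1
      simp only [act, point, substLin, bk, Sum.elim_inl, Matrix.cons_val_one,
        Matrix.cons_val_zero]
      field_simp; ring
  · obtain ⟨h11, h12, h22⟩ := hF k
    refine ⟨?_, ?_, ?_⟩
    · convert mul_mem htwo h22 using 1
      simp only [act, point, substQuad, bk, endo, Sum.elim_inr, Matrix.cons_val_zero]
      field_simp; ring
    · convert neg_mem h12 using 1
      simp only [act, point, substQuad, bk, endo, Sum.elim_inr, Matrix.cons_val_one,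
        Matrix.cons_val_zero]
      field_simp; ring
    · convert mul_mem htwo h11 using 1
      simp only [act, point, substQuad, bk, endo, Sum.elim_inr, Matrix.cons_val]
      field_simp; ring

end Orbit

end LinQuad

namespace LinQuad

open MvPolynomial

section Zeros

variable {σ ι : Type*}

lemma aeval_smul_of_isHomogeneous {K : Type*} [CommRing K] [Algebra ℂ K]
    {P : MvPolynomial σ ℂ} {d : ℕ} (hP : P.IsHomogeneous d) (t : K) (c : σ → K) :
    aeval (t • c) P = t ^ d * aeval c P := by
  rw [aeval_def, aeval_def, eval₂_eq, eval₂_eq, Finset.mul_sum]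
  refine Finset.sum_congr rfl fun x hx => ?_
  have hd : x.degree = d := by
    rw [Finsupp.degree_eq_weight_one]
    exact hP (mem_support_iff.mp hx)
  simp only [Pi.smul_apply, smul_eq_mul, mul_pow, Finset.prod_mul_distrib]
  rw [Finset.prod_pow_eq_pow_sum, ← hd, Finsupp.degree]
  ring_nf
  rfl

/-- A polynomial vanishing on the common zeros of a family has a power in its ideal. -/
lemma exists_pow_mem_span [Finite σ] (P : ι → MvPolynomial σ ℂ) (f : MvPolynomial σ ℂ)
    (h : ∀ c : σ → ℂ, (∀ j, eval c (P j) = 0) → eval c f = 0) :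
    ∃ N : ℕ, f ^ N ∈ Ideal.span (Set.range P) := by
  change f ∈ (Ideal.span (Set.range P)).radical
  rw [← vanishingIdeal_zeroLocus_eq_radical (K := ℂ), mem_vanishingIdeal_iff]
  intro c hc
  rw [mem_zeroLocus_iff] at hc
  simpa using h c fun j => by simpa using hc (P j) (Ideal.subset_span ⟨j, rfl⟩)

variable {K : Type*} [Field K] [Algebra ℂ K] {O : ValuationSubring K}

lemma aeval_mem (hC : ∀ r : ℂ, algebraMap ℂ K r ∈ O) {z : σ → K} (hz : ∀ x, z x ∈ O)
    (f : MvPolynomial σ ℂ) : aeval z f ∈ O := by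
  induction f using MvPolynomial.induction_on with
  | C r => simpa using hC r
  | add p q hp hq => simpa using add_mem hp hq
  | mul_X p i hp => simpa using mul_mem hp (hz i)

lemma valuation_aeval_lt_one (hC : ∀ r : ℂ, algebraMap ℂ K r ∈ O) {z : σ → K}
    (hz : ∀ x, z x ∈ O) {P : ι → MvPolynomial σ ℂ}
    (hP : ∀ j, O.valuation (aeval z (P j)) < 1) {f : MvPolynomial σ ℂ}
    (hf : f ∈ Ideal.span (Set.range P)) : O.valuation (aeval z f) < 1 := by
  induction hf using Submodule.span_induction with
  | mem x hx => obtain ⟨j, rfl⟩ := hx; exact hP j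
  | zero => simp
  | add x y _ _ hx hy =>
    rw [map_add]
    exact O.valuation.map_add_lt hx hy
  | smul a x _ hx =>
    rw [smul_eq_mul, map_mul, map_mul, mul_comm]
    exact mul_lt_one_of_lt_of_le hx ((O.valuation_le_one_iff _).2 (aeval_mem hC hz a))

end Zeros

section Integrality

variable {m n : ℕ} {ι : Type*} {P : ι → MvPolynomial (Ix m n) ℂ} {d : ι → ℕ}

/-- The family vanishes only where all basic invariants vanish. -/
def DefinesNullcone (P : ι → MvPolynomial (Ix m n) ℂ) : Prop :=
  ∀ c : Ix m n → ℂ, (∀ j, eval c (P j) = 0) → (∀ b, deg2 c b = 0) ∧ ∀ b, deg3 c b = 0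

/-- The basic invariants raised to powers of common degree six. -/
def deg6 {A : Type*} [CommRing A] (c : Ix m n → A) : Ix2 m n ⊕ Ix3 m n → A :=
  Sum.elim (fun b => deg2 c b ^ 3) (fun b => deg3 c b ^ 2)

lemma map_deg6 {A B F : Type*} [CommRing A] [CommRing B] [FunLike F A B] [RingHomClass F A B]
    (φ : F) (c : Ix m n → A) (b : Ix2 m n ⊕ Ix3 m n) :
    φ (deg6 c b) = deg6 (fun x => φ (c x)) b := by
  rcases b with b | b <;> simp [deg6, map_deg2, map_deg3]

lemma deg6_smul {A : Type*} [CommRing A] (t : A) (c : Ix m n → A) (b : Ix2 m n ⊕ Ix3 m n) :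
    deg6 (t • c) b = t ^ 6 * deg6 c b := by
  rcases b with b | b <;> simp [deg6, deg2_smul, deg3_smul, mul_pow, ← pow_mul]

variable {K : Type*} [Field K] [Algebra ℂ K] [IsAlgClosed K] {O : ValuationSubring K}

lemma deg6_mem (hC : ∀ r : ℂ, algebraMap ℂ K r ∈ O) (hinv : ∀ j, SubstInvariant (P j))
    (hhom : ∀ j, (P j).IsHomogeneous (d j)) (hd : ∀ j, 0 < d j) (hP : DefinesNullcone P)
    {c : Ix m n → K} (hne : ∃ i j, bk (lin c i) (lin c j) ≠ 0)
    (hc : ∀ j, aeval c (P j) ∈ O) (b : Ix2 m n ⊕ Ix3 m n) : deg6 c b ∈ O := by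
  have : CharZero K := charZero_of_injective_algebraMap (algebraMap ℂ K).injective
  have htwo : (2 : K)⁻¹ ∈ O := by simpa only [map_inv₀, map_ofNat] using hC 2⁻¹
  obtain ⟨b₀, hb₀⟩ := @Finite.exists_max _ _ _ ⟨b⟩ _ fun b => O.valuation (deg6 c b)
  by_cases he : O.valuation (deg6 c b₀) ≤ 1
  · exact (O.valuation_le_one_iff _).1 ((hb₀ b).trans he)
  exfalso
  rw [not_le] at he
  have he0 : deg6 c b₀ ≠ 0 := by
    intro h0
    simp [h0] at he
  obtain ⟨t, ht⟩ := IsAlgClosed.exists_pow_nat_eq (deg6 c b₀)⁻¹ (n := 6) (by norm_num)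
  have ht0 : t ≠ 0 := by
    rintro rfl
    simp at ht
    exact he0 ht.symm
  have ht1 : O.valuation t < 1 := by
    by_contra hlt
    rw [not_lt] at hlt
    have h1 : 1 ≤ O.valuation t ^ 6 := one_le_pow₀ hlt
    rw [← map_pow, ht, map_inv₀] at h1
    exact absurd h1 (not_le.2 (inv_lt_one_of_one_lt₀ he))
  have hmem : ∀ b, deg6 (t • c) b ∈ O := by
    intro b
    rw [← O.valuation_le_one_iff, deg6_smul, ht, map_mul, map_inv₀]
    have h0 : O.valuation (deg6 c b₀) ≠ 0 := by simpa using he0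
    calc _ ≤ (O.valuation (deg6 c b₀))⁻¹ * O.valuation (deg6 c b₀) := by
            gcongr; exact hb₀ b
      _ = 1 := inv_mul_cancel₀ h0
  obtain ⟨i, j, hij⟩ := hne
  obtain ⟨p, q, r, s, hdet, hz⟩ := exists_integral_act htwo two_ne_zero (t • c)
    (fun b => mem_of_pow_mem O three_ne_zero (hmem (.inl b)))
    (fun b => mem_of_pow_mem O two_ne_zero (hmem (.inr b)))
    ⟨i, j, by
      have := deg2_smul t c (.inl (i, j))
      simp only [deg2, Sum.elim_inl] at this
      rw [this]
      exact mul_ne_zero (pow_ne_zero _ ht0) hij⟩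
  obtain ⟨N, hN⟩ := exists_pow_mem_span P (deg6 X b₀) fun z hz => by
    obtain ⟨h2, h3⟩ := hP z hz
    rw [map_deg6]
    rcases b₀ with b | b <;> simp [deg6, h2, h3]
  have hlt := valuation_aeval_lt_one hC hz (fun j => by
    rw [(hinv j).aeval_act hdet, aeval_smul_of_isHomogeneous (hhom j), map_mul, map_pow]
    exact mul_lt_one_of_lt_of_le (pow_lt_one₀ zero_le ht1 (hd j).ne')
      ((O.valuation_le_one_iff _).2 (hc j))) hN
  rw [map_pow, map_deg6] at hlt
  have h1 : deg6 (fun x => aeval (act p q r s (t • c)) (X x : MvPolynomial (Ix m n) ℂ)) b₀ = 1 := by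
    have h2 : deg6 (act p q r s (t • c)) b₀ = deg6 (t • c) b₀ := by
      simp only [deg6, deg2_act hdet, deg3_act hdet]
    simp only [aeval_X]
    rw [h2, deg6_smul, ht, inv_mul_cancel₀ he0]
  rw [h1] at hlt
  simp at hlt

lemma SubstInvariant.aeval_mem (hC : ∀ r : ℂ, algebraMap ℂ K r ∈ O)
    (hinv : ∀ j, SubstInvariant (P j)) (hhom : ∀ j, (P j).IsHomogeneous (d j))
    (hd : ∀ j, 0 < d j) (hP : DefinesNullcone P) {c : Ix m n → K}
    (hne : ∃ i j, bk (lin c i) (lin c j) ≠ 0) (hc : ∀ j, aeval c (P j) ∈ O)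
    {f : MvPolynomial (Ix m n) ℂ} (hf : SubstInvariant f) : aeval c f ∈ O := by
  have : CharZero K := charZero_of_injective_algebraMap (algebraMap ℂ K).injective
  have htwo : (2 : K)⁻¹ ∈ O := by simpa only [map_inv₀, map_ofNat] using hC 2⁻¹
  have hmem := deg6_mem hC hinv hhom hd hP hne hc
  obtain ⟨p, q, r, s, hdet, hz⟩ := exists_integral_act htwo two_ne_zero c
    (fun b => mem_of_pow_mem O three_ne_zero (hmem (.inl b)))
    (fun b => mem_of_pow_mem O two_ne_zero (hmem (.inr b))) hne
  rw [← hf.aeval_act hdet]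
  exact LinQuad.aeval_mem hC hz f

lemma bk_lin_X_ne_zero {i j : Fin m} (hij : i ≠ j) :
    bk (lin (X : Ix m n → MvPolynomial (Ix m n) ℂ) i) (lin X j) ≠ 0 := by
  intro h
  have := congrArg (eval (point (fun l => if l = i then ((1 : ℂ), (0 : ℂ)) else (0, 1))
    (fun _ : Fin n => 0))) h
  simp [bk, lin, point, hij.symm] at this

/-- Invariants are integral over a homogeneous family of invariants defining the nullcone. -/
theorem SubstInvariant.isIntegral_adjoin (hm : 2 ≤ m) (hinv : ∀ j, SubstInvariant (P j))
    (hhom : ∀ j, (P j).IsHomogeneous (d j)) (hd : ∀ j, 0 < d j) (hP : DefinesNullcone P)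
    {f : MvPolynomial (Ix m n) ℂ} (hf : SubstInvariant f) :
    IsIntegral (Algebra.adjoin ℂ (Set.range P)) f := by
  let A := MvPolynomial (Ix m n) ℂ
  let K := AlgebraicClosure (FractionRing A)
  let R := Algebra.adjoin ℂ (Set.range P)
  have hinj : Function.Injective (algebraMap A K) := by
    rw [IsScalarTower.algebraMap_eq A (FractionRing A) K]
    exact (algebraMap (FractionRing A) K).injective.comp (IsFractionRing.injective A _)
  let T : Subring K := (R.toSubring).map (algebraMap A K)
  have hmem : algebraMap A K f ∈ (integralClosure (Subring.closure (T : Set K)) K).toSubring := by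
    rw [← iInf_valuationSubring_superset, Subring.mem_iInf]
    rintro ⟨O, hO⟩
    have hR : ∀ g ∈ R, algebraMap A K g ∈ O := fun g hg => hO ⟨g, hg, rfl⟩
    have hae : ∀ g : A, aeval (fun x => algebraMap A K (X x)) g = algebraMap A K g := by
      intro g
      have := aeval_algebraMap_apply K (X : Ix m n → A) g
      simpa [Function.comp_def] using this
    change algebraMap A K f ∈ O
    rw [← hae]
    refine hf.aeval_mem (fun r => ?_) hinv hhom hd hP ?_ (fun j => ?_)
    · rw [IsScalarTower.algebraMap_apply ℂ A K]
      exact hR _ (R.algebraMap_mem r)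
    · refine ⟨⟨0, by omega⟩, ⟨1, by omega⟩, ?_⟩
      have := (map_ne_zero_iff _ hinj).2
        (bk_lin_X_ne_zero (n := n) (i := (⟨0, by omega⟩ : Fin m)) (j := ⟨1, by omega⟩) (by simp))
      simpa [bk, lin] using this
    · rw [hae]
      exact hR _ (Algebra.subset_adjoin ⟨j, rfl⟩)
  rw [Subring.closure_eq] at hmem
  obtain ⟨p, hp, hpf⟩ : IsIntegral T (algebraMap A K f) := hmem
  let e : R.toSubring ≃+* T := R.toSubring.equivMapOfInjective (algebraMap A K) hinj
  refine ⟨p.map (e.symm : T →+* R.toSubring), hp.map _, hinj ?_⟩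
  rw [map_zero, ← hpf, Polynomial.eval₂_map, Polynomial.hom_eval₂]
  congr 1
  ext x
  obtain ⟨y, rfl⟩ := e.surjective x
  simp only [RingHom.comp_apply, RingEquiv.coe_toRingHom, RingEquiv.symm_apply_apply]
  rfl

end Integrality

end LinQuad

namespace LinQuad

section Generic

open Algebra

lemma card_le_of_forall_isAlgebraic {ι F E : Type*} [Fintype ι] [Field F] [Field E]
    [Algebra F E] {u : ι → E} (hu : AlgebraicIndependent F u) (G : Finset E)
    (h : ∀ i, IsAlgebraic (adjoin F (G : Set E)) (u i)) : Fintype.card ι ≤ G.card := by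
  let M := AlgebraicIndependent.matroid F E
  have hind : M.Indep (Set.range u) := hu.to_subtype_range
  have hsub : Set.range u ⊆ M.closure G := by
    rw [AlgebraicIndependent.matroid_closure_eq]
    rintro _ ⟨i, rfl⟩
    exact h i
  have h1 := hind.encard_le_eRk_of_subset hsub
  rw [M.eRk_closure_eq] at h1
  have h2 := h1.trans (M.eRk_le_encard G)
  rw [Set.encard_coe_eq_coe_finsetCard, ← Set.image_univ, hu.injective.encard_image,
    Set.encard_univ, ENat.card_eq_coe_fintype_card] at h2
  exact_mod_cast h2

/-- A system of linear equations with algebraically independent coefficients whose unknowns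
depend on few parameters has only few nontrivial equations. -/
lemma card_le_of_generic {σ J B : Type*} [Fintype J] [Fintype B] [Nonempty B]
    {u : J × B → ℂ} (hu : AlgebraicIndependent ℚ u) (x : σ → ℂ) (w : J → B → ℂ)
    (hw : ∀ j b, w j b ∈ adjoin ℚ (Set.range x)) (hsum : ∀ j, ∑ b, u (j, b) * w j b = 0)
    (S : Finset J) (hS : ∀ j ∈ S, ∃ b, w j b ≠ 0) (T : Finset σ)
    (hT : ∀ i ∉ T, x i = 0 ∨ x i = 1) : S.card ≤ T.card := by
  classical
  have hS' : ∀ j, ∃ b, j ∈ S → w j b ≠ 0 := by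
    intro j
    by_cases hj : j ∈ S
    · obtain ⟨b, hb⟩ := hS j hj
      exact ⟨b, fun _ => hb⟩
    · exact ⟨Classical.arbitrary B, fun h => absurd h hj⟩
  choose g hg using hS'
  set S' : Finset (J × B) := S.image fun j => (j, g j)
  have hcard : S'.card = S.card :=
    Finset.card_image_of_injective _ fun a b h => congrArg Prod.fst h
  set G : Finset ℂ := T.image x ∪ S'ᶜ.image u with hG
  set M := Subalgebra.algebraicClosure (adjoin ℚ (G : Set ℂ)) ℂ with hM
  have hGM : ∀ z ∈ G, z ∈ M := fun z hz =>
    isAlgebraic_algebraMap (⟨z, subset_adjoin hz⟩ : adjoin ℚ (G : Set ℂ))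
  have hxM : ∀ i, x i ∈ M := by
    intro i
    by_cases hi : i ∈ T
    · exact hGM _ (Finset.mem_union_left _ (Finset.mem_image_of_mem x hi))
    · rcases hT i hi with h | h <;> rw [h]
      exacts [zero_mem M, one_mem M]
  have hwM : ∀ j b, w j b ∈ M := by
    intro j b
    have : adjoin ℚ (Set.range x) ≤ M.restrictScalars ℚ :=
      adjoin_le (by rintro _ ⟨i, rfl⟩; exact hxM i)
    exact this (hw j b)
  have huM' : ∀ i ∉ S', u i ∈ M := fun i hi => hGM _ <|
    Finset.mem_union_right _ (Finset.mem_image_of_mem u (Finset.mem_compl.2 hi))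
  have huM : ∀ i, u i ∈ M := by
    intro i
    by_cases hi : i ∈ S'
    · obtain ⟨j, hj, rfl⟩ := Finset.mem_image.1 hi
      have h0 := hg j hj
      have h1 := hsum j
      rw [← Finset.add_sum_erase _ _ (Finset.mem_univ (g j))] at h1
      have h2 : u (j, g j) =
          -(∑ b ∈ Finset.univ.erase (g j), u (j, b) * w j b) * (w j (g j))⁻¹ := by
        rw [← eq_neg_of_add_eq_zero_left h1, mul_inv_cancel_right₀ h0]
      rw [h2]
      refine mul_mem (neg_mem (sum_mem fun b hb => mul_mem (huM' _ fun hb' => ?_) (hwM j b)))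
        (IsAlgebraic.inv (hwM j (g j)))
      obtain ⟨j', -, hj'⟩ := Finset.mem_image.1 hb'
      obtain ⟨rfl, rfl⟩ := Prod.ext_iff.1 hj'
      exact Finset.ne_of_mem_erase hb rfl
    · exact huM' i hi
  have h1 := card_le_of_forall_isAlgebraic hu G huM
  have h2 : G.card ≤ T.card + S'ᶜ.card := (Finset.card_union_le _ _).trans
    (add_le_add Finset.card_image_le Finset.card_image_le)
  have h3 := S'.card_add_card_compl
  omega

/-- There are arbitrarily large finite families of algebraically independent complex numbers. -/
lemma exists_algebraicIndependent (ι : Type) [Finite ι] :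
    ∃ u : ι → ℂ, AlgebraicIndependent ℚ u := by
  obtain ⟨s, hs⟩ := exists_isTranscendenceBasis ℚ ℂ
  have hinf : Infinite s := by
    have h := IsAlgClosed.cardinal_eq_cardinal_transcendence_basis_of_aleph0_lt' _ hs
      (Cardinal.mk_le_aleph0 (α := ℚ)) (by simpa using Cardinal.aleph0_lt_continuum)
    rw [Cardinal.infinite_iff, ← h]
    simpa using Cardinal.aleph0_le_continuum
  obtain ⟨f⟩ := (Cardinal.le_def _ _).1 ((Cardinal.lt_aleph0_of_finite ι).le.trans
    (Cardinal.aleph0_le_mk s))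
  exact ⟨_, hs.1.comp f f.injective⟩

end Generic

end LinQuad

namespace LinQuad

open MvPolynomial

section GenericFamily

variable {m n N₂ N₃ N₆ : ℕ} {A : Type*} [CommRing A]

/-- The invariants of degree two, three and six entering the three kinds of generic
linear combinations. -/
def val (c : Ix m n → A) : Fin N₂ ⊕ Fin N₃ ⊕ Fin N₆ → Ix2 m n ⊕ Ix3 m n → A :=
  Sum.elim (fun _ => Sum.elim (deg2 c) 0)
    (Sum.elim (fun _ => Sum.elim 0 (deg3 c)) (fun _ => deg6 c))

/-- The degrees of the generic linear combinations. -/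
def degree : Fin N₂ ⊕ Fin N₃ ⊕ Fin N₆ → ℕ :=
  Sum.elim (fun _ => 2) (Sum.elim (fun _ => 3) (fun _ => 6))

lemma map_val {B F : Type*} [CommRing B] [FunLike F A B] [RingHomClass F A B] (φ : F)
    (c : Ix m n → A) (j : Fin N₂ ⊕ Fin N₃ ⊕ Fin N₆) (b : Ix2 m n ⊕ Ix3 m n) :
    φ (val c j b) = val (fun x => φ (c x)) j b := by
  rcases j with j | j | j <;> rcases b with b | b <;>
    simp [val, map_deg2, map_deg3, map_deg6]

lemma val_eq_pow_mul {c c' : Ix m n → A} {t : A} (h2 : ∀ b, deg2 c b = t ^ 2 * deg2 c' b)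
    (h3 : ∀ b, deg3 c b = t ^ 3 * deg3 c' b) (j : Fin N₂ ⊕ Fin N₃ ⊕ Fin N₆)
    (b : Ix2 m n ⊕ Ix3 m n) : val c j b = t ^ degree j * val c' j b := by
  rcases j with j | j | j <;> rcases b with b | b <;>
    simp [val, degree, deg6, h2, h3, mul_pow, ← pow_mul]

lemma val_act {p q r s : A} (h : p * s - q * r = 1) (c : Ix m n → A)
    (j : Fin N₂ ⊕ Fin N₃ ⊕ Fin N₆) : val (act p q r s c) j = val c j := by
  rcases j with j | j | j <;> simp [val, deg6, deg2_act h, deg3_act h]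

/-- Linear combinations of the basic invariants with coefficients `u`. -/
noncomputable def combination (u : (Fin N₂ ⊕ Fin N₃ ⊕ Fin N₆) × (Ix2 m n ⊕ Ix3 m n) → ℂ)
    (j : Fin N₂ ⊕ Fin N₃ ⊕ Fin N₆) : MvPolynomial (Ix m n) ℂ :=
  ∑ b, C (u (j, b)) * val X j b

variable {u : (Fin N₂ ⊕ Fin N₃ ⊕ Fin N₆) × (Ix2 m n ⊕ Ix3 m n) → ℂ}

lemma eval_combination (c : Ix m n → ℂ) (j : Fin N₂ ⊕ Fin N₃ ⊕ Fin N₆) :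
    eval c (combination u j) = ∑ b, u (j, b) * val c j b := by
  simp [combination, map_val]

lemma combination_substInvariant (j : Fin N₂ ⊕ Fin N₃ ⊕ Fin N₆) :
    SubstInvariant (combination u j) := by
  intro p q r s h c
  simp [eval_combination, val_act h]

lemma isHomogeneous_deg2 (b : Ix2 m n) :
    (deg2 X b : MvPolynomial (Ix m n) ℂ).IsHomogeneous 2 := by
  have hX : ∀ x y : Ix m n, (X x * X y : MvPolynomial (Ix m n) ℂ).IsHomogeneous 2 :=
    fun x y => (isHomogeneous_X ℂ x).mul (isHomogeneous_X ℂ y)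
  have h2 : ∀ x y : Ix m n, (2 * X x * X y : MvPolynomial (Ix m n) ℂ).IsHomogeneous 2 := by
    intro x y
    rw [mul_assoc]
    exact (hX x y).C_mul 2
  rcases b with ⟨i, j⟩ | ⟨k, l⟩
  · exact (hX _ _).sub (hX _ _)
  · exact ((h2 _ _).add (h2 _ _)).sub (hX _ _)

lemma isHomogeneous_deg3 (b : Ix3 m n) :
    (deg3 X b : MvPolynomial (Ix m n) ℂ).IsHomogeneous 3 := by
  have hX : ∀ x y : Ix m n, (X x * X y : MvPolynomial (Ix m n) ℂ).IsHomogeneous 2 :=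
    fun x y => (isHomogeneous_X ℂ x).mul (isHomogeneous_X ℂ y)
  have h2 : ∀ x y : Ix m n, (2 * X x * X y : MvPolynomial (Ix m n) ℂ).IsHomogeneous 2 := by
    intro x y
    rw [mul_assoc]
    exact (hX x y).C_mul 2
  exact ((isHomogeneous_X ℂ _).mul ((h2 _ _).sub (hX _ _))).sub
    ((isHomogeneous_X ℂ _).mul ((hX _ _).sub (h2 _ _)))

lemma combination_isHomogeneous (j : Fin N₂ ⊕ Fin N₃ ⊕ Fin N₆) :
    (combination u j).IsHomogeneous (degree j) := by
  refine IsHomogeneous.sum _ _ _ fun b _ => IsHomogeneous.C_mul ?_ _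
  rcases j with j | j | j <;> rcases b with b | b
  · exact isHomogeneous_deg2 b
  · exact isHomogeneous_zero _ _ _
  · exact isHomogeneous_zero _ _ _
  · exact isHomogeneous_deg3 b
  · exact (isHomogeneous_deg2 b).pow 3
  · exact (isHomogeneous_deg3 b).pow 2

end GenericFamily

section NullconeCount

variable {m n N₂ N₃ N₆ : ℕ} {u : (Fin N₂ ⊕ Fin N₃ ⊕ Fin N₆) × (Ix2 m n ⊕ Ix3 m n) → ℂ}

lemma card_le_of_similar [NeZero m] (hu : AlgebraicIndependent ℚ u) {c c' : Ix m n → ℂ}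
    {t : ℂ} (ht : t ≠ 0)
    (hc : ∀ j, eval c (combination u j) = 0) (h2 : ∀ b, deg2 c b = t ^ 2 * deg2 c' b)
    (h3 : ∀ b, deg3 c b = t ^ 3 * deg3 c' b) (T : Finset (Ix m n))
    (hT : ∀ x ∉ T, c' x = 0 ∨ c' x = 1) (S : Finset (Fin N₂ ⊕ Fin N₃ ⊕ Fin N₆))
    (hS : ∀ j ∈ S, ∃ b, val c j b ≠ 0) : S.card ≤ T.card := by
  have : Nonempty (Ix2 m n ⊕ Ix3 m n) := ⟨.inl (.inl (0, 0))⟩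
  refine card_le_of_generic hu c' (val c') (fun j b => ?_) (fun j => ?_) S (fun j hj => ?_) T hT
  · rw [Algebra.adjoin_range_eq_range_aeval]
    refine ⟨val X j b, ?_⟩
    have := map_val (aeval c' : MvPolynomial (Ix m n) ℚ →ₐ[ℚ] ℂ) X j b
    simpa using this
  · have := hc j
    rw [eval_combination] at this
    simp only [val_eq_pow_mul h2 h3 j, mul_left_comm _ (t ^ _), ← Finset.mul_sum] at this
    exact (mul_eq_zero.1 this).resolve_left (pow_ne_zero _ ht)
  · obtain ⟨b, hb⟩ := hS j hj
    rw [val_eq_pow_mul h2 h3] at hb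
    exact ⟨b, right_ne_zero_of_mul hb⟩

section

variable [NeZero m] (hu : AlgebraicIndependent ℚ u) {c c' : Ix m n → ℂ} {t : ℂ} (ht : t ≠ 0)
    (hc : ∀ j, eval c (combination u j) = 0) (h2 : ∀ b, deg2 c b = t ^ 2 * deg2 c' b)
    (h3 : ∀ b, deg3 c b = t ^ 3 * deg3 c' b) (T : Finset (Ix m n))
    (hT : ∀ x ∉ T, c' x = 0 ∨ c' x = 1)

include hu ht hc h2 h3 hT

lemma add_le_of_deg2_ne_zero (hne : ∃ b, deg2 c b ≠ 0) : N₂ + N₆ ≤ T.card := by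
  obtain ⟨b, hb⟩ := hne
  have := card_le_of_similar hu ht hc h2 h3 T hT
    (Finset.univ.disjSum (Finset.disjSum ∅ Finset.univ))
    (by
      rintro (j | j | j) hj
      · exact ⟨.inl b, hb⟩
      · simp at hj
      · exact ⟨.inl b, pow_ne_zero 3 hb⟩)
  simpa [Finset.card_disjSum] using this

lemma add_le_of_deg3_ne_zero (hne : ∃ b, deg3 c b ≠ 0) : N₃ + N₆ ≤ T.card := by
  obtain ⟨b, hb⟩ := hne
  have := card_le_of_similar hu ht hc h2 h3 T hT (Finset.disjSum ∅ Finset.univ)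
    (by
      rintro (j | j | j) hj
      · simp at hj
      · exact ⟨.inr b, hb⟩
      · exact ⟨.inr b, pow_ne_zero 2 hb⟩)
  simpa [Finset.card_disjSum] using this

lemma add_add_le_of_ne_zero (hne : ∃ b, deg2 c b ≠ 0) (hne' : ∃ b, deg3 c b ≠ 0) :
    N₂ + (N₃ + N₆) ≤ T.card := by
  obtain ⟨b, hb⟩ := hne
  obtain ⟨b', hb'⟩ := hne'
  have := card_le_of_similar hu ht hc h2 h3 T hT Finset.univ
    (by
      rintro (j | j | j) -
      · exact ⟨.inl b, hb⟩
      · exact ⟨.inr b', hb'⟩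
      · exact ⟨.inl b, pow_ne_zero 3 hb⟩)
  simpa using this

end

end NullconeCount

end LinQuad

namespace LinQuad

open MvPolynomial

section NormalForms

variable {m n : ℕ} {K : Type*} [Field K]

lemma deg2_twist {p q r s t : K} (h : (p * s - q * r) * t ^ 2 = 1) (c : Ix m n → K)
    (b : Ix2 m n) : deg2 c b =
      t ^ 2 * deg2 (point (lin (act p q r s c)) fun k => t • quad (act p q r s c) k) b := by
  have hd : p * s - q * r ≠ 0 := fun h0 => by simp [h0] at h
  rcases b with ⟨i, j⟩ | ⟨k, l⟩
  · simp only [deg2, Sum.elim_inl, lin_point, lin_act, bk_subst]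
    linear_combination -bk (lin c i) (lin c j) * h
  · have := disc_subst p q r s (quad c k) (quad c l)
    simp only [deg2, Sum.elim_inr, quad_point, quad_act]
    have h1 : ∀ f g : K × K × K, disc (t • f) (t • g) = t ^ 2 * disc f g := by
      intro f g; simp only [disc, Prod.smul_fst, Prod.smul_snd, smul_eq_mul]; ring
    rw [h1, this]
    linear_combination -disc (quad c k) (quad c l) * ((p * s - q * r) * t ^ 2 + 1) * h

lemma deg3_twist {p q r s t : K} (h : (p * s - q * r) * t ^ 2 = 1) (c : Ix m n → K)
    (b : Ix3 m n) : deg3 c b =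
      t ^ 3 * deg3 (point (lin (act p q r s c)) fun k => t • quad (act p q r s c) k) b := by
  have := bk_endo_subst p q r s (quad c b.1) (lin c b.2.1) (lin c b.2.2)
  simp only [deg3, lin_point, quad_point, lin_act, quad_act]
  have h1 : ∀ (f : K × K × K) (v w : K × K), bk v (endo (t • f) w) = t * bk v (endo f w) := by
    intro f v w; simp only [bk, endo, Prod.smul_fst, Prod.smul_snd, smul_eq_mul]; ring
  rw [h1, this]
  linear_combination
    -bk (lin c b.2.1) (endo (quad c b.1) (lin c b.2.2)) * ((p * s - q * r) * t ^ 2 + 1) * h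

/-- A point with two independent linear forms can be normalised so that these become the
coordinate forms. -/
lemma exists_normalised_pair [IsAlgClosed K] (c : Ix m n → K) {i j : Fin m}
    (h : bk (lin c i) (lin c j) ≠ 0) : ∃ (c' : Ix m n → K) (t : K), t ≠ 0 ∧
      lin c' i = (1, 0) ∧ lin c' j = (0, 1) ∧ (∀ b, deg2 c b = t ^ 2 * deg2 c' b) ∧
      ∀ b, deg3 c b = t ^ 3 * deg3 c' b := by
  obtain ⟨t, ht⟩ := IsAlgClosed.exists_pow_nat_eq (bk (lin c i) (lin c j)) two_pos
  have ht0 : t ≠ 0 := by rintro rfl; simp at ht; exact h ht.symm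
  have hdet : (lin c j).2 / t ^ 2 * ((lin c i).1 / t ^ 2)
      - -(lin c i).2 / t ^ 2 * (-(lin c j).1 / t ^ 2) = 1 / t ^ 2 := by
    have : t ^ 2 = (lin c i).1 * (lin c j).2 - (lin c i).2 * (lin c j).1 := ht
    field_simp
    linear_combination -this
  have ht' := ht
  simp only [bk] at ht'
  refine ⟨_, t, ht0, ?_, ?_, deg2_twist (p := (lin c j).2 / t ^ 2) (q := -(lin c i).2 / t ^ 2)
    (r := -(lin c j).1 / t ^ 2) (s := (lin c i).1 / t ^ 2) ?_ c, deg3_twist ?_ c⟩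
  · rw [lin_point, lin_act]
    ext <;> simp only [substLin] <;> field_simp
    · linear_combination -ht'
    · ring
  · rw [lin_point, lin_act]
    ext <;> simp only [substLin] <;> field_simp
    · ring
    · linear_combination -ht'
  all_goals rw [hdet]; field_simp

/-- A nonzero linear form can be normalised to the first coordinate form. -/
lemma exists_normalised_lin (c : Ix m n → K) {i : Fin m} (h : lin c i ≠ 0) :
    ∃ c' : Ix m n → K, lin c' i = (1, 0) ∧ (∀ b, deg2 c b = deg2 c' b) ∧
      ∀ b, deg3 c b = deg3 c' b := by
  obtain ⟨p, r, hpr⟩ : ∃ p r, p * (lin c i).1 + r * (lin c i).2 = 1 := by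
    by_cases h1 : (lin c i).1 = 0
    · have h2 : (lin c i).2 ≠ 0 := fun h2 => h (Prod.ext h1 h2)
      exact ⟨0, (lin c i).2⁻¹, by simp [h2]⟩
    · exact ⟨(lin c i).1⁻¹, 0, by simp [h1]⟩
  have hdet : p * (lin c i).1 - -(lin c i).2 * r = 1 := by linear_combination hpr
  refine ⟨act p (-(lin c i).2) r (lin c i).1 c, ?_, fun b => by rw [deg2_act hdet],
    fun b => by rw [deg3_act hdet]⟩
  rw [lin_act]
  ext <;> simp only [substLin]
  · linear_combination hpr
  · ring

end NormalForms

section Nullcone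

variable {m n N₂ N₃ N₆ : ℕ} {u : (Fin N₂ ⊕ Fin N₃ ⊕ Fin N₆) × (Ix2 m n ⊕ Ix3 m n) → ℂ}

/-- The coordinates of linear forms. -/
def linCoords (m n : ℕ) : Finset (Ix m n) := Finset.univ.map .inl

lemma card_linCoords : (linCoords m n).card = m * 2 := by simp [linCoords]

/-- The coordinates of two linear forms. -/
def pairCoords (i j : Fin m) : Finset (Ix m n) :=
  {.inl (i, 0), .inl (i, 1), .inl (j, 0), .inl (j, 1)}

lemma card_sdiff_pairCoords {T : Finset (Ix m n)} (hT : linCoords m n ⊆ T) {i j : Fin m}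
    (hij : i ≠ j) : (T \ pairCoords i j).card + 4 = T.card := by
  have h4 : (pairCoords i j : Finset (Ix m n)).card = 4 := by
    rw [pairCoords, Finset.card_insert_of_notMem, Finset.card_insert_of_notMem,
      Finset.card_insert_of_notMem, Finset.card_singleton] <;> simp [hij]
  have hsub : (pairCoords i j : Finset (Ix m n)) ⊆ T := by
    intro x hx
    apply hT
    simp only [pairCoords, Finset.mem_insert, Finset.mem_singleton] at hx
    rcases hx with rfl | rfl | rfl | rfl <;> simp [linCoords]
  rw [← h4]
  exact Finset.card_sdiff_add_card_eq_card hsub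

lemma bk_eq_zero_of_combination [NeZero m] (hu : AlgebraicIndependent ℚ u)
    (hN₂ : N₂ + 2 = m + 2 * n) (hN₃ : N₃ = 3 * n) (hN₆ : N₆ + 2 * n + 1 = m)
    {c : Ix m n → ℂ} (hc : ∀ j, eval c (combination u j) = 0) (i j : Fin m) :
    bk (lin c i) (lin c j) = 0 := by
  by_contra h
  obtain ⟨c', t, ht, hi, hj, h2, h3⟩ := exists_normalised_pair c h
  have hij : i ≠ j := by rintro rfl; simp [bk, mul_comm] at h
  have hne : ∃ b, deg2 c b ≠ 0 := ⟨.inl (i, j), h⟩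
  have hi0 : c' (.inl (i, 0)) = 1 := congrArg Prod.fst hi
  have hi1 : c' (.inl (i, 1)) = 0 := congrArg Prod.snd hi
  have hj0 : c' (.inl (j, 0)) = 0 := congrArg Prod.fst hj
  have hj1 : c' (.inl (j, 1)) = 1 := congrArg Prod.snd hj
  by_cases hne' : ∃ b, deg3 c b ≠ 0
  · have hcard := card_sdiff_pairCoords (Finset.subset_univ (linCoords m n)) hij
    have := add_add_le_of_ne_zero hu ht hc h2 h3 (Finset.univ \ pairCoords i j) (fun x hx => by
      simp only [Finset.mem_sdiff, Finset.mem_univ, true_and, not_not, pairCoords,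
        Finset.mem_insert, Finset.mem_singleton] at hx
      rcases hx with rfl | rfl | rfl | rfl <;> simp [*]) hne hne'
    simp at hcard
    omega
  · have hcard := card_sdiff_pairCoords (subset_refl (linCoords m n)) hij
    have hq : ∀ b, deg3 c' b = 0 := fun b => by
      have := h3 b
      rw [not_exists_not.1 hne' b] at this
      exact (mul_eq_zero.1 this.symm).resolve_left (pow_ne_zero _ ht)
    have := add_le_of_deg2_ne_zero hu ht hc h2 h3 (linCoords m n \ pairCoords i j) (fun x hx => by
      rcases x with x | ⟨k, l⟩
      · simp only [Finset.mem_sdiff, linCoords, Finset.mem_map, Finset.mem_univ, true_and, not_and,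
          not_not, pairCoords, Finset.mem_insert, Finset.mem_singleton] at hx
        rcases hx ⟨x, rfl⟩ with h | h | h | h <;> simp [*]
      · left
        have e1 := hq (k, i, i)
        have e2 := hq (k, i, j)
        have e3 := hq (k, j, j)
        simp only [deg3, hi, hj] at e1 e2 e3
        simp [bk, endo, quad] at e1 e2 e3
        fin_cases l <;> assumption) hne
    rw [card_linCoords] at hcard
    omega

lemma definesNullcone_combination [NeZero m] (hu : AlgebraicIndependent ℚ u) (hn : 1 ≤ n)
    (hN₂ : N₂ + 2 = m + 2 * n) (hN₃ : N₃ = 3 * n) (hN₆ : N₆ + 2 * n + 1 = m) (h0 : 0 < N₆) :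
    DefinesNullcone (combination u) := by
  intro c hc
  have hbk := bk_eq_zero_of_combination hu hN₂ hN₃ hN₆ hc
  have h3 : ∀ b, deg3 c b = 0 := by
    by_contra! hne'
    obtain ⟨⟨k₀, i₀, j₀⟩, hb⟩ := hne'
    have hi₀ : lin c i₀ ≠ 0 := by
      intro h0
      apply hb
      simp [deg3, h0, bk]
    obtain ⟨c', hi, h2', h3'⟩ := exists_normalised_lin c hi₀
    have hi0 : c' (.inl (i₀, 0)) = 1 := congrArg Prod.fst hi
    have hi1 : c' (.inl (i₀, 1)) = 0 := congrArg Prod.snd hi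
    have hv : ∀ i, c' (.inl (i, 1)) = 0 := by
      intro i
      have := (h2' (.inl (i₀, i))).symm.trans (hbk i₀ i)
      simpa [deg2, bk, lin, hi0, hi1] using this
    by_cases hne : ∃ b, deg2 c b ≠ 0
    · set S : Finset (Ix m n) := insert (.inl (i₀, 0)) (Finset.univ.image fun i => .inl (i, 1))
      have hS : S.card = m + 1 := by
        rw [Finset.card_insert_of_notMem (by simp),
          Finset.card_image_of_injective _ (by intro a b h; simpa using h)]
        simp
      have := add_add_le_of_ne_zero hu one_ne_zero hc (by simpa using h2') (by simpa using h3')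
        Sᶜ (fun x hx => by
          rw [Finset.mem_compl, not_not] at hx
          simp only [S, Finset.mem_insert, Finset.mem_image, Finset.mem_univ, true_and] at hx
          rcases hx with rfl | ⟨i, rfl⟩
          · exact .inr hi0
          · exact .inl (hv i)) hne ⟨_, hb⟩
      have hcard := S.card_add_card_compl
      simp only [Fintype.card_sum, Fintype.card_prod, Fintype.card_fin] at hcard
      omega
    · have hd3 : ∀ b, deg3 c' b =
          c' (.inl (b.2.1, 0)) * c' (.inl (b.2.2, 0)) * (2 * c' (.inr (b.1, 2))) := by
        intro b
        simp only [deg3, bk, endo, lin, quad, hv]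
        ring
      have hγ : c' (.inr (k₀, 2)) ≠ 0 := by
        intro h
        apply hb
        rw [h3', hd3]
        simp [h]
      obtain ⟨t, ht⟩ := IsAlgClosed.exists_pow_nat_eq (c' (.inr (k₀, 2))) three_pos
      have ht0 : t ≠ 0 := by rintro rfl; simp at ht; exact hγ ht.symm
      set T : Finset (Ix m n) := ((Finset.univ.erase i₀).image fun i => .inl (i, 0)) ∪
        (Finset.univ.erase k₀).image fun k => .inr (k, 2)
      have hcard : T.card ≤ (m - 1) + (n - 1) := by
        refine (Finset.card_union_le _ _).trans (add_le_add ?_ ?_)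
        all_goals exact Finset.card_image_le.trans_eq (by simp)
      have := add_le_of_deg3_ne_zero (c' := point (fun i => (c' (.inl (i, 0)), 0))
          (fun k => (0, 0, c' (.inr (k, 2)) / c' (.inr (k₀, 2))))) hu ht0 hc
        (fun b => by
          rw [not_exists_not.1 hne b]
          rcases b with b | b <;> simp [deg2, bk, disc])
        (fun b => by
          rw [h3', hd3, ht]
          simp only [deg3, bk, endo, lin_point, quad_point]
          field_simp
          ring) T
        (forall_ix (fun i => ⟨fun hx => .inr ?_, fun _ => .inl (by simp [point])⟩)
          (fun k => ⟨fun _ => .inl (by simp [point]), fun _ => .inl (by simp [point]),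
            fun hx => .inr ?_⟩)) ⟨_, hb⟩
      · omega
      · have : i = i₀ := by simpa [T] using hx
        simp [point, this, hi0]
      · have : k = k₀ := by simpa [T] using hx
        simp [point, this, hγ]
  refine ⟨?_, h3⟩
  by_contra! hne
  have := add_le_of_deg2_ne_zero (c' := point 0 (quad c)) hu one_ne_zero hc
    (by
      rintro (⟨i, j⟩ | ⟨k, l⟩)
      · simpa [deg2, bk] using hbk i j
      · simp [deg2])
    (fun b => by rw [h3]; simp [deg3, bk]) (linCoords m n)ᶜ (fun x hx => by
      rw [Finset.mem_compl, not_not, linCoords, Finset.mem_map] at hx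
      obtain ⟨⟨i, l⟩, -, rfl⟩ := hx
      left
      fin_cases l <;> simp [point]) hne
  have hcard := (linCoords m n).card_add_card_compl
  rw [card_linCoords] at hcard
  simp only [Fintype.card_sum, Fintype.card_prod, Fintype.card_fin] at hcard
  omega

end Nullcone

end LinQuad

namespace LinQuad

open MvPolynomial

section Independence

variable {m n : ℕ}

/-- The coordinates of a point can be recovered from its invariants and three coordinates. -/
lemma mem_of_invariants_mem {A : Type*} [CommRing A] (M : Subring A)
    (hdiv : ∀ a x, a ∈ M → a ≠ 0 → a * x ∈ M → x ∈ M) (h2 : (2 : A) ≠ 0) (c : Ix m n → A)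
    (hc2 : ∀ b, deg2 c b ∈ M) (hc3 : ∀ b, deg3 c b ∈ M) {i j : Fin m}
    (hij : bk (lin c i) (lin c j) ≠ 0) (hi0 : c (.inl (i, 0)) ≠ 0)
    (hM : c (.inl (i, 0)) ∈ M ∧ c (.inl (i, 1)) ∈ M ∧ c (.inl (j, 0)) ∈ M) (x : Ix m n) :
    c x ∈ M := by
  obtain ⟨ha, hb, hc⟩ := hM
  have hδ : bk (lin c i) (lin c j) ∈ M := hc2 (.inl (i, j))
  have hd : c (.inl (j, 1)) ∈ M := by
    refine hdiv _ _ ha hi0 ?_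
    convert add_mem hδ (mul_mem hb hc) using 1
    simp only [bk, lin]; ring
  have h2M : (2 : A) ∈ M := by
    rw [← one_add_one_eq_two]
    exact add_mem (one_mem M) (one_mem M)
  induction x using forall_ix with
  | h l =>
    have e1 : bk (lin c i) (lin c l) ∈ M := hc2 (.inl (i, l))
    have e2 : bk (lin c l) (lin c j) ∈ M := hc2 (.inl (l, j))
    constructor <;> refine hdiv _ _ hδ hij ?_
    · convert add_mem (mul_mem e1 hc) (mul_mem e2 ha) using 1
      simp only [bk, lin]; ring
    · convert add_mem (mul_mem e1 hd) (mul_mem e2 hb) using 1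
      simp only [bk, lin]; ring
  | h' k =>
    have e1 : bk (lin c i) (endo (quad c k) (lin c i)) ∈ M := hc3 (k, i, i)
    have e2 : bk (lin c i) (endo (quad c k) (lin c j)) ∈ M := hc3 (k, i, j)
    have e3 : bk (lin c j) (endo (quad c k) (lin c j)) ∈ M := hc3 (k, j, j)
    refine ⟨?_, ?_, ?_⟩ <;> refine hdiv _ _ hδ hij (hdiv _ _ hδ hij (hdiv _ _ h2M h2 ?_))
    · convert add_mem (sub_mem (mul_mem (mul_mem hc hc) e1)
        (mul_mem (mul_mem h2M (mul_mem ha hc)) e2)) (mul_mem (mul_mem ha ha) e3) using 1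
      simp only [bk, lin, quad, endo]; ring
    · convert mul_mem h2M (add_mem (sub_mem (mul_mem (mul_mem hc hd) e1)
        (mul_mem (add_mem (mul_mem ha hd) (mul_mem hb hc)) e2)) (mul_mem (mul_mem ha hb) e3))
        using 1
      simp only [bk, lin, quad, endo]; ring
    · convert add_mem (sub_mem (mul_mem (mul_mem hd hd) e1)
        (mul_mem (mul_mem h2M (mul_mem hb hd)) e2)) (mul_mem (mul_mem hb hb) e3) using 1
      simp only [bk, lin, quad, endo]; ring

lemma substInvariant_deg2 (b : Ix2 m n) : SubstInvariant (deg2 X b) := by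
  intro p q r s h c
  simp [map_deg2, deg2_act h]

lemma substInvariant_deg3 (b : Ix3 m n) : SubstInvariant (deg3 X b) := by
  intro p q r s h c
  simp [map_deg3, deg3_act h]

/-- A family of `dim V - 3` invariants over which all invariants are integral is algebraically
independent. -/
lemma algebraicIndependent_of_isIntegral {ι : Type} [Fintype ι] (hm : 2 ≤ m)
    (hι : Fintype.card ι + 3 = 2 * m + 3 * n) (P : ι → MvPolynomial (Ix m n) ℂ)
    (hP : ∀ f : MvPolynomial (Ix m n) ℂ, SubstInvariant f →
      IsIntegral (Algebra.adjoin ℂ (Set.range P)) f) :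
    AlgebraicIndependent ℂ P := by
  let i : Fin m := ⟨0, by omega⟩
  let j : Fin m := ⟨1, by omega⟩
  let Q : ι ⊕ Fin 3 → MvPolynomial (Ix m n) ℂ :=
    Sum.elim P ![X (.inl (i, 0)), X (.inl (i, 1)), X (.inl (j, 0))]
  let M := Subalgebra.algebraicClosure (Algebra.adjoin ℂ (Set.range Q)) (MvPolynomial (Ix m n) ℂ)
  have hQ : ∀ k, Q k ∈ M := fun k => isAlgebraic_algebraMap
    (⟨Q k, Algebra.subset_adjoin ⟨k, rfl⟩⟩ : Algebra.adjoin ℂ (Set.range Q))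
  have hinv : ∀ f, SubstInvariant f → f ∈ M := fun f hf =>
    (hP f hf).isAlgebraic.adjoin_of_forall_isAlgebraic <| by
      rintro _ ⟨⟨k, rfl⟩, hk⟩
      exact absurd ⟨.inl k, rfl⟩ hk
  have hX : ∀ x, X x ∈ M := mem_of_invariants_mem M.toSubring
    (fun a x ha ha0 hax => IsAlgebraic.of_mul (mem_nonZeroDivisors_of_ne_zero ha0) ha hax)
    two_ne_zero X (fun b => hinv _ (substInvariant_deg2 b)) (fun b => hinv _ (substInvariant_deg3 b))
    (bk_lin_X_ne_zero (i := i) (j := j) (by simp [i, j])) (X_ne_zero _)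
    ⟨hQ (.inr 0), hQ (.inr 1), hQ (.inr 2)⟩
  have halg : Algebra.IsAlgebraic (Algebra.adjoin ℂ (Set.range Q)) (MvPolynomial (Ix m n) ℂ) := by
    refine ⟨fun f => ?_⟩
    have hle : Algebra.adjoin ℂ (Set.range (X : Ix m n → MvPolynomial (Ix m n) ℂ)) ≤
        M.restrictScalars ℂ := Algebra.adjoin_le (by rintro _ ⟨x, rfl⟩; exact hX x)
    rw [adjoin_range_X] at hle
    exact hle (Algebra.mem_top (x := f))
  have := Algebra.IsAlgebraic.isTranscendenceBasis_of_le_trdeg_of_finite ℂ Q (by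
    rw [MvPolynomial.trdeg_of_isDomain, Cardinal.lift_id, Cardinal.mk_fintype, Cardinal.mk_fintype,
      Nat.cast_le]
    simp only [Fintype.card_sum, Fintype.card_prod, Fintype.card_fin]
    omega)
  exact this.1.comp Sum.inl Sum.inl_injective

/-- Existence of a homogeneous system of parameters in coordinates. -/
theorem exists_hsop {N₂ N₃ N₆ : ℕ} (hn : 1 ≤ n) (hN₂ : N₂ + 2 = m + 2 * n) (hN₃ : N₃ = 3 * n)
    (hN₆ : N₆ + 2 * n + 1 = m) (h0 : 0 < N₆) :
    ∃ P : Fin N₂ ⊕ Fin N₃ ⊕ Fin N₆ → MvPolynomial (Ix m n) ℂ, (∀ j, SubstInvariant (P j)) ∧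
      (∀ j, (P j).IsHomogeneous (degree j)) ∧ AlgebraicIndependent ℂ P ∧
      ∀ f : MvPolynomial (Ix m n) ℂ, SubstInvariant f →
        IsIntegral (Algebra.adjoin ℂ (Set.range P)) f := by
  have : NeZero m := ⟨by omega⟩
  obtain ⟨u, hu⟩ := exists_algebraicIndependent
    ((Fin N₂ ⊕ Fin N₃ ⊕ Fin N₆) × (Ix2 m n ⊕ Ix3 m n))
  have hintegral : ∀ f, SubstInvariant f →
      IsIntegral (Algebra.adjoin ℂ (Set.range (combination u))) f := fun f hf =>
    hf.isIntegral_adjoin (by omega) combination_substInvariant combination_isHomogeneous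
      (by rintro (j | j | j) <;> simp [degree])
      (definesNullcone_combination hu hn hN₂ hN₃ hN₆ h0)
  refine ⟨combination u, combination_substInvariant, combination_isHomogeneous,
    algebraicIndependent_of_isIntegral (by omega) ?_ _ hintegral, hintegral⟩
  simp only [Fintype.card_sum, Fintype.card_fin]
  omega

end Independence

end LinQuad

namespace LinQuad

open MvPolynomial BinInv

section Transfer

lemma coeff_C_mul_X_pow_mul_X_pow (b : ℂ) (i j i' j' : ℕ) :
    coeff (Finsupp.single 0 i + Finsupp.single 1 j)
      (C b * X 0 ^ i' * X 1 ^ j' : MvPolynomial (Fin 2) ℂ) =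
      if i' = i ∧ j' = j then b else 0 := by
  rw [mul_assoc, coeff_C_mul, X_pow_eq_monomial, X_pow_eq_monomial, monomial_mul, coeff_monomial]
  simp [Finsupp.ext_iff, Fin.forall_fin_two]

variable (g : Matrix.SpecialLinearGroup (Fin 2) ℂ)

lemma coeff_sl2Act_linear {d : ℕ} (hd : d = 1) (a : Fin (d + 1) → ℂ) {v : ℂ × ℂ}
    (hv : ∀ k : Fin (d + 1), a k = ![v.1, v.2] (k.cast (by rw [hd]))) (k : Fin (d + 1)) :
    coeff (Finsupp.single 0 (d - (k : ℕ)) + Finsupp.single 1 (k : ℕ))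
      (sl2Act g (∑ k : Fin (d + 1), C (a k) * X 0 ^ (d - (k : ℕ)) * X 1 ^ (k : ℕ))) =
      ![(substLin (g⁻¹ 0 0) (g⁻¹ 0 1) (g⁻¹ 1 0) (g⁻¹ 1 1) v).1,
        (substLin (g⁻¹ 0 0) (g⁻¹ 0 1) (g⁻¹ 1 0) (g⁻¹ 1 1) v).2] (k.cast (by rw [hd])) := by
  subst hd
  have h : sl2Act g (∑ k : Fin (1 + 1), C (a k) * X 0 ^ (1 - (k : ℕ)) * X 1 ^ (k : ℕ)) =
      C (substLin (g⁻¹ 0 0) (g⁻¹ 0 1) (g⁻¹ 1 0) (g⁻¹ 1 1) v).1 * X 0 ^ 1 * X 1 ^ 0 +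
      C (substLin (g⁻¹ 0 0) (g⁻¹ 0 1) (g⁻¹ 1 0) (g⁻¹ 1 1) v).2 * X 0 ^ 0 * X 1 ^ 1 := by
    simp [sl2Act, Fin.sum_univ_succ, hv, substLin, algebraMap_eq]
    ring
  rw [h, coeff_add, coeff_C_mul_X_pow_mul_X_pow, coeff_C_mul_X_pow_mul_X_pow]
  fin_cases k <;> simp

lemma coeff_sl2Act_quadratic {d : ℕ} (hd : d = 2) (a : Fin (d + 1) → ℂ) {f : ℂ × ℂ × ℂ}
    (hf : ∀ k : Fin (d + 1), a k = ![f.1, f.2.1, f.2.2] (k.cast (by rw [hd])))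
    (k : Fin (d + 1)) :
    coeff (Finsupp.single 0 (d - (k : ℕ)) + Finsupp.single 1 (k : ℕ))
      (sl2Act g (∑ k : Fin (d + 1), C (a k) * X 0 ^ (d - (k : ℕ)) * X 1 ^ (k : ℕ))) =
      ![(substQuad (g⁻¹ 0 0) (g⁻¹ 0 1) (g⁻¹ 1 0) (g⁻¹ 1 1) f).1,
        (substQuad (g⁻¹ 0 0) (g⁻¹ 0 1) (g⁻¹ 1 0) (g⁻¹ 1 1) f).2.1,
        (substQuad (g⁻¹ 0 0) (g⁻¹ 0 1) (g⁻¹ 1 0) (g⁻¹ 1 1) f).2.2] (k.cast (by rw [hd])) := by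
  subst hd
  have h : sl2Act g (∑ k : Fin (2 + 1), C (a k) * X 0 ^ (2 - (k : ℕ)) * X 1 ^ (k : ℕ)) =
      C (substQuad (g⁻¹ 0 0) (g⁻¹ 0 1) (g⁻¹ 1 0) (g⁻¹ 1 1) f).1 * X 0 ^ 2 * X 1 ^ 0 +
      C (substQuad (g⁻¹ 0 0) (g⁻¹ 0 1) (g⁻¹ 1 0) (g⁻¹ 1 1) f).2.1 * X 0 ^ 1 * X 1 ^ 1 +
      C (substQuad (g⁻¹ 0 0) (g⁻¹ 0 1) (g⁻¹ 1 0) (g⁻¹ 1 1) f).2.2 * X 0 ^ 0 * X 1 ^ 2 := by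
    have h2 : (C 2 : MvPolynomial (Fin 2) ℂ) = 2 := map_ofNat C 2
    simp [sl2Act, Fin.sum_univ_succ, hf, substQuad, algebraMap_eq, h2]
    ring
  rw [h, coeff_add, coeff_add, coeff_C_mul_X_pow_mul_X_pow, coeff_C_mul_X_pow_mul_X_pow,
    coeff_C_mul_X_pow_mul_X_pow]
  fin_cases k <;> simp

variable (m n : ℕ)

/-- The degrees of `m` linear and `n` quadratic forms. -/
abbrev formDegree (i : Fin (m + n)) : ℕ := if (i : ℕ) < m then 1 else 2

variable {m n}

lemma formDegree_castAdd (i : Fin m) : formDegree m n (Fin.castAdd n i) = 1 := by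
  simp [formDegree]

lemma formDegree_natAdd (k : Fin n) : formDegree m n (Fin.natAdd m k) = 2 := by
  simp [formDegree]

/-- The coordinate of `V` corresponding to an element of `Ix m n`. -/
def toIdx : Ix m n → Idx (formDegree m n) :=
  Sum.elim (fun x => ⟨Fin.castAdd n x.1, x.2.cast (by rw [formDegree_castAdd])⟩)
    (fun x => ⟨Fin.natAdd m x.1, x.2.cast (by rw [formDegree_natAdd])⟩)

lemma toIdx_bijective : Function.Bijective (toIdx : Ix m n → Idx (formDegree m n)) := by
  constructor
  · have h : ∀ x y : Ix m n, toIdx x = toIdx y →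
        ((toIdx x).1 : ℕ) = (toIdx y).1 ∧ ((toIdx x).2 : ℕ) = (toIdx y).2 := by
      intro x y hxy
      rw [hxy]
      exact ⟨rfl, rfl⟩
    rintro (⟨i, k⟩ | ⟨i, k⟩) (⟨i', k'⟩ | ⟨i', k'⟩) hxy <;> obtain ⟨h1, h2⟩ := h _ _ hxy <;>
      simp [toIdx] at h1 h2 <;> first | omega | skip
    · rw [Fin.ext h1, Fin.ext h2]
    · rw [Fin.ext h1, Fin.ext h2]
  · rintro ⟨i, k⟩
    induction i using Fin.addCases with
    | left i => exact ⟨.inl (i, k.cast (by rw [formDegree_castAdd])), rfl⟩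
    | right i => exact ⟨.inr (i, k.cast (by rw [formDegree_natAdd])), rfl⟩

lemma actPt_toIdx (c : Idx (formDegree m n) → ℂ) (x : Ix m n) :
    actPt (formDegree m n) g c (toIdx x) =
      act (g⁻¹ 0 0) (g⁻¹ 0 1) (g⁻¹ 1 0) (g⁻¹ 1 1) (c ∘ toIdx) x := by
  rcases x with ⟨i, k⟩ | ⟨i, k⟩
  · have := coeff_sl2Act_linear g (formDegree_castAdd (n := n) i)
      (fun k => c ⟨Fin.castAdd n i, k⟩) (v := lin (c ∘ toIdx) i) (fun k => ?_)
      (k.cast (by rw [formDegree_castAdd]))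
    · exact this
    · obtain ⟨k, rfl⟩ : ∃ k' : Fin 2, k = k'.cast (by rw [formDegree_castAdd]) :=
        ⟨k.cast (by rw [formDegree_castAdd]), rfl⟩
      fin_cases k <;> rfl
  · have := coeff_sl2Act_quadratic g (formDegree_natAdd (m := m) i)
      (fun k => c ⟨Fin.natAdd m i, k⟩) (f := quad (c ∘ toIdx) i) (fun k => ?_)
      (k.cast (by rw [formDegree_natAdd]))
    · exact this
    · obtain ⟨k, rfl⟩ : ∃ k' : Fin 3, k = k'.cast (by rw [formDegree_natAdd]) :=
        ⟨k.cast (by rw [formDegree_natAdd]), rfl⟩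
      fin_cases k <;> rfl

lemma rename_toIdx_mem_invariantRing (f : MvPolynomial (Ix m n) ℂ) :
    rename toIdx f ∈ invariantRing (formDegree m n) ↔ SubstInvariant f := by
  have key : ∀ (g : Matrix.SpecialLinearGroup (Fin 2) ℂ) (c : Idx (formDegree m n) → ℂ),
      eval (actPt (formDegree m n) g c) (rename toIdx f) =
        eval (act (g⁻¹ 0 0) (g⁻¹ 0 1) (g⁻¹ 1 0) (g⁻¹ 1 1) (c ∘ toIdx)) f := fun g c => by
    rw [eval_rename]
    congr 2
    exact funext fun x => actPt_toIdx g c x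
  constructor
  · intro h p q r s hdet c
    let g : Matrix.SpecialLinearGroup (Fin 2) ℂ := ⟨!![p, q; r, s], by
      rw [Matrix.det_fin_two_of, hdet]⟩
    have hc : (c ∘ (Equiv.ofBijective _ toIdx_bijective).symm) ∘ toIdx = c :=
      funext fun x => congrArg c ((Equiv.ofBijective _ toIdx_bijective).symm_apply_apply x)
    have h1 := h g⁻¹ (c ∘ (Equiv.ofBijective _ toIdx_bijective).symm)
    rw [key, inv_inv, hc, eval_rename, hc] at h1
    simpa [g] using h1
  · intro h g c
    rw [key, eval_rename]
    refine h _ _ _ _ ?_ _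
    have := g⁻¹.det_coe
    rwa [Matrix.det_fin_two] at this

end Transfer

end LinQuad

namespace LinQuad

lemma isIntegral_adjoin_map {K A B : Type*} [Field K] [CommRing A] [CommRing B] [Algebra K A]
    [Algebra K B] (φ : A →ₐ[K] B) {S : Set A} {a : A} (ha : IsIntegral (Algebra.adjoin K S) a) :
    IsIntegral (Algebra.adjoin K (φ '' S)) (φ a) := by
  let ψ : Algebra.adjoin K S →ₐ[K] Algebra.adjoin K (φ '' S) :=
    (φ.comp (Algebra.adjoin K S).val).codRestrict _ fun x => by
      rw [← AlgHom.map_adjoin]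
      exact ⟨x, x.2, rfl⟩
  exact ha.map_of_comp_eq ψ.toRingHom φ.toRingHom (RingHom.ext fun x => rfl)

lemma exists_equiv_degree (N₂ N₃ N₆ : ℕ) :
    ∃ ε : Fin (N₂ + N₃ + N₆) ≃ Fin N₂ ⊕ Fin N₃ ⊕ Fin N₆, ∀ j,
      degree (ε j) = if (j : ℕ) < N₂ then 2 else if (j : ℕ) < N₂ + N₃ then 3 else 6 := by
  refine ⟨(finSumFinEquiv.symm.trans (Equiv.sumCongr finSumFinEquiv.symm (Equiv.refl _))).trans
    (Equiv.sumAssoc _ _ _), fun j => ?_⟩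
  induction j using Fin.addCases with
  | right j =>
    have h : ¬ N₂ + N₃ + (j : ℕ) < N₂ := by omega
    simp [degree, h]
  | left j =>
    induction j using Fin.addCases with
    | left j => simp [degree]
    | right j => simp [degree]

end LinQuad

open BinInv in
/-- For `V = m·V₁ ⊕ n·V₂` with `m, n ≥ 1` and `2n + 1 < m`, the invariant ring has a
homogeneous system of parameters consisting of `m + 2n − 2` invariants of degree 2,
`3n` invariants of degree 3 and `m − 2n − 1` invariants of degree 6. -/
theorem mV1_nV2_hsop_large_m (m n : ℕ) (hm : 1 ≤ m) (hn : 1 ≤ n) (h : 2 * n + 1 < m) :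
    ∃ P : Fin ((m + 2 * n - 2) + 3 * n + (m - 2 * n - 1)) →
        MvPolynomial (Idx (fun i : Fin (m + n) => if (i : ℕ) < m then 1 else 2)) ℂ,
      IsHSOP (fun i : Fin (m + n) => if (i : ℕ) < m then 1 else 2) P
        (fun j => if (j : ℕ) < m + 2 * n - 2 then 2
          else if (j : ℕ) < (m + 2 * n - 2) + 3 * n then 3 else 6) := by
  obtain ⟨P₀, hP, hdeg, hind, hintegral⟩ := LinQuad.exists_hsop (m := m) (n := n)
    (N₂ := m + 2 * n - 2) (N₃ := 3 * n) (N₆ := m - 2 * n - 1) hn (by omega) rfl (by omega)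
    (by omega)
  obtain ⟨ε, hε⟩ := LinQuad.exists_equiv_degree (m + 2 * n - 2) (3 * n) (m - 2 * n - 1)
  refine ⟨fun j => rename LinQuad.toIdx (P₀ (ε j)),
    fun j => (LinQuad.rename_toIdx_mem_invariantRing _).2 (hP _), fun j => ?_, fun j => ?_,
    (hind.comp ε ε.injective).map' (rename_injective _ LinQuad.toIdx_bijective.1),
    fun x hx => ?_⟩
  · dsimp only
    split_ifs <;> norm_num
  · dsimp only
    rw [← hε]
    exact (hdeg _).rename_isHomogeneous
  · obtain ⟨f, rfl⟩ := rename_surjective _ LinQuad.toIdx_bijective.2 x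
    have hf := LinQuad.isIntegral_adjoin_map (rename LinQuad.toIdx)
      (hintegral f ((LinQuad.rename_toIdx_mem_invariantRing f).1 hx))
    rwa [← Set.range_comp, ← ε.surjective.range_comp] at hf
end
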